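/- Let p1, p2, p3 be three distinct linear primes of height 2 in R, and let K = K1 ∩ p2 ∩ p3, where K1 is a p1-primary ideal with e(R/K1) = 2. If either K = I^un or K = L, then pd(R/I) ≤ 5. -/

import Mathlib

open MvPolynomial Filter CategoryTheory

noncomputable section

/-- The height of an ideal `J`: the infimum of the heights of the prime ideals containing it. -/
def idealHeight {R : Type} [CommRing R] (J : Ideal R) : ℕ∞ :=
  ⨅ p ∈ {p : {q : Ideal R // q.IsPrime} | J ≤ p.1}, Order.height p

/-- `pdQuotLE J n` holds iff `R ⧸ J` admits a projective resolution of length at most `n`,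
i.e. the projective dimension of `R ⧸ J` as an `R`-module is at most `n`. -/
def pdQuotLE {R : Type} [CommRing R] (J : Ideal R) (n : ℕ) : Prop :=
  ∃ P : ProjectiveResolution (ModuleCat.of R (R ⧸ J)),
    ∀ i, n < i → Limits.IsZero (P.complex.X i)

/-- The `p`-primary component of `J` for `p` a minimal prime of `J`:
the saturation of `J` at `p`. -/
def primaryComponent {R : Type} [CommRing R] (J p : Ideal R) : Ideal R :=
  ⨆ (s : R) (_ : s ∉ p), Submodule.colon J (Ideal.span {s})

/-- The unmixed part `J^un` of `J`: the intersection of the primary components of `J`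
corresponding to the minimal primes of `J` of minimal height. -/
def unmixedPart {R : Type} [CommRing R] (J : Ideal R) : Ideal R :=
  ⨅ p ∈ {p : Ideal R | p.IsPrime ∧ J ≤ p ∧ idealHeight p = idealHeight J},
    primaryComponent J p

/-- A linear prime: a prime ideal generated by forms of degree one. -/
def IsLinearPrime {k : Type} [CommSemiring k] {N : ℕ} (p : Ideal (MvPolynomial (Fin N) k)) : Prop :=
  p.IsPrime ∧ ∃ S : Set (MvPolynomial (Fin N) k), (∀ ℓ ∈ S, ℓ.IsHomogeneous 1) ∧ p = Ideal.span S

/-- A homogeneous ideal: an ideal generated by homogeneous elements. -/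
def IsHomogeneousIdeal {k : Type} [CommSemiring k] {N : ℕ}
    (J : Ideal (MvPolynomial (Fin N) k)) : Prop :=
  ∃ S : Set (MvPolynomial (Fin N) k), (∀ g ∈ S, ∃ d, g.IsHomogeneous d) ∧ J = Ideal.span S

/-- `[B]_n`: the ideal generated by all forms of degree `n` belonging to `B`. -/
def degreePart {k : Type} [CommSemiring k] {N : ℕ} (B : Ideal (MvPolynomial (Fin N) k)) (n : ℕ) :
    Ideal (MvPolynomial (Fin N) k) :=
  Ideal.span {f | f ∈ B ∧ f.IsHomogeneous n}

/-- The Hilbert–Samuel function of `R/J` with respect to the irrelevant maximal ideal: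
`n ↦ length (R / (J + 𝔪^n)) = dim_k (R / (J + 𝔪^n))`. -/
def hilbertSamuelFn {k : Type} [Field k] {N : ℕ} (J : Ideal (MvPolynomial (Fin N) k))
    (n : ℕ) : ℕ :=
  Module.finrank k
    (MvPolynomial (Fin N) k ⧸
      (J ⊔ (Ideal.span (Set.range (MvPolynomial.X : Fin N → MvPolynomial (Fin N) k))) ^ n))

/-- `HasMultiplicity J d e`: the quotient `R/J` has Krull dimension `d` and Hilbert–Samuel
multiplicity `e`, expressed through the asymptotics `d! · HS_J(n) / n^d → e` of the
Hilbert–Samuel function. -/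
def HasMultiplicity {k : Type} [Field k] {N : ℕ} (J : Ideal (MvPolynomial (Fin N) k))
    (d e : ℕ) : Prop :=
  Tendsto (fun n : ℕ => (Nat.factorial d : ℝ) * (hilbertSamuelFn J n : ℝ) / (n : ℝ) ^ d)
    atTop (nhds (e : ℝ))

/-- An ideal of `R` is extended from a subalgebra `A` if it is generated by elements of `A`. -/
def extendedFrom {k R : Type} [CommRing k] [CommRing R] [Algebra k R]
    (K : Ideal R) (A : Subalgebra k R) : Prop :=
  ∃ S : Set R, S ⊆ (A : Set R) ∧ K = Ideal.span S


section
open MvPolynomial Filter CategoryTheory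
noncomputable section

/-- Constructor for a projective resolution from exactness data. -/
def mkRes {R : Type} [CommRing R] {Z : ModuleCat.{0} R} (C : ChainComplex (ModuleCat.{0} R) ℕ)
    (hp : ∀ n, Projective (C.X n)) (f : C.X 0 ⟶ Z) (w : C.d 1 0 ≫ f = 0) [Epi f]
    (h0 : (ShortComplex.mk _ _ w).Exact)
    (h1 : ∀ n, (ShortComplex.mk (C.d (n+2) (n+1)) (C.d (n+1) n) (C.d_comp_d _ _ _)).Exact) :
    ProjectiveResolution Z where
  complex := C
  projective := hp
  π := (ChainComplex.toSingle₀Equiv _ _).symm ⟨f, w⟩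
  quasiIso := ⟨fun n => by
    cases n with
    | zero =>
      rw [ChainComplex.quasiIsoAt₀_iff, ShortComplex.quasiIso_iff_of_zeros']
      · refine (ShortComplex.exact_and_epi_g_iff_of_iso ?_).2
          ⟨h0, by dsimp; infer_instance⟩
        exact ShortComplex.isoMk (Iso.refl _) (Iso.refl _) (Iso.refl _)
            ((Category.id_comp _).trans (Category.comp_id _).symm)
            ((Category.id_comp _).trans ((by simp : f = _).trans (Category.comp_id _).symm))
      · exact C.shape 0 0 (by simp)
      · rfl
      · rfl
    | succ n =>
      rw [quasiIsoAt_iff_exactAt']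
      · rw [HomologicalComplex.exactAt_iff' _ (n + 1 + 1) (n + 1) n (by simp) (by simp)]
        exact h1 _
      · apply ChainComplex.exactAt_succ_single_obj⟩

theorem exists_res {R : Type} [CommRing R] (n : ℕ) : ∀ (X : ModuleCat.{0} R),
    HasProjectiveDimensionLT X (n+1) →
    ∃ P : ProjectiveResolution X, ∀ i, n < i → Limits.IsZero (P.complex.X i) := by
  induction n with
  | zero =>
    intro X hX
    have : Projective X := projective_iff_hasProjectiveDimensionLT_one.2 hX
    refine ⟨ProjectiveResolution.self X, fun i hi => ?_⟩
    exact HomologicalComplex.isZero_single_obj_X _ _ _ _ (by omega)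
  | succ n ih =>
    intro X hX
    let S : ShortComplex (ModuleCat.{0} R) :=
      ShortComplex.mk (Limits.kernel.ι (Projective.π X)) (Projective.π X) (by simp)
    have hS : S.ShortExact := { exact := ShortComplex.exact_kernel _ }
    have h2 : HasProjectiveDimensionLT S.X₂ (n+1) := by
      have : HasProjectiveDimensionLT S.X₂ 1 :=
        projective_iff_hasProjectiveDimensionLT_one.1 (Projective.projective_over X)
      exact hasProjectiveDimensionLT_of_ge _ 1 _ (by omega)
    have h1 : HasProjectiveDimensionLT S.X₁ (n+1) := hS.hasProjectiveDimensionLT_X₁ _ h2 hX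
    obtain ⟨P, hP⟩ := ih _ h1
    have w1 : P.complex.d 1 0 ≫ P.π.f 0 = 0 := P.complex_d_comp_π_f_zero
    let g : P.complex.X 0 ⟶ S.X₁ := P.π.f 0
    have hg : Epi g := inferInstanceAs (Epi (P.π.f 0))
    have w : P.complex.d 1 0 ≫ (g ≫ S.f) = 0 := by
      have w2 : P.complex.d 1 0 ≫ g = 0 := w1
      rw [← Category.assoc, w2, Limits.zero_comp]
    have hmono : Mono S.f := hS.mono_f
    have e0 : (ShortComplex.mk (g ≫ S.f) S.g (by simp)).Exact := by
      let α : ShortComplex.mk (g ≫ S.f) S.g (by simp) ⟶ S :=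
        { τ₁ := g
          τ₂ := 𝟙 _
          τ₃ := 𝟙 _ }
      rw [ShortComplex.exact_iff_of_epi_of_isIso_of_mono α]
      exact hS.exact
    have e1 : (ShortComplex.mk (P.complex.d 1 0) (g ≫ S.f) w).Exact := by
      let α : ShortComplex.mk (P.complex.d 1 0) g w1 ⟶
        ShortComplex.mk (P.complex.d 1 0) (g ≫ S.f) w :=
        { τ₁ := 𝟙 _
          τ₂ := 𝟙 _
          τ₃ := S.f }
      rw [← ShortComplex.exact_iff_of_epi_of_isIso_of_mono α]
      exact P.exact₀
    have hE : Epi S.g := hS.epi_g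
    refine ⟨@mkRes R _ X (ChainComplex.augment P.complex (g ≫ S.f) w) ?_ S.g ?_ hE e0 ?_, ?_⟩
    · rintro (_ | i)
      · exact Projective.projective_over X
      · exact P.projective i
    · change (g ≫ S.f) ≫ S.g = 0
      simp
    · rintro (_ | i)
      · exact e1
      · exact P.exact_succ i
    · rintro (_ | i) hi
      · omega
      · exact hP i (by omega)

/-- `pdl M n`: the projective dimension of `M` is at most `n`. -/
def pdl (R : Type) [CommRing R] (M : Type) [AddCommGroup M] [Module R M] (n : ℕ) : Prop :=
  HasProjectiveDimensionLT (ModuleCat.of R M) (n+1)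

section pdl
variable {R : Type} [CommRing R] {M M₁ M₂ M₃ : Type} [AddCommGroup M] [Module R M]
  [AddCommGroup M₁] [Module R M₁] [AddCommGroup M₂] [Module R M₂] [AddCommGroup M₃] [Module R M₃]

theorem pdQuotLE_of_pdl (J : Ideal R) (n : ℕ) (h : pdl R (R ⧸ J) n) : pdQuotLE J n :=
  exists_res n _ h

theorem pdl_mono {n m : ℕ} (h : pdl R M n) (hnm : n ≤ m) : pdl R M m := by
  have : HasProjectiveDimensionLT (ModuleCat.of R M) (n+1) := h
  exact hasProjectiveDimensionLT_of_ge _ (n+1) _ (by omega)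

theorem pdl_equiv {n : ℕ} (e : M₁ ≃ₗ[R] M₂) (h : pdl R M₁ n) : pdl R M₂ n := by
  have : HasProjectiveDimensionLT (ModuleCat.of R M₁) (n+1) := h
  exact hasProjectiveDimensionLT_of_iso e.toModuleIso _

theorem pdl_projective [Module.Projective R M] (n : ℕ) : pdl R M n := by
  refine pdl_mono (n := 0) ?_ (Nat.zero_le n)
  exact projective_iff_hasProjectiveDimensionLT_one.1 inferInstance

theorem ses_aux (f : M₁ →ₗ[R] M₂) (g : M₂ →ₗ[R] M₃) (hf : Function.Injective f)
    (hfg : Function.Exact f g) (hg : Function.Surjective g) :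
    (ModuleCat.shortComplexOfCompEqZero f g hfg.linearMap_comp_eq_zero).ShortExact :=
  ModuleCat.shortComplex_shortExact _ hfg hf hg

theorem pdl_ses2 (f : M₁ →ₗ[R] M₂) (g : M₂ →ₗ[R] M₃) (hf : Function.Injective f)
    (hfg : Function.Exact f g) (hg : Function.Surjective g) {n : ℕ}
    (h1 : pdl R M₁ n) (h3 : pdl R M₃ n) : pdl R M₂ n :=
  (ses_aux f g hf hfg hg).hasProjectiveDimensionLT_X₂ _ h1 h3

theorem pdl_ses3 (f : M₁ →ₗ[R] M₂) (g : M₂ →ₗ[R] M₃) (hf : Function.Injective f)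
    (hfg : Function.Exact f g) (hg : Function.Surjective g) {n : ℕ}
    (h1 : pdl R M₁ n) (h2 : pdl R M₂ (n+1)) : pdl R M₃ (n+1) :=
  (ses_aux f g hf hfg hg).hasProjectiveDimensionLT_X₃ _ h1 h2

theorem pdl_ses1 (f : M₁ →ₗ[R] M₂) (g : M₂ →ₗ[R] M₃) (hf : Function.Injective f)
    (hfg : Function.Exact f g) (hg : Function.Surjective g) {n : ℕ}
    (h2 : pdl R M₂ n) (h3 : pdl R M₃ (n+1)) : pdl R M₁ n :=
  (ses_aux f g hf hfg hg).hasProjectiveDimensionLT_X₁ _ h2 h3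
end pdl

end

end

section
open MvPolynomial Filter CategoryTheory
noncomputable section

section pdl2
variable {R : Type} [CommRing R] {M M₁ M₂ M₃ : Type} [AddCommGroup M] [Module R M]
  [AddCommGroup M₁] [Module R M₁] [AddCommGroup M₂] [Module R M₂] [AddCommGroup M₃] [Module R M₃]

theorem pdl_prod {n : ℕ} (h1 : pdl R M₁ n) (h2 : pdl R M₂ n) : pdl R (M₁ × M₂) n := by
  refine pdl_ses2 (LinearMap.inl R M₁ M₂) (LinearMap.snd R M₁ M₂) LinearMap.inl_injective ?_
    LinearMap.snd_surjective h1 h2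
  exact Function.Exact.inl_snd

theorem pdl_subsingleton [Subsingleton M] (n : ℕ) : pdl R M n := pdl_projective n

variable {B : Type} [CommRing B] [Algebra R B]

theorem pdi_congr {𝔞 𝔟 : Ideal B} (h : 𝔞 = 𝔟) {n : ℕ} (h1 : pdl R 𝔞 n) : pdl R 𝔟 n := h ▸ h1

theorem pdi_top {n : ℕ} (h1 : pdl R B n) : pdl R (⊤ : Ideal B) n :=
  pdl_equiv (Submodule.topEquiv (R := B) (M := B) |>.restrictScalars R).symm h1

theorem pdi_sup {𝔞 𝔟 : Ideal B} {n : ℕ} (h1 : pdl R 𝔞 (n+1)) (h2 : pdl R 𝔟 (n+1))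
    (h3 : pdl R (𝔞 ⊓ 𝔟 : Ideal B) n) : pdl R (𝔞 ⊔ 𝔟 : Ideal B) (n+1) := by
  let f : (𝔞 ⊓ 𝔟 : Ideal B) →ₗ[R] 𝔞 × 𝔟 :=
    { toFun := fun z => (⟨z.1, z.2.1⟩, ⟨-z.1, 𝔟.neg_mem z.2.2⟩)
      map_add' := fun z w => by ext <;> simp <;> ring
      map_smul' := fun r z => by ext <;> simp }
  let g : 𝔞 × 𝔟 →ₗ[R] (𝔞 ⊔ 𝔟 : Ideal B) :=
    { toFun := fun z => ⟨z.1.1 + z.2.1, Submodule.add_mem_sup z.1.2 z.2.2⟩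
      map_add' := fun z w => by ext; simp; ring
      map_smul' := fun r z => by ext; simp }
  refine pdl_ses3 f g ?_ ?_ ?_ h3 (pdl_prod h1 h2)
  · intro z w h
    have := congrArg (fun q => q.1.1) h
    exact Subtype.ext this
  · rintro ⟨⟨z, hz⟩, ⟨w, hw⟩⟩
    constructor
    · intro h
      have h' : z + w = 0 := congrArg Subtype.val h
      have : w = -z := by linear_combination h'
      subst this
      refine ⟨⟨z, hz, by simpa using hw⟩, ?_⟩
      rfl
    · rintro ⟨q, hq⟩
      rw [← hq]
      exact Subtype.ext (by simp [f, g])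
  · rintro ⟨z, hz⟩
    obtain ⟨u, hu, v, hv, rfl⟩ := Submodule.mem_sup.1 hz
    exact ⟨(⟨u, hu⟩, ⟨v, hv⟩), rfl⟩

/-- kernel of a map from an ideal of `R` onto an ideal of `B` -/
theorem pdi_ker {H H' : Ideal R} {𝔠 : Ideal B} (θ : H →ₗ[R] B) (hle : H' ≤ H)
    (h1 : ∀ h, θ h ∈ 𝔠) (h2 : ∀ c ∈ 𝔠, ∃ h, θ h = c)
    (h3 : ∀ h : H, h.1 ∈ H' ↔ θ h = 0) {n : ℕ}
    (hH : pdl R H n) (hc : pdl R 𝔠 (n+1)) : pdl R H' n := by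
  let g : H →ₗ[R] 𝔠 :=
    { toFun := fun z => ⟨θ z, h1 z⟩
      map_add' := fun z w => by ext; simp
      map_smul' := fun r z => by ext; simp }
  refine pdl_ses1 (Submodule.inclusion hle) g (Submodule.inclusion_injective hle) ?_ ?_ hH hc
  · intro z
    constructor
    · intro h
      exact ⟨⟨z.1, (h3 z).2 (congrArg Subtype.val h)⟩, rfl⟩
    · rintro ⟨w, rfl⟩
      exact Subtype.ext ((h3 _).1 w.2)
  · rintro ⟨c, hc⟩
    obtain ⟨h, rfl⟩ := h2 c hc
    exact ⟨h, rfl⟩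

theorem pdl_quot {J : Ideal R} {n : ℕ} (h : pdl R J n) : pdl R (R ⧸ J) (n+1) :=
  pdl_ses3 (Submodule.subtype J) (Submodule.mkQ J) (Submodule.subtype_injective J)
    (LinearMap.exact_subtype_mkQ J) (Submodule.mkQ_surjective J) h (pdl_projective _)

variable [IsDomain B]

theorem pdi_mul (c : B) {𝔞 : Ideal B} {n : ℕ} (h1 : pdl R 𝔞 n) :
    pdl R (Ideal.span {c} * 𝔞 : Ideal B) n := by
  by_cases hc : c = 0
  · subst hc
    have : Ideal.span {(0:B)} * 𝔞 = ⊥ := by simp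
    rw [this]
    exact pdl_subsingleton n
  let f : 𝔞 →ₗ[R] (Ideal.span {c} * 𝔞 : Ideal B) :=
    { toFun := fun z => ⟨c * z.1, Ideal.mem_span_singleton_mul.2 ⟨z.1, z.2, rfl⟩⟩
      map_add' := fun z w => by ext; simp; ring
      map_smul' := fun r z => by ext; simp }
  refine pdl_equiv (LinearEquiv.ofBijective f ⟨?_, ?_⟩) h1
  · intro z w h
    have := congrArg Subtype.val h
    exact Subtype.ext (mul_left_cancel₀ hc this)
  · rintro ⟨z, hz⟩
    obtain ⟨u, hu, rfl⟩ := Ideal.mem_span_singleton_mul.1 hz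
    exact ⟨⟨u, hu⟩, rfl⟩

end pdl2

theorem exists_gcd2 {B : Type} [CommRing B] [IsDomain B] [UniqueFactorizationMonoid B] (a b : B) :
    ∃ d a' b', a = d * a' ∧ b = d * b' ∧ IsRelPrime a' b' := by
  letI : GCDMonoid B := UniqueFactorizationMonoid.toGCDMonoid B
  obtain ⟨a', b', h1, h2, h3⟩ := extract_gcd a b
  refine ⟨_, a', b', h1, h2, ?_⟩
  intro d hda hdb
  exact isUnit_of_dvd_unit (dvd_gcd hda hdb) h3

section pdl3
variable {R : Type} [CommRing R] {B : Type} [CommRing B] [Algebra R B]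
  [IsDomain B] [UniqueFactorizationMonoid B]

theorem span_pair_mul (a b : B) (𝔞 : Ideal B) :
    Ideal.span {a, b} * 𝔞 = Ideal.span {a} * 𝔞 ⊔ Ideal.span {b} * 𝔞 := by
  rw [Ideal.span_insert, Ideal.sup_mul]

theorem mul_inf_mul {a b : B} (hab : IsRelPrime a b) {𝔞 𝔠 : Ideal B}
    (hc : ∀ c, c ∈ 𝔠 ↔ a * c ∈ 𝔞 ∧ b * c ∈ 𝔞) :
    Ideal.span {a} * 𝔞 ⊓ Ideal.span {b} * 𝔞 = Ideal.span {a * b} * 𝔠 := by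
  ext z
  constructor
  · rintro ⟨h1, h2⟩
    obtain ⟨u, hu, rfl⟩ := Ideal.mem_span_singleton_mul.1 h1
    obtain ⟨v, hv, h⟩ := Ideal.mem_span_singleton_mul.1 h2
    by_cases ha : a = 0
    · subst ha; simp
    obtain ⟨w, rfl⟩ : a ∣ v := hab.dvd_of_dvd_mul_left ⟨u, h⟩
    have hu' : u = b * w := mul_left_cancel₀ ha (by linear_combination -h)
    subst hu'
    exact Ideal.mem_span_singleton_mul.2 ⟨w, (hc w).2 ⟨hv, hu⟩, by ring⟩
  · intro h
    obtain ⟨w, hw, rfl⟩ := Ideal.mem_span_singleton_mul.1 h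
    obtain ⟨h1, h2⟩ := (hc w).1 hw
    exact ⟨Ideal.mem_span_singleton_mul.2 ⟨_, h2, by ring⟩,
      Ideal.mem_span_singleton_mul.2 ⟨_, h1, by ring⟩⟩

theorem pdi_pair {a b : B} (hab : IsRelPrime a b) {𝔞 𝔠 : Ideal B}
    (hc : ∀ c, c ∈ 𝔠 ↔ a * c ∈ 𝔞 ∧ b * c ∈ 𝔞) {n : ℕ}
    (h1 : pdl R 𝔞 (n+1)) (h2 : pdl R 𝔠 n) :
    pdl R (Ideal.span {a, b} * 𝔞 : Ideal B) (n+1) := by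
  rw [span_pair_mul]
  refine pdi_sup (pdi_mul a h1) (pdi_mul b h1) ?_
  rw [mul_inf_mul hab hc]
  exact pdi_mul _ h2

theorem pdi_two {n : ℕ} (hB : pdl R B n) (a b : B) : pdl R (Ideal.span {a, b} : Ideal B) (n+1) := by
  obtain ⟨d, a', b', rfl, rfl, h⟩ := exists_gcd2 a b
  have : Ideal.span {d * a', d * b'} = Ideal.span {d} * (Ideal.span {a', b'} * ⊤) := by
    rw [Ideal.mul_top, Ideal.span_mul_span]
    congr 1
    ext z
    simp [eq_comm]
  rw [this]
  refine pdi_mul d (pdi_pair h (𝔠 := ⊤) (by simp) (pdl_mono (pdi_top hB) (by omega)) (pdi_top hB))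

theorem pdi_one {n : ℕ} (hB : pdl R B n) (a : B) : pdl R (Ideal.span {a} : Ideal B) n := by
  have : Ideal.span {a} = Ideal.span {a} * ⊤ := by rw [Ideal.mul_top]
  rw [this]
  exact pdi_mul _ (pdi_top hB)

theorem span_factor (d a' b' : B) : Ideal.span {d * a', d * b'} = Ideal.span {d} * Ideal.span {a', b'} := by
    rw [Ideal.span_mul_span]
    congr 1
    ext z
    simp [eq_comm]

theorem pdi_pair_prime {n : ℕ} (hB : pdl R B n) {𝔞 : Ideal B} (hp : 𝔞.IsPrime)
   (h : pdl R 𝔞 (n+1)) (a b : B) : pdl R (Ideal.span {a, b} * 𝔞 : Ideal B) (n+2) := by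
  obtain ⟨d, a', b', rfl, rfl, hr⟩ := exists_gcd2 a b
  rw [span_factor, mul_assoc]
  refine pdi_mul d ?_
  by_cases hm : a' ∈ 𝔞 ∧ b' ∈ 𝔞
  · refine pdi_pair (𝔠 := ⊤) hr ?_ (pdl_mono h (by omega)) (pdl_mono (pdi_top hB) (by omega))
    intro c
    simp [𝔞.mul_mem_right c hm.1, 𝔞.mul_mem_right c hm.2]
  · refine pdi_pair (𝔠 := 𝔞) hr ?_ (pdl_mono h (by omega)) h
    intro c
    constructor
    · intro hc
      exact ⟨𝔞.mul_mem_left _ hc, 𝔞.mul_mem_left _ hc⟩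
    · rintro ⟨h1, h2⟩
      by_contra hc
      exact hm ⟨(hp.mem_or_mem h1).resolve_right hc, (hp.mem_or_mem h2).resolve_right hc⟩
end pdl3

theorem pdl_final {R : Type} [CommRing R] [IsDomain R] [UniqueFactorizationMonoid R]
    (f₁ f₂ f₃ : R) (L : Ideal R) (hL : ∀ r, r ∈ L ↔ r * f₃ ∈ Ideal.span {f₁, f₂})
    (h : pdl R L 3) : pdl R (R ⧸ Ideal.span {f₁, f₂, f₃}) 5 := by
  have hF : pdl R (R ⧸ Ideal.span {f₁, f₂}) 2 := pdl_quot (pdi_two (pdl_projective 0) _ _)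
  have hle : Ideal.span {f₁, f₂} ≤ Ideal.span {f₁, f₂, f₃} := by
    apply Ideal.span_mono; intro z; simp; tauto
  let f : (R ⧸ L) →ₗ[R] (R ⧸ Ideal.span {f₁, f₂}) :=
    Submodule.mapQ L (Ideal.span {f₁, f₂}) (LinearMap.mulRight R f₃) (fun r hr => (hL r).1 hr)
  let g : (R ⧸ Ideal.span {f₁, f₂}) →ₗ[R] (R ⧸ Ideal.span {f₁, f₂, f₃}) :=
    Submodule.mapQ _ _ LinearMap.id hle
  have hfm : ∀ r : R, f (Submodule.Quotient.mk r) = Submodule.Quotient.mk (r * f₃) := fun _ => rfl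
  have hgm : ∀ r : R, g (Submodule.Quotient.mk r) = Submodule.Quotient.mk r := fun _ => rfl
  refine pdl_ses3 f g ?_ ?_ ?_ (pdl_quot h) (pdl_mono hF (by omega))
  · rw [injective_iff_map_eq_zero]
    intro z hz
    obtain ⟨r, rfl⟩ := Submodule.Quotient.mk_surjective _ z
    have : r * f₃ ∈ Ideal.span {f₁, f₂} := by
      rwa [hfm, Submodule.Quotient.mk_eq_zero] at hz
    exact (Submodule.Quotient.mk_eq_zero _).2 ((hL r).2 this)
  · intro z
    obtain ⟨r, rfl⟩ := Submodule.Quotient.mk_surjective _ z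
    constructor
    · intro hz
      have h1 : r ∈ Ideal.span {f₁, f₂, f₃} := by
        rwa [hgm, Submodule.Quotient.mk_eq_zero] at hz
      have h2 : Ideal.span {f₁, f₂, f₃} = Ideal.span {f₃} ⊔ Ideal.span {f₁, f₂} := by
        rw [← Ideal.span_union]; congr 1; ext z; simp
      rw [h2] at h1
      obtain ⟨u, hu, v, hv, rfl⟩ := Submodule.mem_sup.1 h1
      obtain ⟨c, rfl⟩ := Ideal.mem_span_singleton'.1 hu
      refine ⟨Submodule.Quotient.mk c, ?_⟩
      rw [hfm, Submodule.Quotient.eq]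
      have : c * f₃ - (c * f₃ + v) = -v := by simp
      rw [this]
      exact neg_mem hv
    · rintro ⟨w, hw⟩
      obtain ⟨c, rfl⟩ := Submodule.Quotient.mk_surjective _ w
      rw [← hw]
      rw [hfm, hgm, Submodule.Quotient.mk_eq_zero]
      exact Ideal.mul_mem_left _ _ (Ideal.subset_span (by simp))
  · intro z
    obtain ⟨r, rfl⟩ := Submodule.Quotient.mk_surjective _ z
    exact ⟨Submodule.Quotient.mk r, rfl⟩

end

end

section
open MvPolynomial Filter CategoryTheory
noncomputable section

section lin
variable {k : Type} [Field k] {N m l : ℕ}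

/-- the linear form with given coefficients -/
def lin : (Fin N → k) →ₗ[k] MvPolynomial (Fin N) k :=
  Fintype.linearCombination k (fun i => (X i : MvPolynomial (Fin N) k))

theorem lin_apply (v : Fin N → k) : lin v = ∑ i, v i • (X i : MvPolynomial (Fin N) k) := rfl

theorem lin_single (i : Fin N) : lin (Pi.single i (1:k)) = X i := by
  simp [lin_apply, Pi.single_apply]

theorem lin_coeff (v : Fin N → k) (i : Fin N) : (lin v).coeff (Finsupp.single i 1) = v i := by
  rw [lin_apply, MvPolynomial.coeff_sum]
  simp only [coeff_smul, coeff_X', Finsupp.single_left_inj (one_ne_zero)]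
  simp

theorem lin_injective : Function.Injective (lin : (Fin N → k) → MvPolynomial (Fin N) k) := by
  intro v w h
  ext i
  rw [← lin_coeff v i, h, lin_coeff]

theorem lin_eq_zero {v : Fin N → k} : lin v = 0 ↔ v = 0 := by
  constructor
  · intro h; exact lin_injective (by rw [h, map_zero])
  · rintro rfl; simp

theorem lin_homog (v : Fin N → k) : (lin v).IsHomogeneous 1 := by
  rw [lin_apply]
  refine IsHomogeneous.sum _ _ _ (fun i _ => ?_)
  rw [MvPolynomial.smul_eq_C_mul]
  simpa using (isHomogeneous_C (Fin N) (v i)).mul (isHomogeneous_X k i)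

theorem exists_lin {f : MvPolynomial (Fin N) k} (hf : f.IsHomogeneous 1) : ∃ v, f = lin v := by
  refine ⟨fun i => f.coeff (Finsupp.single i 1), ?_⟩
  ext d
  by_cases hd : d.degree = 1
  · obtain ⟨i, rfl⟩ : ∃ i, d = Finsupp.single i 1 := by
      have h : d ∈ Set.range (fun a : Fin N => Finsupp.single a 1) := by
        rw [Finsupp.range_single_one]; exact hd
      obtain ⟨i, rfl⟩ := h
      exact ⟨i, rfl⟩
    rw [lin_coeff]
  · rw [hf.coeff_eq_zero hd, (lin_homog _).coeff_eq_zero hd]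

/-- linear substitution -/
def sub (φ : (Fin N → k) →ₗ[k] (Fin m → k)) :
    MvPolynomial (Fin N) k →ₐ[k] MvPolynomial (Fin m) k :=
  aeval (fun i => lin (φ (Pi.single i 1)))

theorem sub_X (φ : (Fin N → k) →ₗ[k] (Fin m → k)) (i) : sub φ (X i) = lin (φ (Pi.single i 1)) := by
  simp [sub]

theorem sub_lin (φ : (Fin N → k) →ₗ[k] (Fin m → k)) (v) : sub φ (lin v) = lin (φ v) := by
  have : (sub φ).toLinearMap ∘ₗ lin = lin ∘ₗ φ := by
    refine LinearMap.pi_ext' (fun i => ?_)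
    ext1
    simp only [LinearMap.comp_apply, LinearMap.single_apply, lin_single, AlgHom.toLinearMap_apply, sub_X]
  exact LinearMap.congr_fun this v

theorem sub_comp (φ : (Fin N → k) →ₗ[k] (Fin m → k)) (ψ : (Fin m → k) →ₗ[k] (Fin l → k)) (f) :
    sub ψ (sub φ f) = sub (ψ ∘ₗ φ) f := by
  have : (sub ψ).comp (sub φ) = sub (ψ ∘ₗ φ) := by
    ext i
    simp [sub_X, sub_lin]
  exact AlgHom.congr_fun this f

theorem sub_id (f : MvPolynomial (Fin N) k) : sub LinearMap.id f = f := by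
  have : sub (LinearMap.id : (Fin N → k) →ₗ[k] _) = AlgHom.id _ _ := by
    ext i
    simp [sub_X, lin_single]
  exact AlgHom.congr_fun this f

theorem sub_homog (φ : (Fin N → k) →ₗ[k] (Fin m → k)) {f : MvPolynomial (Fin N) k} {d : ℕ}
    (hf : f.IsHomogeneous d) : (sub φ f).IsHomogeneous d := by
  have := hf.aeval (fun i => lin (φ (Pi.single i 1))) (fun i => lin_homog _)
  simpa [sub] using this

/-- the ideal generated by a space of linear forms -/
def ip (U : Submodule k (Fin N → k)) : Ideal (MvPolynomial (Fin N) k) := Ideal.span (lin '' U)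

theorem ip_mono {U W : Submodule k (Fin N → k)} (h : U ≤ W) : ip U ≤ ip W :=
  Ideal.span_mono (Set.image_mono h)

theorem lin_mem_ip' {U : Submodule k (Fin N → k)} {v} (h : v ∈ U) : lin v ∈ ip U :=
  Ideal.subset_span ⟨v, h, rfl⟩

theorem ip_span (s : Set (Fin N → k)) : ip (Submodule.span k s) = Ideal.span (lin '' s) := by
  apply le_antisymm
  · rw [ip, Ideal.span_le]
    rintro _ ⟨v, hv, rfl⟩
    induction hv using Submodule.span_induction with
    | mem x h => exact Ideal.subset_span ⟨x, h, rfl⟩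
    | zero => simp
    | add x y _ _ h1 h2 => rw [map_add]; exact add_mem h1 h2
    | smul a x _ h =>
      rw [map_smul, MvPolynomial.smul_eq_C_mul]
      exact Ideal.mul_mem_left _ _ h
  · exact Ideal.span_mono (Set.image_mono Submodule.subset_span)

theorem ip_sup (U W : Submodule k (Fin N → k)) : ip (U ⊔ W) = ip U ⊔ ip W := by
  conv_lhs => rw [← Submodule.span_eq U, ← Submodule.span_eq W, ← Submodule.span_union, ip_span]
  rw [Set.image_union, Ideal.span_union]
  rfl

theorem ip_pair (x y : Fin N → k) : ip (Submodule.span k {x, y}) = Ideal.span {lin x, lin y} := by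
  rw [ip_span, Set.image_pair]

theorem ip_single (x : Fin N → k) : ip (Submodule.span k {x}) = Ideal.span {lin x} := by
  rw [ip_span, Set.image_singleton]

theorem sub_ip (φ : (Fin N → k) →ₗ[k] (Fin m → k)) {U : Submodule k (Fin N → k)}
    {W : Submodule k (Fin m → k)} (h : ∀ v ∈ U, φ v ∈ W) {f} (hf : f ∈ ip U) : sub φ f ∈ ip W := by
  have : ip U ≤ Ideal.comap (sub φ) (ip W) := by
    rw [ip, Ideal.span_le]
    rintro _ ⟨v, hv, rfl⟩
    simp only [SetLike.mem_coe, Ideal.mem_comap, sub_lin]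
    exact lin_mem_ip' (h v hv)
  exact this hf

theorem ip_bot : ip (⊥ : Submodule k (Fin N → k)) = ⊥ := by
  simp [ip]

/-- An endomorphism which is the identity modulo `U` induces the identity modulo `ip U`. -/
theorem sub_sub_mem (φ : (Fin N → k) →ₗ[k] (Fin N → k)) {U : Submodule k (Fin N → k)}
    (h : ∀ v, φ v - v ∈ U) (f) : sub φ f - f ∈ ip U := by
  have : (Ideal.Quotient.mkₐ k (ip U)).comp (sub φ) = (Ideal.Quotient.mkₐ k (ip U)) := by
    ext i
    simp only [AlgHom.comp_apply, Ideal.Quotient.mkₐ_eq_mk]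
    rw [Ideal.Quotient.eq, sub_X, ← lin_single, ← map_sub]
    exact lin_mem_ip' (h _)
  have := AlgHom.congr_fun this f
  simpa [Ideal.Quotient.eq] using this

/-- projection data for a subspace -/
theorem exists_proj (U : Submodule k (Fin N → k)) : ∃ (m : ℕ) (φ : (Fin N → k) →ₗ[k] (Fin m → k))
    (σ : (Fin m → k) →ₗ[k] (Fin N → k)), m + Module.finrank k U = N ∧
      LinearMap.ker φ = U ∧ (∀ w, φ (σ w) = w) := by
  have h0 := U.finrank_quotient_add_finrank
  simp only [Module.finrank_fintype_fun_eq_card, Fintype.card_fin] at h0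
  have h1 : Module.finrank k ((Fin N → k) ⧸ U) =
      Module.finrank k (Fin (Module.finrank k ((Fin N → k) ⧸ U)) → k) := by
    simp
  let e := LinearEquiv.ofFinrankEq _ _ h1
  let φ := e.toLinearMap ∘ₗ U.mkQ
  have hs : LinearMap.range φ = ⊤ := by
    rw [LinearMap.range_eq_top]
    exact e.surjective.comp (Submodule.mkQ_surjective U)
  obtain ⟨σ, hσ⟩ := φ.exists_rightInverse_of_surjective hs
  refine ⟨_, φ, σ, h0, ?_, fun w => LinearMap.congr_fun hσ w⟩
  rw [LinearMap.ker_comp, LinearEquiv.ker, Submodule.comap_bot, Submodule.ker_mkQ]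

theorem ker_sub {U : Submodule k (Fin N → k)} {φ : (Fin N → k) →ₗ[k] (Fin m → k)}
    {σ : (Fin m → k) →ₗ[k] (Fin N → k)} (h1 : LinearMap.ker φ = U) (h2 : ∀ w, φ (σ w) = w)
    (f) : sub φ f = 0 ↔ f ∈ ip U := by
  constructor
  · intro h
    have := sub_sub_mem (σ ∘ₗ φ) (U := U) (fun v => by
      rw [← h1, LinearMap.mem_ker]; simp [h2]) f
    rw [← sub_comp, h, map_zero, zero_sub] at this
    simpa using this
  · intro h
    have := sub_ip φ (U := U) (W := ⊥) (fun v hv => by rw [← h1] at hv; simpa using hv) h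
    rwa [ip_bot] at this

theorem sub_surj {φ : (Fin N → k) →ₗ[k] (Fin m → k)}
    {σ : (Fin m → k) →ₗ[k] (Fin N → k)} (h2 : ∀ w, φ (σ w) = w) (f) : sub φ (sub σ f) = f := by
  rw [sub_comp]
  have : φ ∘ₗ σ = LinearMap.id := LinearMap.ext h2
  rw [this, sub_id]

theorem ip_prime (U : Submodule k (Fin N → k)) : (ip U).IsPrime := by
  obtain ⟨m, φ, σ, -, h1, h2⟩ := exists_proj U
  have : ip U = RingHom.ker (sub φ) := by
    ext f; rw [RingHom.mem_ker, ker_sub h1 h2]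
  rw [this]
  exact RingHom.ker_isPrime _

instance (U : Submodule k (Fin N → k)) : (ip U).IsPrime := ip_prime U

theorem ufd_of_surj {A B : Type} [CommRing A] [CommRing B] [IsDomain B] [UniqueFactorizationMonoid B]
    (I : Ideal A) (f : A →+* B) (hf : Function.Surjective f) (h : I = RingHom.ker f) :
    UniqueFactorizationMonoid (A ⧸ I) := by
  subst h
  exact (RingHom.quotientKerEquivOfSurjective hf).symm.toMulEquiv.uniqueFactorizationMonoid inferInstance

instance (U : Submodule k (Fin N → k)) : UniqueFactorizationMonoid (MvPolynomial (Fin N) k ⧸ ip U) := by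
  obtain ⟨m, φ, σ, -, h1, h2⟩ := exists_proj U
  refine ufd_of_surj (ip U) (sub φ).toRingHom (fun f => ⟨sub σ f, sub_surj h2 f⟩) ?_
  ext f
  rw [RingHom.mem_ker]
  exact (ker_sub h1 h2 f).symm

theorem lin_mem_ip {U : Submodule k (Fin N → k)} {v} : lin v ∈ ip U ↔ v ∈ U := by
  obtain ⟨m, φ, σ, -, h1, h2⟩ := exists_proj U
  rw [← ker_sub h1 h2, sub_lin, lin_eq_zero, ← h1, LinearMap.mem_ker]

theorem ip_le_iff {U W : Submodule k (Fin N → k)} : ip U ≤ ip W ↔ U ≤ W := by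
  constructor
  · intro h v hv
    exact lin_mem_ip.1 (h (lin_mem_ip' hv))
  · exact ip_mono

theorem exists_ip_of_linearPrime {p : Ideal (MvPolynomial (Fin N) k)} (hp : IsLinearPrime p) :
    ∃ U, p = ip U := by
  obtain ⟨-, S, hS, rfl⟩ := hp
  refine ⟨Submodule.span k (lin ⁻¹' S), ?_⟩
  rw [ip_span, Set.image_preimage_eq_of_subset]
  intro f hf
  obtain ⟨v, rfl⟩ := exists_lin (hS f hf)
  exact ⟨v, rfl⟩

end lin
end

end

section
open MvPolynomial Filter CategoryTheory
noncomputable section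

theorem idealHeight_eq {R : Type} [CommRing R] (J : Ideal R) : idealHeight J = J.height := by
  have key : ∀ (q : {q : Ideal R // q.IsPrime}), Order.height q = q.1.height := by
    intro q
    have hq := q.2
    let e : PrimeSpectrum R ≃o {q : Ideal R // q.IsPrime} :=
      { toFun := fun p => ⟨p.1, p.2⟩
        invFun := fun p => ⟨p.1, p.2⟩
        left_inv := fun _ => rfl
        right_inv := fun _ => rfl
        map_rel_iff' := Iff.rfl }
    have := Order.height_orderIso e ⟨q.1, q.2⟩
    have h2 := PrimeSpectrum.height_eq_orderHeight (⟨q.1, q.2⟩ : PrimeSpectrum R)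
    simp only at h2
    rw [h2, ← this]
    rfl
  unfold idealHeight
  apply le_antisymm
  · rw [Ideal.height_eq_inf_minimalPrimes]
    refine le_iInf₂ (fun p hp => ?_)
    have hpp := hp.1.1
    refine (iInf₂_le (⟨p, hpp⟩ : {q : Ideal R // q.IsPrime}) hp.1.2).trans ?_
    rw [key]
  · refine le_iInf₂ (fun p hp => ?_)
    rw [key]
    exact Ideal.height_mono hp

theorem height_le_two {R : Type} [CommRing R] [IsNoetherianRing R] {a b : R}
    (h : Ideal.span {a, b} ≠ ⊤) : (Ideal.span {a, b}).height ≤ 2 := by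
  refine (Ideal.height_le_spanFinrank _ h).trans ?_
  refine (Submodule.spanFinrank_span_le_encard _).trans ?_
  exact (Set.encard_insert_le _ _).trans (by rw [Set.encard_singleton]; norm_num)

theorem relprime_of_height {R : Type} [CommRing R] [IsDomain R] [UniqueFactorizationMonoid R] [IsNoetherianRing R] {a b : R}
    (h : (Ideal.span {a, b}).height = 2) : IsRelPrime a b ∧ a ≠ 0 ∧ b ≠ 0 := by
  have key : ∀ c : R, c ∣ a → c ∣ b → IsUnit c := by
    intro c h1 h2
    by_contra hc
    have hle : Ideal.span {a, b} ≤ Ideal.span {c} := by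
      rw [Ideal.span_le]
      rintro z (rfl | rfl)
      · exact Ideal.mem_span_singleton.2 h1
      · exact Ideal.mem_span_singleton.2 h2
    have := (Ideal.height_mono hle).trans (Ideal.height_span_singleton_le_one hc)
    rw [h] at this
    exact absurd this (by decide)
  have hu : ¬ (IsUnit a) := by
    intro hu
    rw [Ideal.eq_top_of_isUnit_mem _ (Ideal.subset_span (by simp)) hu, Ideal.height_top] at h
    exact absurd h (by decide)
  have hv : ¬ (IsUnit b) := by
    intro hu
    rw [Ideal.eq_top_of_isUnit_mem _ (Ideal.subset_span (by simp)) hu, Ideal.height_top] at h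
    exact absurd h (by decide)
  refine ⟨key, ?_, ?_⟩
  · rintro rfl
    exact hv (key b (by simp) dvd_rfl)
  · rintro rfl
    exact hu (key a dvd_rfl (by simp))

section lin
variable {k : Type} [Field k] {N m l : ℕ}

theorem le_height_ip (n : ℕ) : ∀ (U : Submodule k (Fin N → k)), n ≤ Module.finrank k U → (n : ℕ∞) ≤ (ip U).height := by
  induction n with
  | zero => intro U _; simp
  | succ n ih =>
    intro U hU
    obtain ⟨r, hr⟩ : ∃ r, Module.finrank k U = r + 1 := ⟨Module.finrank k U - 1, by omega⟩
    let b := Module.finBasisOfFinrankEq k U hr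
    let W : Submodule k (Fin N → k) := Submodule.span k (Set.range (fun i : Fin r => (b i.succ : Fin N → k)))
    have hli : LinearIndependent k (fun i : Fin (r+1) => (b i : Fin N → k)) :=
      b.linearIndependent.map' U.subtype (Submodule.ker_subtype U)
    have hW : Module.finrank k W = r := by
      have := finrank_span_eq_card (hli.comp Fin.succ (Fin.succ_injective r))
      rw [Fintype.card_fin] at this
      exact this
    have hlt : W < U := by
      refine lt_of_le_of_ne ?_ ?_
      · rw [Submodule.span_le]
        rintro _ ⟨i, rfl⟩
        exact (b i.succ).2
      · rintro h
        rw [h] at hW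
        omega
    have h2 : ip W < ip U := by
      rw [lt_iff_le_not_ge] at hlt ⊢
      simpa [ip_le_iff] using hlt
    have h3 := ih W (by omega)
    have h4 := Ideal.height_add_one_le_of_lt_of_isPrime h2
    calc ((n+1 : ℕ) : ℕ∞) = (n : ℕ∞) + 1 := by push_cast; rfl
      _ ≤ (ip W).height + 1 := by gcongr
      _ ≤ _ := h4

theorem height_ip_le (U : Submodule k (Fin N → k)) : (ip U).height ≤ Module.finrank k U := by
  let b := Module.finBasis k U
  have hU : U = Submodule.span k (Set.range (fun i => (b i : Fin N → k))) := by
    have := b.span_eq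
    have h2 := congrArg (Submodule.map U.subtype) this
    rw [Submodule.map_span, Submodule.map_top, Submodule.range_subtype, ← Set.range_comp] at h2
    exact h2.symm
  have h1 : ip U = Ideal.span (lin '' (Set.range (fun i => (b i : Fin N → k)))) := by
    conv_lhs => rw [hU]
    rw [ip_span]
  refine (Ideal.height_le_spanFinrank _ (ip_prime U).ne_top).trans ?_
  rw [h1]
  refine (Submodule.spanFinrank_span_le_encard _).trans ?_
  refine (Set.encard_image_le _ _).trans ?_
  rw [← Set.image_univ]
  refine (Set.encard_image_le _ _).trans ?_
  simp

theorem finrank_of_height {U : Submodule k (Fin N → k)} (h : (ip U).height = 2) : Module.finrank k U = 2 := by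
  have h1 := height_ip_le U
  rw [h] at h1
  have h2 := le_height_ip _ U le_rfl
  rw [h] at h2
  have h1' : 2 ≤ Module.finrank k U := by exact_mod_cast h1
  have h2' : Module.finrank k U ≤ 2 := by exact_mod_cast h2
  omega

/-- primes in quotients -/
theorem prime_mk_lin {U : Submodule k (Fin N → k)} {v : Fin N → k} (hv : v ∉ U) :
    Prime (Ideal.Quotient.mk (ip U) (lin v)) := by
  rw [← Ideal.span_singleton_prime]
  · have h1 : Ideal.span {Ideal.Quotient.mk (ip U) (lin v)} =
        (ip (U ⊔ Submodule.span k {v})).map (Ideal.Quotient.mk (ip U)) := by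
      rw [ip_sup, Ideal.map_sup, Ideal.map_quotient_self, bot_sup_eq, ip_single, Ideal.map_span, Set.image_singleton]
    rw [h1]
    refine Ideal.map_isPrime_of_surjective Ideal.Quotient.mk_surjective ?_
    rw [Ideal.mk_ker]
    exact ip_mono le_sup_left
  · rw [Ne, Ideal.Quotient.eq_zero_iff_mem, lin_mem_ip]
    exact hv

theorem mk_dvd_mk {R : Type} [CommRing R] {I : Ideal R} {a b : R} :
    Ideal.Quotient.mk I a ∣ Ideal.Quotient.mk I b ↔ b ∈ I ⊔ Ideal.span {a} := by
  rw [← Ideal.mem_span_singleton]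
  have : Ideal.span {Ideal.Quotient.mk I a} = Ideal.map (Ideal.Quotient.mk I) (Ideal.span {a}) := by
    rw [Ideal.map_span, Set.image_singleton]
  rw [this, Ideal.mem_quotient_iff_mem_sup, sup_comm]

theorem mk_lin_dvd {U : Submodule k (Fin N → k)} {v : Fin N → k} {b} :
    Ideal.Quotient.mk (ip U) (lin v) ∣ Ideal.Quotient.mk (ip U) b ↔ b ∈ ip (U ⊔ Submodule.span k {v}) := by
  rw [mk_dvd_mk, ip_sup, ip_single]

theorem prime_lin {v : Fin N → k} (hv : v ≠ 0) : Prime (lin v) := by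
  rw [← Ideal.span_singleton_prime (by rwa [Ne, lin_eq_zero]), ← ip_single]
  exact ip_prime _

theorem lin_dvd {v : Fin N → k} {b} : lin v ∣ b ↔ b ∈ ip (Submodule.span k {v}) := by
  rw [ip_single, Ideal.mem_span_singleton]

theorem relprime_mk_lin {U : Submodule k (Fin N → k)} {v w : Fin N → k} (hv : v ∉ U)
    (hw : w ∉ U ⊔ Submodule.span k {v}) :
    IsRelPrime (Ideal.Quotient.mk (ip U) (lin v)) (Ideal.Quotient.mk (ip U) (lin w)) := by
  rw [(prime_mk_lin hv).irreducible.isRelPrime_iff_not_dvd, mk_lin_dvd, lin_mem_ip]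
  exact hw

theorem relprime_lin {v w : Fin N → k} (hv : v ≠ 0)
    (hw : w ∉ Submodule.span k {v}) : IsRelPrime (lin v) (lin w) := by
  rw [(prime_lin hv).irreducible.isRelPrime_iff_not_dvd, lin_dvd, lin_mem_ip]
  exact hw
end lin
end

end

section
open MvPolynomial Filter CategoryTheory
noncomputable section

theorem um_poly {C : Type} [CommRing C] [IsDomain C] [UniqueFactorizationMonoid C] [IsNoetherianRing C]
    (f₁ f₂ w : Polynomial C) (hm : f₁.Monic) (hrel : IsRelPrime f₁ f₂) (h2 : f₂ ≠ 0)
    (P : Ideal (Polynomial C)) [hPp : P.IsPrime]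
    (hP : ∀ r, r ∈ P ↔ r * w ∈ Ideal.span {f₁, f₂}) : P.height ≤ 2 := by
  let A := AdjoinRoot f₁
  let mk : Polynomial C →+* A := AdjoinRoot.mk f₁
  have hsurj : Function.Surjective mk := AdjoinRoot.mk_surjective
  have hmk : ∀ r, mk r = 0 ↔ f₁ ∣ r := fun r => AdjoinRoot.mk_eq_zero
  let B := (AdjoinRoot.powerBasis' hm).basis
  have hIntg : ∀ a : A, IsIntegral C a := by
    have : Module.Finite C A := hm.finite_adjoinRoot
    intro a
    exact Algebra.IsIntegral.isIntegral a
  have f1ne : f₁ ≠ 0 := hm.ne_zero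
  have hf1P : f₁ ∈ P := by
    rw [hP]; exact Ideal.mul_mem_right _ _ (Ideal.subset_span (by simp))
  -- f2 is a nonzerodivisor
  have nzd : ∀ {x : A}, x * mk f₂ = 0 → x = 0 := by
    intro x hx
    obtain ⟨x, rfl⟩ := hsurj x
    rw [← map_mul, hmk] at hx
    rw [hmk]
    exact hrel.dvd_of_dvd_mul_right hx
  have hP' : ∀ r, r ∈ P ↔ mk f₂ ∣ mk r * mk w := by
    intro r
    rw [hP, Ideal.mem_span_pair]
    constructor
    · rintro ⟨a, b, h⟩
      refine ⟨mk b, ?_⟩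
      rw [← map_mul, ← h, map_add, map_mul, map_mul, (hmk f₁).2 dvd_rfl]; ring
    · rintro ⟨b, h⟩
      obtain ⟨b, rfl⟩ := hsurj b
      rw [← map_mul, ← map_mul, ← sub_eq_zero, ← map_sub, hmk] at h
      obtain ⟨a, h⟩ := h
      exact ⟨a, b, by linear_combination -h⟩
  obtain ⟨q, hq, hq0⟩ := hIntg (mk f₂)
  obtain ⟨i, hi0, hi⟩ := Ideal.exists_coeff_ne_zero_mem_comap_of_non_zero_divisor_root_mem
    (I := Ideal.span {mk f₂}) (f := algebraMap C A) nzd (Ideal.subset_span rfl) hq.ne_zero hq0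
  set g := q.coeff i
  rw [Ideal.mem_comap, Ideal.mem_span_singleton] at hi
  obtain ⟨h, hgh⟩ := hi
  have hsm : ∀ (c : C) (a : A), c • a = mk (Polynomial.C c) * a := by
    intro c a
    rw [Algebra.smul_def]; rfl
  have hgmk : mk (Polynomial.C g) = mk f₂ * h := hgh
  have gcancel : ∀ (c : C) (a : A), c ≠ 0 → mk (Polynomial.C c) * a = 0 → a = 0 := by
    intro c a hc ha
    rw [← hsm] at ha
    apply B.repr.injective
    ext j
    have := congrArg (fun v => B.repr v j) ha
    simp only [map_smul, Finsupp.smul_apply, map_zero, Finsupp.zero_apply, smul_eq_mul] at this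
    simpa using (mul_eq_zero.1 this).resolve_left hc
  have hnzd : ∀ a : A, a * h = 0 → a = 0 := by
    intro a ha
    apply gcancel g a hi0
    rw [hgmk]; linear_combination mk f₂ * ha
  have hP0 : ∀ r, r ∈ P ↔ mk (Polynomial.C g) ∣ mk r * (mk w * h) := by
    intro r
    rw [hP']
    constructor
    · rintro ⟨z, hz⟩
      exact ⟨z, by rw [hgmk]; linear_combination h * hz⟩
    · rintro ⟨z, hz⟩
      refine ⟨z, ?_⟩
      apply sub_eq_zero.1
      apply hnzd
      rw [hgmk] at hz
      linear_combination hz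
  set u := mk w * h
  have hgP : g ∈ P.comap Polynomial.C := by
    rw [Ideal.mem_comap, hP0]; exact dvd_mul_right _ _
  have hne : P.comap Polynomial.C ≠ ⊥ := by
    intro h; rw [h] at hgP; exact hi0 hgP
  obtain ⟨π, hπ, hπp⟩ := Ideal.IsPrime.exists_mem_prime_of_ne_bot (inferInstance : (P.comap Polynomial.C).IsPrime) hne
  have hprin : ∀ c, Polynomial.C c ∈ P → π ∣ c := by
    intro c hc
    by_contra hcon
    rw [Ideal.mem_comap, hP0] at hπ
    rw [hP0] at hc
    obtain ⟨z, hz⟩ := hπ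
    obtain ⟨z', hz'⟩ := hc
    have e1 : mk (Polynomial.C π) * z' = mk (Polynomial.C c) * z := by
      apply sub_eq_zero.1
      apply gcancel g _ hi0
      linear_combination mk (Polynomial.C c) * hz - mk (Polynomial.C π) * hz'
    have e2 : ∀ j, π ∣ B.repr z j := by
      intro j
      rw [← hsm, ← hsm] at e1
      have := congrArg (fun v => B.repr v j) e1
      simp only [map_smul, Finsupp.smul_apply, smul_eq_mul] at this
      exact (hπp.dvd_or_dvd (⟨_, this.symm⟩ : π ∣ c * B.repr z j)).resolve_left hcon
    choose y hy using e2
    have e3 : z = mk (Polynomial.C π) * ∑ j, y j • B j := by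
      rw [← hsm]
      rw [Finset.smul_sum]
      conv_lhs => rw [← B.sum_repr z]
      refine Finset.sum_congr rfl fun j _ => ?_
      rw [hy j, smul_smul]
    apply hPp.ne_top
    rw [Ideal.eq_top_iff_one, hP0, map_one, one_mul]
    refine ⟨∑ j, y j • B j, ?_⟩
    apply sub_eq_zero.1
    apply gcancel π _ hπp.ne_zero
    rw [e3] at hz
    linear_combination hz
  have hmin : P ∈ (Ideal.span {Polynomial.C π, f₁}).minimalPrimes := by
    refine ⟨⟨hPp, ?_⟩, ?_⟩
    · rw [Ideal.span_le]
      rintro z (rfl | rfl)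
      · exact hπ
      · exact hf1P
    · rintro Q ⟨hQp, hQ⟩ hQP
      intro x hx
      by_contra hxQ
      obtain ⟨p, hp, hp0⟩ := hIntg (mk x)
      have := Ideal.exists_coeff_mem_comap_sdiff_comap_of_root_mem_sdiff (f := Polynomial.C) hQP ⟨hx, hxQ⟩ (p := p)
        (Polynomial.map_monic_ne_zero hp) (by
          have : mk (Polynomial.eval₂ Polynomial.C x p) = 0 := by
            rw [Polynomial.hom_eval₂]; exact hp0
          rw [hmk] at this
          exact Ideal.mem_of_dvd _ this (hQ (Ideal.subset_span (by simp))))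
      obtain ⟨i, h1, h2⟩ := this
      apply h2
      have := hprin _ h1
      exact Ideal.mem_of_dvd Q (map_dvd Polynomial.C this) (hQ (Ideal.subset_span (by simp)))
  refine (Ideal.height_le_spanRank_toENat_of_mem_minimalPrimes _ _ hmin).trans ?_
  refine (Cardinal.toENat_le_natCast.2 ?_ : _ ≤ ((2:ℕ) : ℕ∞))
  refine (Submodule.spanRank_span_le_card _).trans ?_
  refine (Cardinal.mk_insert_le).trans ?_
  rw [Cardinal.mk_singleton]; norm_num

/-- The change of variables making a form monic. -/
theorem exists_monic {k : Type} [Field k] [Infinite k] {n d : ℕ} (f : MvPolynomial (Fin (n+1)) k)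
    (hf : f.IsHomogeneous d) (h0 : f ≠ 0) :
    ∃ e : MvPolynomial (Fin (n+1)) k ≃+* Polynomial (MvPolynomial (Fin n) k), ∃ c : (MvPolynomial (Fin n) k)ˣ,
      (Polynomial.C (c : MvPolynomial (Fin n) k) * e f).Monic := by
  have hX : (X 0 * f : MvPolynomial (Fin (n+1)) k) ≠ 0 := mul_ne_zero (X_ne_zero _) h0
  obtain ⟨a, ha⟩ : ∃ a : Fin (n+1) → k, eval a (X 0 * f) ≠ 0 := by
    by_contra hcon
    push Not at hcon
    exact hX (MvPolynomial.funext (by simpa using hcon))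
  rw [map_mul, eval_X, mul_ne_zero_iff] at ha
  obtain ⟨ha0, ha⟩ := ha
  let T : MvPolynomial (Fin (n+1)) k →ₐ[k] MvPolynomial (Fin (n+1)) k :=
    aeval fun i => if i = 0 then C (a 0) * X 0 else X i + C (a i) * X 0
  let T' : MvPolynomial (Fin (n+1)) k →ₐ[k] MvPolynomial (Fin (n+1)) k :=
    aeval fun i => if i = 0 then C (a 0)⁻¹ * X 0 else X i - C (a i * (a 0)⁻¹) * X 0
  have alC : ∀ z : k, C (σ := Fin (n+1)) (a 0) * C ((a 0)⁻¹) = 1 := by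
    intro z; rw [← C_mul, mul_inv_cancel₀ ha0, C_1]
  have h1 : T.comp T' = AlgHom.id k _ := by
    ext1 i
    by_cases hi : i = 0
    · subst hi
      simp only [T, T', AlgHom.comp_apply, aeval_X, if_true, map_mul, algHom_C, AlgHom.id_apply]
      simp only [algebraMap_eq]
      linear_combination X 0 * alC 0
    · simp only [T, T', AlgHom.comp_apply, aeval_X, if_neg hi, if_true, map_mul, map_sub, algHom_C, AlgHom.id_apply]
      simp only [algebraMap_eq, C_mul, map_mul]
      linear_combination - C (a i) * X 0 * alC 0
  have h2 : T'.comp T = AlgHom.id k _ := by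
    ext1 i
    by_cases hi : i = 0
    · subst hi
      simp only [T, T', AlgHom.comp_apply, aeval_X, if_true, map_mul, algHom_C, AlgHom.id_apply]
      simp only [algebraMap_eq]
      linear_combination X 0 * alC 0
    · simp only [T, T', AlgHom.comp_apply, aeval_X, if_neg hi, if_true, map_mul, map_add, algHom_C, AlgHom.id_apply]
      simp only [algebraMap_eq, C_mul, map_mul]
      ring
  let e := (AlgEquiv.ofAlgHom T T' h1 h2).trans (finSuccEquiv k n)
  have hTf : (T f).IsHomogeneous d := by
    have := hf.aeval (φ := f) (fun i => if i = 0 then C (a 0) * X 0 else X i + C (a i) * X 0) (n := 1) (by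
      intro i
      split_ifs
      · exact (isHomogeneous_X _ _).C_mul _
      · exact (isHomogeneous_X _ _).add ((isHomogeneous_X _ _).C_mul _))
    simpa [T] using this
  have hdeg : (finSuccEquiv k n (T f)).natDegree ≤ d := by
    rw [natDegree_finSuccEquiv]
    exact (degreeOf_le_totalDegree _ _).trans hTf.totalDegree_le
  have hco : (finSuccEquiv k n (T f)).coeff d = C (eval a f) := by
    have hconst : ∀ m : Fin n →₀ ℕ, m ≠ 0 → coeff m ((finSuccEquiv k n (T f)).coeff d) = 0 := by
      intro m hm
      rw [finSuccEquiv_coeff_coeff]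
      by_contra hcon
      have : Finsupp.degree (Finsupp.cons d m) = d := by
        rw [Finsupp.degree_eq_weight_one]; exact hTf hcon
      apply hm
      have h3 : Finsupp.degree (Finsupp.cons d m) = d + Finsupp.degree m := by
        rw [Finsupp.degree_eq_sum, Finsupp.degree_eq_sum, Fin.sum_univ_succ]; simp
      rw [h3] at this
      exact (Finsupp.degree_eq_zero_iff m).1 (by omega)
    have e1 : (finSuccEquiv k n (T f)).coeff d = C (coeff 0 ((finSuccEquiv k n (T f)).coeff d)) := by
      ext m
      rw [coeff_C]
      split_ifs with h
      · rw [h]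
      · exact hconst m (fun h' => h h'.symm)
    rw [e1, finSuccEquiv_coeff_coeff]
    congr 1
    have e2 : eval a f = eval (Pi.single 0 1) (T f) := by
      have : (eval (Pi.single (0 : Fin (n+1)) (1:k))).comp (T : _ →+* _) = eval a := by
        ext i
        · simp
        · by_cases hi : i = 0
          · subst hi; simp [T]
          · simp [T, hi]
      rw [← this]; rfl
    rw [e2, eval_eq']
    rw [Finset.sum_eq_single (Finsupp.cons d 0)]
    · rw [Fin.prod_univ_succ]
      simp
    · intro b hb hne
      have h4 : Finsupp.degree b = d := by
        rw [Finsupp.degree_eq_weight_one]; exact hTf (mem_support_iff.1 hb)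
      have : ∃ i : Fin n, b i.succ ≠ 0 := by
        by_contra hcon
        push Not at hcon
        apply hne
        have h5 : b 0 = d := by
          rw [← h4, Finsupp.degree_eq_sum, Fin.sum_univ_succ]; simp [hcon]
        ext j
        refine Fin.cases ?_ (fun j => ?_) j
        · simpa using h5
        · simpa using hcon j
      obtain ⟨i, hi⟩ := this
      rw [Finset.prod_eq_zero (Finset.mem_univ i.succ)]
      · simp
      · simp [hi]
    · intro hb
      rw [notMem_support_iff.1 hb, zero_mul]
  refine ⟨e.toRingEquiv, Units.map (C : k →+* MvPolynomial (Fin n) k) (Units.mk0 _ ha)⁻¹, ?_⟩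
  apply Polynomial.monic_of_natDegree_le_of_coeff_eq_one d
  · refine (Polynomial.natDegree_C_mul_le _ _).trans ?_
    exact hdeg
  · rw [Polynomial.coeff_C_mul]
    change _ * (finSuccEquiv k n (T f)).coeff d = 1
    rw [hco]
    simp only [Units.coe_map, Units.val_inv_eq_inv_val, Units.val_mk0]
    change C (eval a f)⁻¹ * C (eval a f) = 1
    rw [← C_mul, inv_mul_cancel₀ ha, C_1]

/-- Unmixedness of complete intersections of two forms. -/
theorem unmixed {k : Type} [Field k] [Infinite k] {N d : ℕ} (f₁ f₂ w : MvPolynomial (Fin N) k)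
    (hf₁ : f₁.IsHomogeneous d) (hd : d ≠ 0) (h1 : f₁ ≠ 0) (h2 : f₂ ≠ 0) (hrel : IsRelPrime f₁ f₂)
    (P : Ideal (MvPolynomial (Fin N) k)) [hPp : P.IsPrime]
    (hP : ∀ r, r ∈ P ↔ r * w ∈ Ideal.span {f₁, f₂}) : P.height ≤ 2 := by
  cases N with
  | zero =>
    exfalso
    apply h1
    have := hf₁
    rw [eq_C_of_isEmpty f₁]
    by_contra hcon
    have h3 : coeff 0 f₁ ≠ 0 := by
      intro h; rw [h] at hcon; simp at hcon
    have := hf₁ h3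
    simp at this
    exact hd this.symm
  | succ n =>
    obtain ⟨e, c, hm⟩ := exists_monic f₁ hf₁ h1
    have hcu : IsUnit (Polynomial.C (c : MvPolynomial (Fin n) k)) := c.isUnit.map Polynomial.C
    have hspan : ∀ r, r ∈ Ideal.span {f₁, f₂} ↔ e r ∈ Ideal.span {Polynomial.C (c : MvPolynomial (Fin n) k) * e f₁, e f₂} := by
      intro r
      obtain ⟨⟨u, v, huv, hvu⟩, hu⟩ := hcu
      simp only at hu
      rw [Ideal.mem_span_pair, Ideal.mem_span_pair, ← hu]
      constructor
      · rintro ⟨a, b, rfl⟩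
        refine ⟨e a * v, e b, ?_⟩
        simp only [map_add, map_mul]
        linear_combination (e a * e f₁) * huv
      · rintro ⟨a, b, h⟩
        refine ⟨e.symm (a * u), e.symm b, ?_⟩
        apply e.injective
        simp only [map_add, map_mul, RingEquiv.apply_symm_apply]
        linear_combination h
    have : ((P.comap (e.symm : _ →+* _)) : Ideal (Polynomial (MvPolynomial (Fin n) k))).height = P.height :=
      e.symm.height_comap P
    rw [← this]
    apply um_poly (Polynomial.C (c : MvPolynomial (Fin n) k) * e f₁) (e f₂) (e w) hm
    · intro z hz1 hz2
      rw [hcu.dvd_mul_left] at hz1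
      have := hrel (d := e.symm z) (by simpa using map_dvd e.symm hz1) (by simpa using map_dvd e.symm hz2)
      simpa using this.map e
    · simpa using h2
    · intro r
      rw [Ideal.mem_comap]
      change e.symm r ∈ P ↔ _
      rw [hP, hspan]; simp
end

end

section
open MvPolynomial Filter CategoryTheory
noncomputable section

def col {R : Type} [CommRing R] (F H : Ideal R) : Ideal R where
  carrier := {r | ∀ h ∈ H, r * h ∈ F}
  add_mem' := fun {a b} ha hb h hh => by rw [add_mul]; exact F.add_mem (ha h hh) (hb h hh)
  zero_mem' := fun h hh => by rw [zero_mul]; exact F.zero_mem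
  smul_mem' := fun c a ha h hh => by rw [smul_eq_mul, mul_assoc]; exact F.mul_mem_left _ (ha h hh)

theorem mem_col {R : Type} [CommRing R] {F H : Ideal R} {r : R} : r ∈ col F H ↔ ∀ h ∈ H, r * h ∈ F := Iff.rfl

def EE {R : Type} [CommRing R] (F H : Ideal R) : Prop :=
  ∀ φ : H →ₗ[R] (R ⧸ F), (∀ h : H, h.1 ∈ F → φ h = 0) → ∃ s : R, ∀ h : H, φ h = Ideal.Quotient.mk F (s * h)

theorem EE_top {R : Type} [CommRing R] (F : Ideal R) : EE F ⊤ := by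
  intro φ _
  obtain ⟨s, hs⟩ := Ideal.Quotient.mk_surjective (φ ⟨1, trivial⟩)
  refine ⟨s, fun h => ?_⟩
  have : h = h.1 • (⟨1, trivial⟩ : (⊤ : Ideal R)) := by ext; simp
  conv_lhs => rw [this]
  rw [map_smul, ← hs, mul_comm, map_mul]
  rfl

structure DL {R : Type} [CommRing R] (F p : Ideal R) (Δ : R) : Prop where
  kill : ∀ r ∈ p, r * Δ ∈ F
  inj : ∀ r, r * Δ ∈ F → r ∈ p
  sat : ∀ w, (∀ r ∈ p, w * r ∈ F) → ∃ t, w - t * Δ ∈ F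
  ext : EE F p
  le : F ≤ p

theorem exists_factor {R M N S : Type} [CommRing R] [AddCommGroup M] [AddCommGroup N] [AddCommGroup S]
    [Module R M] [Module R N] [Module R S] (g : M →ₗ[R] N) (hg : Function.Surjective g) (φ : M →ₗ[R] S)
    (h : ∀ m, g m = 0 → φ m = 0) : ∃ ψ : N →ₗ[R] S, ∀ m, ψ (g m) = φ m := by
  have hker : LinearMap.ker g ≤ LinearMap.ker φ := fun m hm => h m hm
  refine ⟨((LinearMap.ker g).liftQ φ hker) ∘ₗ (g.quotKerEquivOfSurjective hg).symm.toLinearMap, fun m => ?_⟩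
  have : (g.quotKerEquivOfSurjective hg).symm (g m) = Submodule.Quotient.mk m := by
    rw [LinearEquiv.symm_apply_eq]; rfl
  simp [this]

section
variable {R : Type} [CommRing R] [IsDomain R] [UniqueFactorizationMonoid R]

theorem exists_DL {f₁ f₂ x y : R} (hrel : IsRelPrime f₁ f₂) (h1 : f₁ ≠ 0) (h2 : f₂ ≠ 0) (hx : Prime x) (hxy : ¬ x ∣ y)
    (hf1 : f₁ ∈ Ideal.span {x, y}) (hf2 : f₂ ∈ Ideal.span {x, y}) :
    ∃ Δ, DL (Ideal.span {f₁, f₂}) (Ideal.span {x, y}) Δ := by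
  obtain ⟨m11, m12, hf1⟩ := Ideal.mem_span_pair.1 hf1
  obtain ⟨m21, m22, hf2⟩ := Ideal.mem_span_pair.1 hf2
  have F1 : f₁ ∈ Ideal.span {f₁, f₂} := Ideal.subset_span (by simp)
  have F2 : f₂ ∈ Ideal.span {f₁, f₂} := Ideal.subset_span (by simp)
  have syz : ∀ a b, a * f₁ = b * f₂ → ∃ h, a = h * f₂ ∧ b = h * f₁ := by
    intro a b hab
    have : f₂ ∣ a := hrel.symm.dvd_of_dvd_mul_right (Dvd.intro_left b hab.symm)
    obtain ⟨h, rfl⟩ := this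
    refine ⟨h, by ring, ?_⟩
    apply mul_right_cancel₀ h2
    linear_combination -hab
  have syz2 : ∀ a b, y * a = x * b → ∃ s, a = x * s ∧ b = y * s := by
    intro a b hab
    have : x ∣ a := (hx.dvd_or_dvd (Dvd.intro b hab.symm)).resolve_left hxy
    obtain ⟨s, rfl⟩ := this
    refine ⟨s, rfl, ?_⟩
    apply mul_left_cancel₀ hx.ne_zero
    linear_combination -hab
  have inj : ∀ r, r * (m11 * m22 - m12 * m21) ∈ Ideal.span {f₁, f₂} → r ∈ Ideal.span {x, y} := by
    intro g hg
    obtain ⟨α, β, hg⟩ := Ideal.mem_span_pair.1 hg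
    obtain ⟨h, e1, e2⟩ := syz (g * m22 - x * α) (g * m12 + x * β) (by
      rw [← hf1, ← hf2] at hg ⊢; linear_combination (-x) * hg)
    have e3 : x * (α + h * m21) = m22 * (g - h * y) := by
      rw [← hf2] at e1; linear_combination -e1
    have e4 : x * (h * m11 - β) = m12 * (g - h * y) := by
      rw [← hf1] at e2; linear_combination -e2
    by_cases hd : x ∣ g - h * y
    · obtain ⟨s, hs⟩ := hd
      rw [Ideal.mem_span_pair]
      exact ⟨s, h, by linear_combination -hs⟩
    · exfalso
      have d1 := (hx.dvd_or_dvd (Dvd.intro _ e3)).resolve_right hd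
      have d2 := (hx.dvd_or_dvd (Dvd.intro _ e4)).resolve_right hd
      apply hx.not_unit
      apply hrel
      · rw [← hf1]; exact dvd_add (dvd_mul_left _ _) (Dvd.dvd.mul_right d2 _)
      · rw [← hf2]; exact dvd_add (dvd_mul_left _ _) (Dvd.dvd.mul_right d1 _)
  refine ⟨m11 * m22 - m12 * m21, ?_, inj, ?_, ?_, ?_⟩
  · intro r hr
    obtain ⟨a, b, rfl⟩ := Ideal.mem_span_pair.1 hr
    rw [Ideal.mem_span_pair]
    refine ⟨a * m22 - b * m21, b * m11 - a * m12, ?_⟩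
    rw [← hf1, ← hf2]; ring
  · intro w hw
    obtain ⟨α, β, h1'⟩ := Ideal.mem_span_pair.1 (hw x (Ideal.subset_span (by simp)))
    obtain ⟨γ, ε, h2'⟩ := Ideal.mem_span_pair.1 (hw y (Ideal.subset_span (by simp)))
    obtain ⟨h, e1, e2⟩ := syz (y * α - x * γ) (x * ε - y * β) (by linear_combination y * h1' - x * h2')
    obtain ⟨s, a1, a2⟩ := syz2 (α - h * m22) (γ + h * m21) (by rw [← hf2] at e1; linear_combination e1)
    obtain ⟨t, b1, b2⟩ := syz2 (β + h * m12) (ε - h * m11) (by rw [← hf1] at e2; linear_combination -e2)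
    refine ⟨h, ?_⟩
    rw [Ideal.mem_span_pair]
    refine ⟨s, t, ?_⟩
    apply mul_left_cancel₀ hx.ne_zero
    linear_combination h1' - f₁ * a1 - f₂ * b1 + h * m22 * hf1 - h * m12 * hf2
  · intro φ hφ
    have px : x ∈ Ideal.span {x, y} := Ideal.subset_span (by simp)
    have py : y ∈ Ideal.span {x, y} := Ideal.subset_span (by simp)
    obtain ⟨u, hu⟩ := Ideal.Quotient.mk_surjective (φ ⟨x, px⟩)
    obtain ⟨v, hv⟩ := Ideal.Quotient.mk_surjective (φ ⟨y, py⟩)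
    have form : ∀ h : Ideal.span {x, y}, ∀ a b, a * x + b * y = h.1 → φ h = Ideal.Quotient.mk _ (a * u + b * v) := by
      intro h a b hab
      have : h = a • (⟨x, px⟩ : Ideal.span {x, y}) + b • ⟨y, py⟩ := by
        ext; simp [hab]
      rw [this, map_add, map_smul, map_smul, ← hu, ← hv]
      rfl
    have k1 : y * u - x * v ∈ Ideal.span {f₁, f₂} := by
      have := form 0 y (-x) (by simp; ring)
      rw [map_zero, eq_comm, Ideal.Quotient.eq_zero_iff_mem] at this
      convert this using 1; ring
    obtain ⟨c1, c2, hc⟩ := Ideal.mem_span_pair.1 k1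
    obtain ⟨s, e1, e2⟩ := syz2 (u - c1 * m12 - c2 * m22) (v + c1 * m11 + c2 * m21) (by
      rw [← hf1, ← hf2] at hc; linear_combination -hc)
    have k2 := form ⟨f₁, Ideal.mem_span_pair.2 ⟨_, _, hf1⟩⟩ m11 m12 hf1
    have k3 := form ⟨f₂, Ideal.mem_span_pair.2 ⟨_, _, hf2⟩⟩ m21 m22 hf2
    rw [hφ _ F1, eq_comm, Ideal.Quotient.eq_zero_iff_mem] at k2
    rw [hφ _ F2, eq_comm, Ideal.Quotient.eq_zero_iff_mem] at k3
    have c2p : c2 ∈ Ideal.span {x, y} := by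
      apply inj
      have := Ideal.sub_mem _ k2 (Ideal.mul_mem_left _ s F1)
      convert this using 1
      rw [← hf1]
      linear_combination -m11 * e1 - m12 * e2
    have c1p : c1 ∈ Ideal.span {x, y} := by
      apply inj
      have := Ideal.sub_mem _ (Ideal.mul_mem_left _ s F2) k3
      convert this using 1
      rw [← hf2]
      linear_combination m21 * e1 + m22 * e2
    obtain ⟨c11, c12, hc1⟩ := Ideal.mem_span_pair.1 c1p
    obtain ⟨c21, c22, hc2⟩ := Ideal.mem_span_pair.1 c2p
    refine ⟨s + c11 * m12 - c12 * m11 + c21 * m22 - c22 * m21, fun h => ?_⟩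
    obtain ⟨a, b, hab⟩ := Ideal.mem_span_pair.1 h.2
    rw [form h a b hab, Ideal.Quotient.eq, ← hab]
    have : a * u + b * v - (s + c11 * m12 - c12 * m11 + c21 * m22 - c22 * m21) * (a * x + b * y)
       = (a * c12 - b * c11) * f₁ + (a * c22 - b * c21) * f₂ := by
      rw [← hf1, ← hf2]
      linear_combination a * e1 + b * e2 - (a * m12 - b * m11) * hc1 - (a * m22 - b * m21) * hc2
    rw [this]
    exact Ideal.mem_span_pair.2 ⟨_, _, rfl⟩
  · rw [Ideal.span_le]
    rintro z (rfl | rfl)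
    · exact Ideal.mem_span_pair.2 ⟨_, _, hf1⟩
    · exact Ideal.mem_span_pair.2 ⟨_, _, hf2⟩

theorem E_step {F p H H' : Ideal R} {Δ : R} (D : DL F p Δ) (hE : EE F H) (hF : F ≤ H') (hle : H' ≤ H) (h : R) (hh : h ∈ H)
    (hH : ∀ z ∈ H, ∃ t, z - t * h ∈ H') (hcol : ∀ r, r * h ∈ H' ↔ r ∈ p) : EE F H' := by
  intro φ hφ
  let ψ : p →ₗ[R] (R ⧸ F) := φ ∘ₗ
    { toFun := fun r => ⟨r.1 * h, (hcol _).2 r.2⟩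
      map_add' := fun a b => by ext; simp [add_mul]
      map_smul' := fun a b => by ext; simp [mul_assoc] }
  obtain ⟨s, hs⟩ := D.ext ψ (by
    intro r hr
    have : ψ r = h • φ ⟨r.1, hF hr⟩ := by
      rw [← map_smul]
      simp only [ψ, LinearMap.comp_apply, LinearMap.coe_mk, AddHom.coe_mk]
      congr 1
      ext; simp [mul_comm]
    rw [this, hφ _ hr, smul_zero])
  let g : (H' × R) →ₗ[R] H :=
    { toFun := fun z => ⟨z.1.1 + z.2 * h, H.add_mem (hle z.1.2) (H.mul_mem_left _ hh)⟩
      map_add' := fun a b => by ext; simp; ring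
      map_smul' := fun a b => by ext; simp; ring }
  have hg : Function.Surjective g := by
    rintro ⟨z, hz⟩
    obtain ⟨t, ht⟩ := hH z hz
    refine ⟨(⟨_, ht⟩, t), ?_⟩
    ext; simp [g]
  obtain ⟨φ', hφ'⟩ := exists_factor g hg (φ.coprod (LinearMap.toSpanSingleton R _ (Ideal.Quotient.mk F s))) (by
    rintro ⟨z, t⟩ hz
    have hz' : z.1 + t * h = 0 := congrArg Subtype.val hz
    have ht : t * h ∈ H' := by
      rw [← neg_eq_of_add_eq_zero_right hz']; exact H'.neg_mem z.2
    have hψ := hs ⟨t, (hcol t).1 ht⟩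
    have hz2 : z = - ⟨t * h, ht⟩ := by ext; simp; linear_combination hz'
    rw [LinearMap.coprod_apply, hz2, map_neg]
    have : ψ ⟨t, (hcol t).1 ht⟩ = φ ⟨t * h, ht⟩ := rfl
    rw [← this, hψ, LinearMap.toSpanSingleton_apply, neg_add_eq_zero, mul_comm, map_mul]
    rfl)
  have hφ'' : ∀ z : H', φ' ⟨z.1, hle z.2⟩ = φ z := by
    intro z
    have := hφ' (z, 0)
    simp only [LinearMap.coprod_apply, map_zero, add_zero] at this
    rw [← this]
    congr 1
    ext; simp [g]
  obtain ⟨s', hs'⟩ := hE φ' (by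
    intro z hz
    have := hφ'' ⟨z.1, hF hz⟩
    rw [hφ _ hz] at this
    exact this)
  exact ⟨s', fun z => by rw [← hφ'', hs']⟩

/-- dividing out the greatest common divisor -/
theorem exists_content {B ι : Type} [CommRing B] [IsDomain B] [UniqueFactorizationMonoid B] (b : ι → B) (hb : ∃ i, b i ≠ 0) :
    ∃ d, d ≠ 0 ∧ ∃ b' : ι → B, (∀ i, b i = d * b' i) ∧ ∀ c, (∀ i, c ∣ b' i) → IsUnit c := by
  obtain ⟨i, hi⟩ := hb
  let S : Set B := {e | ∃ d, (∀ j, d ∣ b j) ∧ b i = d * e}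
  have hS : S.Nonempty := ⟨b i, 1, fun j => one_dvd _, by ring⟩
  obtain ⟨e, ⟨d, hd, hde⟩, hmin⟩ := WellFounded.has_min (wellFounded_dvdNotUnit (α := B)) S hS
  have hd0 : d ≠ 0 := by rintro rfl; simp at hde; exact hi hde
  choose b' hb' using hd
  refine ⟨d, hd0, b', hb', fun c hc => ?_⟩
  by_contra hcu
  have e1 : e = b' i := mul_left_cancel₀ hd0 (by rw [← hde, hb' i])
  obtain ⟨e', he'⟩ := hc i
  refine hmin e' ⟨d * c, fun j => ?_, by rw [hb' i, he']; ring⟩ ?_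
  · rw [hb' j]; exact mul_dvd_mul_left _ (hc j)
  · refine ⟨?_, c, hcu, by rw [e1, he']; ring⟩
    rintro rfl
    rw [hb' i, he'] at hi; simp at hi

variable {p : Ideal R} [IsDomain (R ⧸ p)] [UniqueFactorizationMonoid (R ⧸ p)]

theorem step_u {F H H' : Ideal R} {Δ : R} (D : DL F p Δ) (hp : pdl R p 1) (hle : H' ≤ H)
    (θ : H →ₗ[R] R ⧸ p) (hk : ∀ h : H, h.1 ∈ H' ↔ θ h = 0) (hg : ∀ c, (∀ h, c ∣ θ h) → IsUnit c)
    (u : R) (hu : ∀ (h : H) r, Ideal.Quotient.mk p r = θ h → u * h - r * Δ ∈ F)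
    (hpd : pdl R (col F H) 2) : pdl R (col F H') 2 := by
  have hθ0 : ∃ h, θ h ≠ 0 := by
    by_contra hcon
    push Not at hcon
    have := hg 0 (fun h => by rw [hcon h])
    exact not_isUnit_zero this
  have smk : ∀ (r : R) (b : R ⧸ p), r • b = Ideal.Quotient.mk p r * b := fun r b => rfl
  -- colon
  have hcolon : ∀ r, r * u ∈ col F H ↔ r ∈ p := by
    intro r
    rw [mem_col]
    have key : ∀ (h : H) s, Ideal.Quotient.mk p s = θ h → (r * u * h ∈ F ↔ r * s ∈ p) := by
      intro h s hs
      have e := F.mul_mem_left r (hu h s hs)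
      have e' : r * u * h = r * (u * h - s * Δ) + r * s * Δ := by ring
      rw [e', F.add_mem_iff_right e]
      exact ⟨D.inj _, D.kill _⟩
    constructor
    · intro h
      obtain ⟨z, hz⟩ := hθ0
      obtain ⟨s, hs⟩ := Ideal.Quotient.mk_surjective (θ z)
      have := (key z s hs).1 (h z.1 z.2)
      rw [← Ideal.Quotient.eq_zero_iff_mem, map_mul, hs] at this
      exact Ideal.Quotient.eq_zero_iff_mem.1 ((mul_eq_zero.1 this).resolve_right hz)
    · intro hr z hz
      obtain ⟨s, hs⟩ := Ideal.Quotient.mk_surjective (θ ⟨z, hz⟩)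
      exact (key ⟨z, hz⟩ s hs).2 (p.mul_mem_right _ hr)
  have hsup : col F H' = col F H ⊔ Ideal.span {u} := by
    apply le_antisymm
    · intro v hv
      rw [mem_col] at hv
      have hpH : ∀ (h : H) r, r ∈ p → r * h.1 ∈ H' := by
        intro h r hr
        have : (r • h).1 = r * h.1 := rfl
        rw [← this, hk, map_smul, smk, Ideal.Quotient.eq_zero_iff_mem.2 hr, zero_mul]
      have hex : ∀ h : H, ∃ t, v * h.1 - t * Δ ∈ F := by
        intro h
        apply D.sat
        intro r hr
        have := hv _ (hpH h r hr)
        rwa [mul_assoc, mul_comm h.1 r]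
      choose t ht using hex
      -- t is linear mod p and vanishes on H
      have hlin : ∀ (h h' : H) (a b : R), θ (a • h) = θ (b • h') → a * t h - b * t h' ∈ p := by
        intro h h' a b hab
        apply D.inj
        have e1 : (a • h - b • h').1 ∈ H' := by rw [hk, map_sub, hab, sub_self]
        have e2 := hv _ e1
        have e3 : (a • h - b • h').1 = a * h.1 - b * h'.1 := rfl
        rw [e3] at e2
        have e4 := F.sub_mem e2 (F.sub_mem (F.mul_mem_left a (ht h)) (F.mul_mem_left b (ht h')))
        convert e4 using 1; ring
      obtain ⟨h0, hh0⟩ := hθ0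
      obtain ⟨d, b0, g0, e1, e2, hrel⟩ := exists_gcd2 (θ h0) (Ideal.Quotient.mk p (t h0))
      have hd : d ≠ 0 := by rintro rfl; simp at e1; exact hh0 e1
      have hb0 : b0 ≠ 0 := by rintro rfl; simp at e1; exact hh0 e1
      have hmain : ∀ h, b0 * Ideal.Quotient.mk p (t h) = θ h * g0 := by
        intro h
        obtain ⟨s0, hs0⟩ := Ideal.Quotient.mk_surjective (θ h0)
        obtain ⟨s, hs⟩ := Ideal.Quotient.mk_surjective (θ h)
        have := hlin h h0 s0 s (by rw [map_smul, map_smul, smk, smk, hs0, hs]; ring)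
        rw [← Ideal.Quotient.eq_zero_iff_mem, map_sub, map_mul, map_mul, hs0, hs, e1, e2] at this
        apply mul_left_cancel₀ hd
        linear_combination this
      have hunit : IsUnit b0 := by
        apply hg
        intro h
        exact hrel.dvd_of_dvd_mul_right (Dvd.intro _ (hmain h))
      obtain ⟨b1, hb1⟩ := hunit.exists_right_inv
      obtain ⟨c, hc⟩ := Ideal.Quotient.mk_surjective (b1 * g0)
      have hth : ∀ h, Ideal.Quotient.mk p (t h) = Ideal.Quotient.mk p c * θ h := by
        intro h
        rw [hc]; linear_combination b1 * hmain h - Ideal.Quotient.mk p (t h) * hb1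
      refine Submodule.mem_sup.2 ⟨v - c * u, ?_, c * u, Ideal.mul_mem_left _ _ (Ideal.subset_span rfl), by ring⟩
      intro z hz
      obtain ⟨s, hs⟩ := Ideal.Quotient.mk_surjective (θ ⟨z, hz⟩)
      have a1 := ht ⟨z, hz⟩
      have a2 := F.mul_mem_left c (hu ⟨z, hz⟩ s hs)
      have a3 : t ⟨z, hz⟩ - c * s ∈ p := by
        rw [← Ideal.Quotient.eq_zero_iff_mem, map_sub, hth, map_mul, hs, sub_self]
      have a4 := D.kill _ a3
      have := F.add_mem (F.sub_mem a1 a2) a4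
      convert this using 1
      simp only; ring
    · refine sup_le ?_ ?_
      · intro r hr z hz
        exact hr z (hle hz)
      · rw [Ideal.span_singleton_le_iff_mem]
        intro z hz
        have := hu ⟨z, hle hz⟩ 0 (by rw [map_zero, eq_comm, ← hk]; exact hz)
        simpa using this
  rw [hsup]
  refine pdi_sup (n := 1) hpd (pdi_one (pdl_projective _) u) ?_
  have : col F H ⊓ Ideal.span {u} = Ideal.span {u} * p := by
    ext z
    rw [Ideal.mem_span_singleton_mul]
    constructor
    · rintro ⟨h1, h2⟩
      obtain ⟨r, rfl⟩ := Ideal.mem_span_singleton'.1 h2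
      exact ⟨r, (hcolon r).1 h1, by ring⟩
    · rintro ⟨r, hr, rfl⟩
      refine ⟨?_, Ideal.mul_mem_right _ _ (Ideal.subset_span rfl)⟩
      rw [mul_comm]; exact (hcolon r).2 hr
  rw [this]
  exact pdi_mul u hp

theorem DL.u_of_E {F H : Ideal R} {Δ : R} (D : DL F p Δ) (hE : EE F H)
    (θ : H →ₗ[R] R ⧸ p) (hk : ∀ h : H, h.1 ∈ F → θ h = 0) :
    ∃ u : R, ∀ (h : H) r, Ideal.Quotient.mk p r = θ h → u * h - r * Δ ∈ F := by
  let j : (R ⧸ p) →ₗ[R] (R ⧸ F) := Submodule.mapQ p F (LinearMap.mulRight R Δ) (fun r hr => D.kill r hr)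
  obtain ⟨u, hu⟩ := hE (j ∘ₗ θ) (fun h hh => by rw [LinearMap.comp_apply, hk h hh, map_zero])
  refine ⟨u, fun h r hr => ?_⟩
  have := hu h
  rw [LinearMap.comp_apply, ← hr] at this
  have e : j (Ideal.Quotient.mk p r) = Ideal.Quotient.mk F (r * Δ) := rfl
  rw [e] at this
  exact Ideal.Quotient.eq.1 this.symm

theorem step_E {F H H' : Ideal R} {Δ : R} (D : DL F p Δ) (hp : pdl R p 1) (hE : EE F H) (hF : F ≤ H') (hle : H' ≤ H)
    (θ : H →ₗ[R] R ⧸ p) (hk : ∀ h : H, h.1 ∈ H' ↔ θ h = 0) (hne : ∃ h, θ h ≠ 0)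
    (hpd : pdl R (col F H) 2) : pdl R (col F H') 2 := by
  obtain ⟨d, hd, b, hb, hc⟩ := exists_content (fun h => θ h) hne
  let θ' : H →ₗ[R] R ⧸ p :=
    { toFun := b
      map_add' := fun x y => by
        apply mul_left_cancel₀ hd
        rw [mul_add, ← hb, ← hb, ← hb, map_add]
      map_smul' := fun r x => by
        apply mul_left_cancel₀ hd
        rw [RingHom.id_apply, mul_smul_comm, ← hb, ← hb, map_smul] }
  have hk' : ∀ h : H, h.1 ∈ H' ↔ θ' h = 0 := by
    intro h
    rw [hk, hb]
    exact ⟨fun h => (mul_eq_zero.1 h).resolve_left hd, fun h => by rw [show b _ = 0 from h, mul_zero]⟩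
  obtain ⟨u, hu⟩ := D.u_of_E hE θ' (fun h hh => (hk' h).1 (hF hh))
  exact step_u D hp hle θ' hk' hc u hu hpd

end
end

end

section
open MvPolynomial Filter CategoryTheory
noncomputable section

theorem mem_primaryComponent {R : Type} [CommRing R] {J p : Ideal R} (hp : p.IsPrime) {h : R}
    (hh : h ∈ primaryComponent J p) : ∃ s, s ∉ p ∧ s * h ∈ J := by
  let S : Ideal R :=
    { carrier := {h | ∃ s, s ∉ p ∧ s * h ∈ J}
      add_mem' := by
        rintro a b ⟨s, hs, hsa⟩ ⟨t, ht, htb⟩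
        refine ⟨s * t, fun h => (hp.mem_or_mem h).elim hs ht, ?_⟩
        have := J.add_mem (J.mul_mem_left t hsa) (J.mul_mem_left s htb)
        convert this using 1; ring
      zero_mem' := ⟨1, fun h => hp.ne_top ((Ideal.eq_top_iff_one _).2 h), by simp⟩
      smul_mem' := by
        rintro c a ⟨s, hs, hsa⟩
        refine ⟨s, hs, ?_⟩
        have := J.mul_mem_left c hsa
        rw [smul_eq_mul]; convert this using 1; ring }
  have : primaryComponent J p ≤ S := by
    refine iSup₂_le (fun s hs z hz => ?_)
    refine ⟨s, hs, ?_⟩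
    have := Submodule.mem_colon.1 hz s (Ideal.subset_span rfl)
    rwa [smul_eq_mul, mul_comm] at this
  exact this hh

theorem le_unmixedPart {R : Type} [CommRing R] (J : Ideal R) : J ≤ unmixedPart J := by
  refine le_iInf₂ (fun p hp => ?_)
  intro z hz
  have h1 : (1 : R) ∉ p := fun h => hp.1.ne_top ((Ideal.eq_top_iff_one _).2 h)
  refine Submodule.mem_iSup_of_mem (1 : R) (Submodule.mem_iSup_of_mem h1 ?_)
  rw [Submodule.mem_colon]
  intro s hs
  exact J.mul_mem_right _ hz

theorem colon_unmixed {k : Type} [Field k] [Infinite k] {N d : ℕ} (f₁ f₂ f₃ : MvPolynomial (Fin N) k)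
    (hf₁ : f₁.IsHomogeneous d) (hd : d ≠ 0) (hI : (Ideal.span {f₁, f₂, f₃}).height = 2)
    (h12 : (Ideal.span {f₁, f₂}).height = 2) (r : MvPolynomial (Fin N) k) :
    r ∈ col (Ideal.span {f₁, f₂}) (unmixedPart (Ideal.span {f₁, f₂, f₃})) ↔ r * f₃ ∈ Ideal.span {f₁, f₂} := by
  obtain ⟨hrel, h1, h2⟩ := relprime_of_height h12
  have hI3 : f₃ ∈ Ideal.span {f₁, f₂, f₃} := Ideal.subset_span (by simp)
  constructor
  · intro h
    exact h f₃ (le_unmixedPart _ hI3)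
  · intro hr h hh
    by_contra hcon
    have hrI : ∀ z ∈ Ideal.span {f₁, f₂, f₃}, r * z ∈ Ideal.span {f₁, f₂} := by
      intro z hz
      have : Ideal.span {f₁, f₂, f₃} ≤ Submodule.comap (LinearMap.mulLeft (MvPolynomial (Fin N) k) r) (Ideal.span {f₁, f₂}) := by
        rw [Ideal.span_le]
        rintro z (rfl | rfl | rfl)
        · exact Ideal.mul_mem_left _ _ (Ideal.subset_span (by simp))
        · exact Ideal.mul_mem_left _ _ (Ideal.subset_span (by simp))
        · exact hr
      exact this hz
    obtain ⟨P, hP, hle⟩ := exists_le_isAssociatedPrime_of_isNoetherianRing (MvPolynomial (Fin N) k)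
      (Ideal.Quotient.mk (Ideal.span {f₁, f₂}) (r * h)) (by rwa [Ne, Ideal.Quotient.eq_zero_iff_mem])
    rw [isAssociatedPrime_iff] at hP
    obtain ⟨hPp, w, hw⟩ := hP
    obtain ⟨w, rfl⟩ := Ideal.Quotient.mk_surjective w
    have sm : ∀ a b : MvPolynomial (Fin N) k, a • (Ideal.Quotient.mk (Ideal.span {f₁, f₂}) b) = Ideal.Quotient.mk (Ideal.span {f₁, f₂}) (a * b) := fun a b => rfl
    have hP' : ∀ a, a ∈ P ↔ a * w ∈ Ideal.span {f₁, f₂} := by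
      intro a
      rw [hw, Submodule.mem_colon_singleton, sm, Submodule.mem_bot, Ideal.Quotient.eq_zero_iff_mem]
    have hle' : ∀ a, a * (r * h) ∈ Ideal.span {f₁, f₂} → a ∈ P := by
      intro a ha
      apply hle
      rw [Submodule.mem_colon_singleton, sm, Submodule.mem_bot, Ideal.Quotient.eq_zero_iff_mem]
      exact ha
    have hht := unmixed f₁ f₂ w hf₁ hd h1 h2 hrel P hP'
    have hIP : Ideal.span {f₁, f₂, f₃} ≤ P := by
      intro a ha
      apply hle'
      have := Ideal.mul_mem_right h _ (hrI a ha)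
      convert this using 1; ring
    have hht2 : idealHeight P = idealHeight (Ideal.span {f₁, f₂, f₃}) := by
      rw [idealHeight_eq, idealHeight_eq, hI]
      exact le_antisymm hht (hI ▸ Ideal.height_mono hIP)
    have := (Submodule.mem_iInf _).1 ((Submodule.mem_iInf _).1 hh P) ⟨hPp, hIP, hht2⟩
    obtain ⟨s, hs, hsh⟩ := mem_primaryComponent hPp this
    apply hs
    apply hle'
    have := hrI _ hsh
    convert this using 1; ring
end

end

section
open MvPolynomial Filter CategoryTheory
noncomputable section

theorem sum_multichoose (m j : ℕ) : ∑ i ∈ Finset.range (j+1), Nat.multichoose m i = Nat.multichoose (m+1) j := by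
  induction j with
  | zero => simp
  | succ j ih => rw [Finset.sum_range_succ, ih, Nat.multichoose_succ_succ]; ring

def monsLT (m j : ℕ) : Finset (Fin m →₀ ℕ) :=
  (Finset.range j).biUnion (fun i => Finset.finsuppAntidiag Finset.univ i)

theorem mem_monsLT {m j : ℕ} (d : Fin m →₀ ℕ) : d ∈ monsLT m j ↔ d.degree < j := by
  simp [monsLT, Finset.mem_finsuppAntidiag, Finsupp.degree_eq_sum]

theorem card_monsLT (m j : ℕ) : m.factorial * (monsLT m (j+1)).card = (j+1).ascFactorial m := by
  rw [monsLT, Finset.card_biUnion]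
  · simp only [Finset.card_finsuppAntidiag_nat_eq_multichoose, Finset.card_univ, Fintype.card_fin]
    rw [sum_multichoose, Nat.multichoose_eq, Nat.ascFactorial_eq_factorial_mul_choose]
    congr 1
    rw [Nat.choose_symm_of_eq_add]
    · congr 1; omega
    · omega
  · intro a _ b _ hab
    rw [Function.onFun, Finset.disjoint_left]
    intro d hd hd'
    rw [Finset.mem_finsuppAntidiag] at hd hd'
    exact hab (hd.1.symm.trans hd'.1)

def coefMap (k : Type) [Field k] (m j : ℕ) : MvPolynomial (Fin m) k →ₗ[k] (monsLT m j → k) :=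
  LinearMap.pi (fun d => MvPolynomial.lcoeff k d.1)

theorem coefMap_ker {k : Type} [Field k] {m j : ℕ} : LinearMap.ker (coefMap k m j) = (idealOfVars (Fin m) k ^ j).restrictScalars k := by
  ext f
  rw [LinearMap.mem_ker, Submodule.restrictScalars_mem, mem_pow_idealOfVars_iff', funext_iff]
  constructor
  · intro h d hd
    exact h ⟨d, (mem_monsLT d).2 hd⟩
  · intro h d
    exact h d.1 ((mem_monsLT _).1 d.2)

theorem coefMap_surj {k : Type} [Field k] {m j : ℕ} : Function.Surjective (coefMap k m j) := by
  classical
  intro g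
  refine ⟨∑ d : monsLT m j, monomial d.1 (g d), ?_⟩
  funext e
  show coeff e.1 (∑ d : monsLT m j, monomial d.1 (g d)) = g e
  rw [coeff_sum, Finset.sum_eq_single e]
  · simp
  · intro b _ hb
    rw [coeff_monomial, if_neg]
    intro h; exact hb (Subtype.ext h)
  · simp

def quotEquiv (k : Type) [Field k] (m j : ℕ) : (MvPolynomial (Fin m) k ⧸ idealOfVars (Fin m) k ^ j) ≃ₗ[k] (monsLT m j → k) :=
  (Submodule.Quotient.restrictScalarsEquiv k (idealOfVars (Fin m) k ^ j)).symm ≪≫ₗ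
  (Submodule.quotEquivOfEq _ _ coefMap_ker.symm) ≪≫ₗ (coefMap k m j).quotKerEquivOfSurjective coefMap_surj

instance finite_quot_pow {k : Type} [Field k] {m j : ℕ} : Module.Finite k (MvPolynomial (Fin m) k ⧸ idealOfVars (Fin m) k ^ j) :=
  Module.Finite.equiv (quotEquiv k m j).symm

theorem finrank_quot_pow {k : Type} [Field k] {m j : ℕ} : Module.finrank k (MvPolynomial (Fin m) k ⧸ idealOfVars (Fin m) k ^ j) = (monsLT m j).card := by
  rw [(quotEquiv k m j).finrank_eq]; simp

/-- Artin-Rees consequence. -/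
theorem artin_rees {A R : Type} [CommRing A] [CommRing R] [Algebra A R] [IsNoetherianRing A]
    (𝔪 : Ideal A) (K : Ideal R) [Module.Finite A (R ⧸ K)] (v : Fin 3 → R)
    (hv : ∀ c : Fin 3 → A, ∑ i, algebraMap A R (c i) * v i ∈ K → c = 0) :
    ∃ s, ∀ n, ∀ c : Fin 3 → A, ∑ i, algebraMap A R (c i) * v i ∈ K ⊔ (𝔪.map (algebraMap A R)) ^ (n + s) →
      ∀ i, c i ∈ 𝔪 ^ n := by
  let Ψ : (Fin 3 → A) →ₗ[A] (R ⧸ K) := Fintype.linearCombination A (fun i => Ideal.Quotient.mk K (v i))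
  have hΨ : ∀ c, Ψ c = Ideal.Quotient.mk K (∑ i, algebraMap A R (c i) * v i) := by
    intro c
    simp only [Ψ, Fintype.linearCombination_apply, map_sum]
    refine Finset.sum_congr rfl fun i _ => ?_
    rw [Algebra.smul_def, map_mul]; rfl
  have hinj : Function.Injective Ψ := by
    rw [injective_iff_map_eq_zero]
    intro c hc
    rw [hΨ, Ideal.Quotient.eq_zero_iff_mem] at hc
    exact hv c hc
  obtain ⟨s, hs⟩ := Ideal.exists_pow_inf_eq_pow_smul 𝔪 (LinearMap.range Ψ)
  refine ⟨s, fun n c hc => ?_⟩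
  have h1 : Ψ c ∈ (𝔪 ^ (n+s) • ⊤ : Submodule A (R ⧸ K)) := by
    rw [hΨ]
    obtain ⟨a, ha, b, hb, hab⟩ := Submodule.mem_sup.1 hc
    rw [← hab, map_add, Ideal.Quotient.eq_zero_iff_mem.2 ha, zero_add]
    rw [← Ideal.map_pow, ← Ideal.mul_top (Ideal.map _ _)] at hb
    have h2 : ∀ z ∈ Ideal.map (algebraMap A R) (𝔪 ^ (n+s)), Ideal.Quotient.mk K z ∈ (𝔪 ^ (n+s) • ⊤ : Submodule A (R ⧸ K)) := by
      intro z hz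
      rw [Ideal.map] at hz
      induction hz using Submodule.span_induction with
      | mem z hz =>
        obtain ⟨a, ha, rfl⟩ := hz
        have : Ideal.Quotient.mk K (algebraMap A R a) = a • (1 : R ⧸ K) := by
          rw [Algebra.smul_def, mul_one]; rfl
        rw [this]
        exact Submodule.smul_mem_smul ha trivial
      | zero => simp
      | add a b _ _ ha hb => rw [map_add]; exact add_mem ha hb
      | smul r z _ hz =>
        rw [smul_eq_mul, map_mul]
        generalize Ideal.Quotient.mk K z = z' at hz
        induction hz using Submodule.smul_induction_on' with
        | smul a ha m hm =>
          rw [mul_smul_comm]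
          exact Submodule.smul_mem_smul ha trivial
        | add a _ b _ ha hb => rw [mul_add]; exact add_mem ha hb
    rw [Ideal.mul_top] at hb
    exact h2 _ hb
  have h2 : Ψ c ∈ 𝔪 ^ (n+s) • ⊤ ⊓ LinearMap.range Ψ := ⟨h1, c, rfl⟩
  rw [hs (n+s) (by omega), Nat.add_sub_cancel] at h2
  have h3 : Ψ c ∈ 𝔪 ^ n • LinearMap.range Ψ := Submodule.smul_mono le_rfl inf_le_right h2
  rw [LinearMap.range_eq_map, ← Submodule.map_smul''] at h3
  obtain ⟨c', hc', hcc⟩ := h3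
  rw [← hinj hcc]
  intro i
  have : (𝔪 ^ n • ⊤ : Submodule A (Fin 3 → A)) ≤ Submodule.comap (LinearMap.proj i) (𝔪 ^ n) := by
    rw [Submodule.smul_le]
    intro r hr z _
    exact Ideal.mul_mem_right _ _ hr
  exact this hc'
end

end

section
open MvPolynomial Filter CategoryTheory
noncomputable section

theorem finrank_le_of_ker {k V X Y : Type} [Field k] [AddCommGroup V] [Module k V] [AddCommGroup X] [Module k X]
    [AddCommGroup Y] [Module k Y] [Module.Finite k X] (T : V →ₗ[k] X) (S : V →ₗ[k] Y) (hS : Function.Surjective S)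
    (h : LinearMap.ker T ≤ LinearMap.ker S) : Module.finrank k Y ≤ Module.finrank k X := by
  have e := T.quotKerEquivRange
  have : Module.Finite k (V ⧸ LinearMap.ker T) := Module.Finite.equiv e.symm
  have h1 : Function.Surjective ((LinearMap.ker T).liftQ S h) := by
    intro y
    obtain ⟨v, rfl⟩ := hS y
    exact ⟨Submodule.Quotient.mk v, by simp⟩
  have h2 : LinearMap.range ((LinearMap.ker T).liftQ S h) = ⊤ := LinearMap.range_eq_top.2 h1
  have h3 := LinearMap.finrank_range_le ((LinearMap.ker T).liftQ S h)
  rw [h2, finrank_top, e.finrank_eq] at h3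
  exact h3.trans (Submodule.finrank_le _)

instance finite_quot_sup {k : Type} [Field k] {N n : ℕ} (K : Ideal (MvPolynomial (Fin N) k)) :
    Module.Finite k (MvPolynomial (Fin N) k ⧸ (K ⊔ idealOfVars (Fin N) k ^ n)) :=
  Module.Finite.of_surjective (Ideal.Quotient.factorₐ k (le_sup_right : idealOfVars (Fin N) k ^ n ≤ K ⊔ idealOfVars (Fin N) k ^ n)).toLinearMap
    (Ideal.Quotient.factor_surjective le_sup_right)

theorem limit_lower {m C : ℕ} (g : ℕ → ℕ) (h : ∀ n, 1 ≤ n → 3 * n ^ m ≤ m.factorial * g (n + C))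
    (ht : Tendsto (fun n : ℕ => (Nat.factorial m : ℝ) * (g n : ℝ) / (n : ℝ) ^ m) atTop (nhds ((2 : ℕ) : ℝ))) : False := by
  have h1 := ht.comp (tendsto_add_atTop_nat C)
  have h2 : Tendsto (fun n : ℕ => 3 * ((n : ℝ) / ((n : ℝ) + C)) ^ m) atTop (nhds (3 * 1 ^ m)) :=
    ((tendsto_natCast_div_add_atTop (C : ℝ)).pow m).const_mul 3
  have h3 := le_of_tendsto_of_tendsto h2 h1 (by
    filter_upwards [eventually_ge_atTop 1] with n hn
    simp only [Function.comp]
    rw [div_pow, ← mul_div_assoc]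
    push_cast
    have := h n hn
    have h4 : (3 : ℝ) * (n : ℝ) ^ m ≤ (m.factorial : ℝ) * (g (n + C) : ℝ) := by exact_mod_cast this
    gcongr)
  norm_num at h3

theorem limit_upper {m : ℕ} (g : ℕ → ℕ) (h : ∀ n, 1 ≤ n → m.factorial * g n ≤ (n + m) ^ m)
    (ht : Tendsto (fun n : ℕ => (Nat.factorial m : ℝ) * (g n : ℝ) / (n : ℝ) ^ m) atTop (nhds ((2 : ℕ) : ℝ))) : False := by
  have h2 : Tendsto (fun n : ℕ => (((n : ℝ) / ((n : ℝ) + m)) ^ m)⁻¹) atTop (nhds ((1 ^ m)⁻¹)) :=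
    ((tendsto_natCast_div_add_atTop (m : ℝ)).pow m).inv₀ (by simp)
  have h3 := le_of_tendsto_of_tendsto ht h2 (by
    filter_upwards [eventually_ge_atTop 1] with n hn
    rw [div_pow, inv_div]
    have := h n hn
    have h4 : (m.factorial : ℝ) * (g n : ℝ) ≤ ((n : ℝ) + m) ^ m := by exact_mod_cast this
    gcongr)
  norm_num at h3

variable {k : Type} [Field k] {N m : ℕ}

theorem lin_mem_vars (v : Fin N → k) : lin v ∈ idealOfVars (Fin N) k := by
  rw [lin_apply]
  refine Ideal.sum_mem _ (fun i _ => ?_)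
  rw [MvPolynomial.smul_eq_C_mul]
  exact Ideal.mul_mem_left _ _ (Ideal.subset_span ⟨i, rfl⟩)

theorem sub_vars (φ : (Fin N → k) →ₗ[k] (Fin m → k)) : (idealOfVars (Fin N) k).map (sub φ) ≤ idealOfVars (Fin m) k := by
  rw [Ideal.map_span, Ideal.span_le]
  rintro _ ⟨_, ⟨i, rfl⟩, rfl⟩
  rw [sub_X]; exact lin_mem_vars _

theorem dep {U : Submodule k (Fin N → k)} {φ : (Fin N → k) →ₗ[k] (Fin m → k)}
    {σ : (Fin m → k) →ₗ[k] (Fin N → k)} (h1 : LinearMap.ker φ = U) (h2 : ∀ w, φ (σ w) = w)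
    (K : Ideal (MvPolynomial (Fin N) k)) (hrad : K.radical = ip U) (hm : HasMultiplicity K m 2)
    (v : Fin 3 → MvPolynomial (Fin N) k) :
    ∃ c : Fin 3 → MvPolynomial (Fin m) k, c ≠ 0 ∧ ∑ i, sub σ (c i) * v i ∈ K := by
  by_contra hcon
  push Not at hcon
  letI alg : Algebra (MvPolynomial (Fin m) k) (MvPolynomial (Fin N) k) := (sub σ).toRingHom.toAlgebra
  have ham : ∀ a, algebraMap (MvPolynomial (Fin m) k) (MvPolynomial (Fin N) k) a = sub σ a := fun a => rfl
  have hd : ∀ f, f - sub σ (sub φ f) ∈ ip U := by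
    intro f
    rw [← ker_sub h1 h2, map_sub, sub_surj h2, sub_self]
  haveI : IsScalarTower k (MvPolynomial (Fin m) k) (MvPolynomial (Fin N) k) := IsScalarTower.of_algebraMap_eq (by
    intro x; rw [ham]; exact ((sub σ).commutes x).symm)
  haveI : IsScalarTower k (MvPolynomial (Fin m) k) (MvPolynomial (Fin N) k ⧸ K) := by
    infer_instance
  haveI : Module.Finite (MvPolynomial (Fin m) k) (MvPolynomial (Fin N) k ⧸ K) := by
    rw [Algebra.finite_iff_isIntegral_and_finiteType]
    refine ⟨⟨fun r => ?_⟩, ?_⟩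
    · obtain ⟨r, rfl⟩ := Ideal.Quotient.mk_surjective r
      have := hd r
      rw [← hrad] at this
      obtain ⟨n, hn⟩ := this
      refine ⟨(Polynomial.X - Polynomial.C (sub φ r)) ^ n, (Polynomial.monic_X_sub_C _).pow n, ?_⟩
      rw [Polynomial.eval₂_pow, Polynomial.eval₂_sub, Polynomial.eval₂_X, Polynomial.eval₂_C]
      show (Ideal.Quotient.mk K r - Ideal.Quotient.mk K (sub σ (sub φ r)))^n = 0
      rw [← map_sub, ← map_pow, Ideal.Quotient.eq_zero_iff_mem]
      exact hn
    · exact Algebra.FiniteType.of_restrictScalars_finiteType k _ _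
  obtain ⟨s, hs⟩ := artin_rees (idealOfVars (Fin m) k) K v (fun c hc => by
    by_contra h0
    exact hcon c h0 hc)
  obtain ⟨c, hc⟩ := Ideal.exists_radical_pow_le_of_fg K (IsNoetherian.noetherian _)
  rw [hrad] at hc
  have hvars : idealOfVars (Fin N) k ≤ (idealOfVars (Fin m) k).map (sub σ) ⊔ ip U := by
    rw [idealOfVars, Ideal.span_le]
    rintro _ ⟨i, rfl⟩
    have : (X i : MvPolynomial (Fin N) k) = sub σ (sub φ (X i)) + (X i - sub σ (sub φ (X i))) := by ring
    rw [this]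
    refine Submodule.add_mem_sup ?_ (hd _)
    refine Ideal.mem_map_of_mem _ ?_
    rw [sub_X]; exact lin_mem_vars _
  have hpow : ∀ n, idealOfVars (Fin N) k ^ (n + c) ≤ K ⊔ (idealOfVars (Fin m) k).map (sub σ) ^ n := by
    intro n
    refine (Ideal.pow_right_mono hvars _).trans ((Ideal.sup_pow_add_le_pow_sup_pow).trans ?_)
    rw [sup_comm]
    exact sup_le_sup_right hc _
  refine limit_lower (C := s + c) (m := m) (hilbertSamuelFn K) ?_ hm
  intro n hn
  obtain ⟨j, rfl⟩ : ∃ j, n = j + 1 := ⟨n - 1, by omega⟩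
  have key : 3 * (monsLT m (j+1)).card ≤ hilbertSamuelFn K (j + 1 + (s + c)) := by
    let T : (Fin 3 → MvPolynomial (Fin m) k) →ₗ[k] (MvPolynomial (Fin N) k ⧸ (K ⊔ idealOfVars (Fin N) k ^ (j+1+(s+c)))) :=
      (Ideal.Quotient.mkₐ k _).toLinearMap ∘ₗ (∑ i, (LinearMap.mulRight k (v i)) ∘ₗ (sub σ).toLinearMap ∘ₗ LinearMap.proj i)
    let S : (Fin 3 → MvPolynomial (Fin m) k) →ₗ[k] (Fin 3 → (monsLT m (j+1) → k)) :=
      LinearMap.pi (fun i => coefMap k m (j+1) ∘ₗ LinearMap.proj i)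
    have hS : Function.Surjective S := by
      intro g
      choose f hf using fun i => coefMap_surj (g i)
      exact ⟨f, funext hf⟩
    have := finrank_le_of_ker T S hS ?_
    · rw [Module.finrank_pi_fintype] at this
      have h3 : 3 * (monsLT m (j+1)).card ≤ Module.finrank k (MvPolynomial (Fin N) k ⧸ K ⊔ idealOfVars (Fin N) k ^ (j + 1 + (s + c))) := by
        simpa using this
      exact h3
    · intro x hx
      have hx' : ∑ i, sub σ (x i) * v i ∈ K ⊔ idealOfVars (Fin N) k ^ (j+1+(s+c)) := by
        rw [← Ideal.Quotient.eq_zero_iff_mem]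
        have h0 := LinearMap.mem_ker.1 hx
        rw [← h0]
        simp [T]
      have hx2 : ∑ i, sub σ (x i) * v i ∈ K ⊔ (idealOfVars (Fin m) k).map (sub σ) ^ (j+1+s) := by
        have := hpow (j+1+s)
        rw [add_assoc (j+1)] at this
        exact (sup_le le_sup_left this) hx'
      have hx3 := hs (j+1) x hx2
      rw [LinearMap.mem_ker]
      funext i
      have : x i ∈ LinearMap.ker (coefMap k m (j+1)) := by rw [coefMap_ker]; exact hx3 i
      exact this
  calc 3 * (j+1)^m ≤ 3 * (j+1).ascFactorial m := Nat.mul_le_mul_left _ (Nat.pow_succ_le_ascFactorial _ _)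
    _ = m.factorial * (3 * (monsLT m (j+1)).card) := by rw [← card_monsLT]; ring
    _ ≤ _ := Nat.mul_le_mul_left _ key

theorem not_mult {U : Submodule k (Fin N → k)} {φ : (Fin N → k) →ₗ[k] (Fin m → k)}
    {σ : (Fin m → k) →ₗ[k] (Fin N → k)} (h1 : LinearMap.ker φ = U) (h2 : ∀ w, φ (σ w) = w)
    (hm : HasMultiplicity (ip U) m 2) : False := by
  refine limit_upper (hilbertSamuelFn (ip U)) ?_ hm
  intro n hn
  obtain ⟨j, rfl⟩ : ∃ j, n = j + 1 := ⟨n - 1, by omega⟩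
  have key : hilbertSamuelFn (ip U) (j + 1) ≤ (monsLT m (j+1)).card := by
    rw [← finrank_quot_pow (k := k)]
    refine finrank_le_of_ker (Ideal.Quotient.mkₐ k (idealOfVars (Fin m) k ^ (j+1))).toLinearMap
      ((Ideal.Quotient.mkₐ k (ip U ⊔ idealOfVars (Fin N) k ^ (j+1))).toLinearMap ∘ₗ (sub σ).toLinearMap) ?_ ?_
    · intro r
      obtain ⟨r, rfl⟩ := Ideal.Quotient.mk_surjective r
      refine ⟨sub φ r, ?_⟩
      show Ideal.Quotient.mk _ (sub σ (sub φ r)) = Ideal.Quotient.mk _ r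
      rw [Ideal.Quotient.eq]
      refine Submodule.mem_sup_left ?_
      rw [← ker_sub h1 h2, map_sub, sub_surj h2, sub_self]
    · intro x hx
      have hx' : x ∈ idealOfVars (Fin m) k ^ (j+1) := Ideal.Quotient.eq_zero_iff_mem.1 hx
      show Ideal.Quotient.mk _ (sub σ x) = 0
      rw [Ideal.Quotient.eq_zero_iff_mem]
      refine Submodule.mem_sup_right ?_
      have := Ideal.mem_map_of_mem (sub σ) hx'
      rw [Ideal.map_pow] at this
      exact Ideal.pow_right_mono (sub_vars σ) _ this
  calc m.factorial * hilbertSamuelFn (ip U) (j+1) ≤ m.factorial * (monsLT m (j+1)).card := Nat.mul_le_mul_left _ key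
    _ = (j+1).ascFactorial m := card_monsLT _ _
    _ ≤ (j + m)^m := Nat.ascFactorial_le_pow_add _ _
    _ ≤ _ := Nat.pow_le_pow_left (by omega) _

theorem K1_struct {x y : Fin N → k} {φ : (Fin N → k) →ₗ[k] (Fin m → k)}
    {σ : (Fin m → k) →ₗ[k] (Fin N → k)} (h1 : LinearMap.ker φ = Submodule.span k {x, y}) (h2 : ∀ w, φ (σ w) = w)
    (K : Ideal (MvPolynomial (Fin N) k)) (hprim : K.IsPrimary) (hrad : K.radical = ip (Submodule.span k {x, y}))
    (hm : HasMultiplicity K m 2) :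
    ∃ α β : MvPolynomial (Fin m) k, IsRelPrime α β ∧
      ∀ s t, s * lin x + t * lin y ∈ K ↔ sub φ s * β = sub φ t * α := by
  set U := Submodule.span k {x, y} with hU
  have hip : ip U = Ideal.span {lin x, lin y} := ip_pair x y
  have hx : lin x ∈ ip U := lin_mem_ip' (Submodule.subset_span (by simp))
  have hy : lin y ∈ ip U := lin_mem_ip' (Submodule.subset_span (by simp))
  have hKp : K ≤ ip U := hrad ▸ Ideal.le_radical
  have canc : ∀ r g, r * g ∈ K → r ∉ ip U → g ∈ K := by
    intro r g hrg hr
    rw [mul_comm] at hrg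
    rcases (Ideal.isPrimary_iff.1 hprim).2 hrg with h | h
    · exact h
    · rw [hrad] at h; exact absurd h hr
  have hσ : ∀ c, sub σ c ∈ ip U ↔ c = 0 := by
    intro c; rw [← ker_sub h1 h2, sub_surj h2]
  have hsq : ∀ v w, v ∈ ip U → w ∈ ip U → v * w ∈ K := by
    intro v w hv hw
    obtain ⟨c, hc, hcK⟩ := dep h1 h2 K hrad hm ![1, v, v * w]
    simp only [Fin.sum_univ_three, Matrix.cons_val_zero, Matrix.cons_val_one, Matrix.cons_val] at hcK
    have h0 : c 0 = 0 := by
      rw [← hσ]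
      have h3 := (ip U).add_mem ((ip U).mul_mem_left (sub σ (c 1)) hv) ((ip U).mul_mem_left (sub σ (c 2) * v) hw)
      have h4 := (ip U).sub_mem (hKp hcK) h3
      convert h4 using 1; ring
    rw [h0, map_zero, zero_mul, zero_add] at hcK
    by_cases h3 : c 1 = 0
    · rw [h3, map_zero, zero_mul, zero_add] at hcK
      refine canc _ _ hcK ?_
      rw [hσ]
      intro h4
      apply hc; funext i; fin_cases i <;> assumption
    · have h4 : (sub σ (c 1) + sub σ (c 2) * w) * v ∈ K := by convert hcK using 1; ring
      refine K.mul_mem_right _ (canc _ _ h4 ?_)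
      intro h5
      apply h3
      rw [← hσ]
      have := (ip U).sub_mem h5 ((ip U).mul_mem_left (sub σ (c 2)) hw)
      convert this using 1; ring
  obtain ⟨α, β, hrel, hF⟩ : ∃ α β : MvPolynomial (Fin m) k, IsRelPrime α β ∧ sub σ α * lin x + sub σ β * lin y ∈ K := by
    obtain ⟨c, hc, hcK⟩ := dep h1 h2 K hrad hm ![1, lin x, lin y]
    simp only [Fin.sum_univ_three, Matrix.cons_val_zero, Matrix.cons_val_one, Matrix.cons_val] at hcK
    have h0 : c 0 = 0 := by
      rw [← hσ]
      have h3 := (ip U).add_mem ((ip U).mul_mem_left (sub σ (c 1)) hx) ((ip U).mul_mem_left (sub σ (c 2)) hy)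
      have h4 := (ip U).sub_mem (hKp hcK) h3
      convert h4 using 1; ring
    rw [h0, map_zero, zero_mul, zero_add] at hcK
    obtain ⟨d, a', b', ha, hb, hrel⟩ := exists_gcd2 (c 1) (c 2)
    refine ⟨a', b', hrel, canc (sub σ d) _ ?_ ?_⟩
    · rw [ha, hb, map_mul, map_mul] at hcK
      convert hcK using 1; ring
    · rw [hσ]
      rintro rfl
      apply hc; funext i; fin_cases i
      · exact h0
      · simpa using ha
      · simpa using hb
  refine ⟨α, β, hrel, fun s t => ⟨fun h => ?_, fun h => ?_⟩⟩
  · by_contra hne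
    have hne' : s * sub σ β - t * sub σ α ∉ ip U := by
      rw [← ker_sub h1 h2, map_sub, map_mul, map_mul, sub_surj h2, sub_surj h2, sub_eq_zero]
      exact hne
    have hxK : lin x ∈ K := by
      refine canc _ _ ?_ hne'
      have := K.sub_mem (K.mul_mem_left (sub σ β) h) (K.mul_mem_left t hF)
      convert this using 1; ring
    have hyK : lin y ∈ K := by
      refine canc _ _ ?_ hne'
      have := K.sub_mem (K.mul_mem_left s hF) (K.mul_mem_left (sub σ α) h)
      convert this using 1; ring
    have : K = ip U := by
      refine le_antisymm hKp ?_
      rw [hip, Ideal.span_le]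
      rintro _ (rfl | rfl)
      · exact hxK
      · exact hyK
    rw [this] at hm
    exact not_mult h1 h2 hm
  · have hd : α ∣ sub φ s := hrel.dvd_of_dvd_mul_right (Dvd.intro_left _ h.symm)
    obtain ⟨c, hc⟩ := hd
    have hct : β * c = sub φ t ∨ α = 0 := by
      by_cases h0 : α = 0
      · right; exact h0
      · left
        apply mul_left_cancel₀ h0
        rw [hc] at h; linear_combination h
    obtain ⟨c, hc, hct⟩ : ∃ c, sub φ s = α * c ∧ sub φ t = β * c := by
      rcases hct with h3 | h3
      · exact ⟨c, hc, h3.symm⟩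
      · have hu : IsUnit β := by
          apply hrel (by rw [h3]; exact dvd_zero _) dvd_rfl
        obtain ⟨u, hu⟩ := hu
        refine ⟨sub φ t * ↑u⁻¹, ?_, ?_⟩
        · rw [hc, h3]; simp
        · rw [← hu, mul_comm (sub φ t), ← mul_assoc, Units.mul_inv, one_mul]
    have e1 : s - sub σ α * sub σ c ∈ ip U := by
      rw [← ker_sub h1 h2, map_sub, map_mul, sub_surj h2, sub_surj h2, hc, sub_self]
    have e2 : t - sub σ β * sub σ c ∈ ip U := by
      rw [← ker_sub h1 h2, map_sub, map_mul, sub_surj h2, sub_surj h2, hct, sub_self]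
    have := K.add_mem (K.mul_mem_left (sub σ c) hF) (K.add_mem (hsq _ _ e1 hx) (hsq _ _ e2 hy))
    convert this using 1; ring
end

end

section
open MvPolynomial Filter CategoryTheory
noncomputable section

section
variable {k V : Type} [Field k] [AddCommGroup V] [Module k V]

/-- `x, y` is a basis of the plane `W`. -/
structure PB (W : Submodule k V) (x y : V) : Prop where
  eq : W = Submodule.span k {x, y}
  ne : x ≠ 0
  nmem : y ∉ Submodule.span k {x}

theorem PB.hx {W : Submodule k V} {x y : V} (h : PB W x y) : x ∈ W := by
  rw [h.eq]; exact Submodule.subset_span (by simp)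

theorem PB.hy {W : Submodule k V} {x y : V} (h : PB W x y) : y ∈ W := by
  rw [h.eq]; exact Submodule.subset_span (by simp)

theorem PB.linInd {x y : V} (hx : x ≠ 0) (hy : y ∉ Submodule.span k {x}) : LinearIndependent k ![x, y] := by
  rw [LinearIndependent.pair_iff' hx]
  intro a ha
  exact hy (Submodule.mem_span_singleton.2 ⟨a, ha⟩)

theorem PB.finrank {W : Submodule k V} {x y : V} (h : PB W x y) : Module.finrank k W = 2 := by
  have := finrank_span_eq_card (PB.linInd h.ne h.nmem)
  rw [h.eq]
  rw [Matrix.range_cons, Matrix.range_cons, Matrix.range_empty, Set.union_empty, Set.singleton_union] at this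
  simpa using this

theorem pb_of_two [FiniteDimensional k V] {W : Submodule k V} (hW : Module.finrank k W = 2) {x y : V} (hx : x ∈ W) (hy : y ∈ W)
    (h0 : x ≠ 0) (h1 : y ∉ Submodule.span k {x}) : PB W x y := by
  refine ⟨?_, h0, h1⟩
  symm
  apply Submodule.eq_of_le_of_finrank_eq
  · rw [Submodule.span_le]
    rintro _ (rfl | rfl) <;> assumption
  · rw [hW]
    exact PB.finrank ⟨rfl, h0, h1⟩

theorem pb_of_one [FiniteDimensional k V] {W : Submodule k V} (hW : Module.finrank k W = 2) {x : V} (hx : x ∈ W)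
    (h0 : x ≠ 0) : ∃ y, PB W x y := by
  by_contra hcon
  push Not at hcon
  have : W ≤ Submodule.span k {x} := by
    intro y hy
    by_contra h
    exact hcon y (pb_of_two hW hx hy h0 h)
  have h2 := Submodule.finrank_mono this
  rw [finrank_span_singleton h0, hW] at h2
  omega

theorem exists_pb [FiniteDimensional k V] {W : Submodule k V} (hW : Module.finrank k W = 2) : ∃ x y, PB W x y := by
  have : W ≠ ⊥ := by rintro rfl; simp at hW
  obtain ⟨x, hx, h0⟩ := Submodule.exists_mem_ne_zero_of_ne_bot this
  exact ⟨x, pb_of_one hW hx h0⟩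

theorem PB.not_mem_of_disj {W U : Submodule k V} {x y : V} (h : PB W x y) (hd : W ⊓ U = ⊥) :
    x ∉ U ∧ y ∉ U ⊔ Submodule.span k {x} := by
  constructor
  · intro hx
    have : x ∈ W ⊓ U := ⟨h.hx, hx⟩
    rw [hd] at this
    exact h.ne (by simpa using this)
  · intro hy
    obtain ⟨u, hu, c, hc, huc⟩ := Submodule.mem_sup.1 hy
    have hcW : c ∈ W := by
      have : Submodule.span k {x} ≤ W := by rw [Submodule.span_singleton_le_iff_mem]; exact h.hx
      exact this hc
    have : u ∈ W ⊓ U := ⟨by have := W.sub_mem h.hy hcW; rw [← huc] at this; simpa using this, hu⟩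
    rw [hd] at this
    have h0 : u = 0 := by simpa using this
    rw [h0, zero_add] at huc
    exact h.nmem (huc ▸ hc)

theorem PB.swap {W : Submodule k V} {x y : V} (h : PB W x y) : PB W y x := by
  refine ⟨by rw [h.eq, Set.pair_comm], ?_, ?_⟩
  · rintro rfl; exact h.nmem (Submodule.zero_mem _)
  · intro hx
    obtain ⟨c, hc⟩ := Submodule.mem_span_singleton.1 hx
    have hc0 : c ≠ 0 := by
      rintro rfl; rw [zero_smul] at hc; exact h.ne hc.symm
    apply h.nmem
    rw [Submodule.mem_span_singleton]
    exact ⟨c⁻¹, by rw [← hc, smul_smul, inv_mul_cancel₀ hc0, one_smul]⟩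
end

section
variable {B : Type} [CommRing B] [IsDomain B] [UniqueFactorizationMonoid B]

theorem dvd_of_relprime {a b c e : B} (h : IsRelPrime a b) (h1 : c ∣ a * e) (h2 : c ∣ b * e) : c ∣ e := by
  classical
  letI := UniqueFactorizationMonoid.toGCDMonoid B
  have h3 : c ∣ gcd (a * e) (b * e) := dvd_gcd h1 h2
  have h4 : gcd (a * e) (b * e) ∣ gcd a b * e := (gcd_mul_right' e a b).dvd
  have h5 : IsUnit (gcd a b) := h (gcd_dvd_left _ _) (gcd_dvd_right _ _)
  exact (h5.dvd_mul_left).1 (h3.trans h4)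
end

variable {k : Type} [Field k] {N m : ℕ}

theorem PB.ip {W : Submodule k (Fin N → k)} {x y} (h : PB W x y) : ip W = Ideal.span {lin x, lin y} := by
  rw [h.eq, ip_pair]

theorem PB.relp {W U : Submodule k (Fin N → k)} {x y} (h : PB W x y) (hd : W ⊓ U = ⊥) :
    IsRelPrime (Ideal.Quotient.mk (_root_.ip U) (lin x)) (Ideal.Quotient.mk (_root_.ip U) (lin y)) := by
  obtain ⟨h1, h2⟩ := h.not_mem_of_disj hd
  exact relprime_mk_lin h1 h2

theorem PB.pd {W : Submodule k (Fin N → k)} {x y} (h : PB W x y) : pdl (MvPolynomial (Fin N) k) (_root_.ip W) 1 := by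
  rw [h.ip]
  exact pdi_two (pdl_projective 0) _ _

theorem PB.DL {W : Submodule k (Fin N → k)} {x y} (h : PB W x y) {f₁ f₂ : MvPolynomial (Fin N) k} (hrel : IsRelPrime f₁ f₂)
    (h1 : f₁ ≠ 0) (h2 : f₂ ≠ 0) (hf1 : f₁ ∈ _root_.ip W) (hf2 : f₂ ∈ _root_.ip W) : ∃ Δ, DL (Ideal.span {f₁, f₂}) (_root_.ip W) Δ := by
  rw [h.ip] at *
  refine exists_DL hrel h1 h2 (prime_lin h.ne) ?_ hf1 hf2
  rw [lin_dvd, lin_mem_ip]; exact h.nmem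

/-- structure of the primary ideal `K₁`. -/
structure KS (x y : Fin N → k) (K : Ideal (MvPolynomial (Fin N) k)) (a b : MvPolynomial (Fin N) k) : Prop where
  le : K ≤ ip (Submodule.span k {x, y})
  mem : ∀ s t, s * lin x + t * lin y ∈ K ↔ s * b - t * a ∈ ip (Submodule.span k {x, y})
  rel : IsRelPrime (Ideal.Quotient.mk (ip (Submodule.span k {x, y})) a) (Ideal.Quotient.mk (ip (Submodule.span k {x, y})) b)

theorem relprime_sub {U : Submodule k (Fin N → k)} {φ : (Fin N → k) →ₗ[k] (Fin m → k)}
    {σ : (Fin m → k) →ₗ[k] (Fin N → k)} (h1 : LinearMap.ker φ = U) (h2 : ∀ w, φ (σ w) = w) {α β : MvPolynomial (Fin m) k}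
    (h : IsRelPrime α β) : IsRelPrime (Ideal.Quotient.mk (ip U) (sub σ α)) (Ideal.Quotient.mk (ip U) (sub σ β)) := by
  intro c hc1 hc2
  obtain ⟨r, rfl⟩ := Ideal.Quotient.mk_surjective c
  have key : ∀ γ, Ideal.Quotient.mk (ip U) r ∣ Ideal.Quotient.mk (ip U) (sub σ γ) → sub φ r ∣ γ := by
    rintro γ ⟨q, hq⟩
    obtain ⟨q, rfl⟩ := Ideal.Quotient.mk_surjective q
    rw [← map_mul, Ideal.Quotient.eq, ← ker_sub h1 h2, map_sub, map_mul, sub_surj h2, sub_eq_zero] at hq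
    exact ⟨_, hq⟩
  have := h (key _ hc1) (key _ hc2)
  obtain ⟨e, he⟩ := this.exists_right_inv
  refine IsUnit.of_mul_eq_one (Ideal.Quotient.mk (ip U) (sub σ e)) ?_
  rw [← map_mul, ← map_one (Ideal.Quotient.mk (ip U)), Ideal.Quotient.eq, ← ker_sub h1 h2, map_sub, map_mul, sub_surj h2, he, map_one, sub_self]

theorem exists_KS {x y : Fin N → k} {φ : (Fin N → k) →ₗ[k] (Fin m → k)}
    {σ : (Fin m → k) →ₗ[k] (Fin N → k)} (h1 : LinearMap.ker φ = Submodule.span k {x, y}) (h2 : ∀ w, φ (σ w) = w)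
    (K : Ideal (MvPolynomial (Fin N) k)) (hprim : K.IsPrimary) (hrad : K.radical = ip (Submodule.span k {x, y}))
    (hm : HasMultiplicity K m 2) : ∃ α β : MvPolynomial (Fin m) k, KS x y K (sub σ α) (sub σ β) := by
  obtain ⟨α, β, hrel, h⟩ := K1_struct h1 h2 K hprim hrad hm
  refine ⟨α, β, hrad ▸ Ideal.le_radical, fun s t => ?_, relprime_sub h1 h2 hrel⟩
  rw [h, ← ker_sub h1 h2, map_sub, map_mul, map_mul, sub_surj h2, sub_surj h2, sub_eq_zero]

theorem KS.delta {x y : Fin N → k} {K : Ideal (MvPolynomial (Fin N) k)} {a b : MvPolynomial (Fin N) k}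
    (h : KS x y K a b) : ∃ δ : ip (Submodule.span k {x, y}) →ₗ[MvPolynomial (Fin N) k] (MvPolynomial (Fin N) k ⧸ ip (Submodule.span k {x, y})),
      (∀ s t (z : ip (Submodule.span k {x, y})), z.1 = s * lin x + t * lin y → δ z = Ideal.Quotient.mk _ (s * b - t * a)) ∧
      (∀ z, z.1 ∈ K ↔ δ z = 0) := by
  have hex : ∀ z : ip (Submodule.span k {x, y}), ∃ s t, s * lin x + t * lin y = z.1 := by
    intro z
    exact Ideal.mem_span_pair.1 ((ip_pair x y).le z.2)
  choose S T hST using hex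
  have key : ∀ s t (z : ip (Submodule.span k {x, y})), z.1 = s * lin x + t * lin y →
      (Ideal.Quotient.mk (ip (Submodule.span k {x, y})) (S z * b - T z * a)) = Ideal.Quotient.mk _ (s * b - t * a) := by
    intro s t z hz
    rw [Ideal.Quotient.eq]
    have h0 : (S z - s) * lin x + (T z - t) * lin y ∈ K := by
      have : (S z - s) * lin x + (T z - t) * lin y = 0 := by
        have := hST z
        linear_combination this + hz
      rw [this]; exact K.zero_mem
    rw [h.mem] at h0
    convert h0 using 1; ring
  refine ⟨{ toFun := fun z => Ideal.Quotient.mk _ (S z * b - T z * a), map_add' := ?_, map_smul' := ?_ }, ?_, ?_⟩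
  · intro z w
    rw [key (S z + S w) (T z + T w) (z + w)]
    · rw [← map_add]; congr 1; ring
    · rw [Submodule.coe_add, ← hST z, ← hST w]; ring
  · intro r z
    rw [key (r * S z) (r * T z) (r • z)]
    · show _ = Ideal.Quotient.mk _ (r * (S z * b - T z * a))
      congr 1; ring
    · rw [Submodule.coe_smul, ← hST z, smul_eq_mul]; ring
  · intro s t z hz
    exact key s t z hz
  · intro z
    show z.1 ∈ K ↔ Ideal.Quotient.mk _ (S z * b - T z * a) = 0
    rw [Ideal.Quotient.eq_zero_iff_mem, ← h.mem, hST]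
end

end

section
open MvPolynomial Filter CategoryTheory
noncomputable section

def mkOn {R : Type} [CommRing R] (p H : Ideal R) : H →ₗ[R] R ⧸ p := p.mkQ ∘ₗ H.subtype

theorem mkOn_apply {R : Type} [CommRing R] (p H : Ideal R) (h : H) : mkOn p H h = Ideal.Quotient.mk p h.1 := rfl

theorem mkOn_eq_zero {R : Type} [CommRing R] (p H : Ideal R) (h : H) : mkOn p H h = 0 ↔ h.1 ∈ p := by
  rw [mkOn_apply, Ideal.Quotient.eq_zero_iff_mem]

theorem mkOn_hk {R : Type} [CommRing R] (p H : Ideal R) (h : H) : h.1 ∈ H ⊓ p ↔ mkOn p H h = 0 := by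
  rw [mkOn_eq_zero]; exact ⟨fun h => h.2, fun hh => ⟨h.2, hh⟩⟩

theorem mkOn_hu {R : Type} [CommRing R] {F p H : Ideal R} {Δ : R} (D : DL F p Δ) (h : H) (r : R)
    (hr : Ideal.Quotient.mk p r = mkOn p H h) : Δ * h - r * Δ ∈ F := by
  rw [mkOn_apply, Ideal.Quotient.eq] at hr
  have := F.neg_mem (D.kill _ hr)
  convert this using 1; ring

theorem mkOn_ne {R : Type} [CommRing R] {p H : Ideal R} (h : ¬ H ≤ p) : ∃ h, mkOn p H h ≠ 0 := by
  obtain ⟨z, hz, hzp⟩ := SetLike.not_le_iff_exists.1 h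
  exact ⟨⟨z, hz⟩, by rwa [Ne, mkOn_eq_zero]⟩

theorem col_top {R : Type} [CommRing R] (F : Ideal R) : col F ⊤ = F := by
  ext r
  rw [mem_col]
  exact ⟨fun h => by simpa using h 1 trivial, fun h z _ => F.mul_mem_right _ h⟩

variable {k : Type} [Field k] {N m : ℕ}

theorem ip_not_le {U W : Submodule k (Fin N → k)} (hU : Module.finrank k U = 2) (hW : Module.finrank k W = 2)
    (h : U ≠ W) : ¬ ip U ≤ ip W := by
  rw [ip_le_iff]
  intro hle
  exact h (Submodule.eq_of_le_of_finrank_eq hle (by rw [hU, hW]))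

/-- data for case A. -/
theorem caseA_start {V : Submodule k (Fin N → k)} {x y} (hV : PB V x y) {f₁ f₂ Δ : MvPolynomial (Fin N) k}
    (D : DL (Ideal.span {f₁, f₂}) (ip V) Δ) :
    pdl (MvPolynomial (Fin N) k) (col (Ideal.span {f₁, f₂}) (ip V)) 2 := by
  refine step_E D hV.pd (EE_top _) D.le le_top (mkOn (ip V) ⊤) ?_ ?_ ?_
  · intro h; rw [mkOn_eq_zero]
  · refine mkOn_ne ?_
    intro h
    exact (ip_prime V).ne_top (top_le_iff.1 h)
  · rw [col_top]
    exact pdl_mono (pdi_two (pdl_projective 0) _ _) (by norm_num)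

theorem caseA_I {V₂ V₃ : Submodule k (Fin N → k)} {x y z w z' w' : Fin N → k} {K₁ : Ideal (MvPolynomial (Fin N) k)} {a b : MvPolynomial (Fin N) k}
    (h₁ : PB (Submodule.span k {x, y}) x y) (h₂ : PB V₂ z w) (h₃ : PB V₃ z' w')
    (h12 : V₂ ⊓ Submodule.span k {x, y} = ⊥) (h13 : V₃ ⊓ Submodule.span k {x, y} = ⊥) (h23 : V₂ ≠ V₃) (hK : KS x y K₁ a b)
    {f₁ f₂ : MvPolynomial (Fin N) k} (hrel : IsRelPrime f₁ f₂) (hf1 : f₁ ≠ 0) (hf2 : f₂ ≠ 0)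
    (hF : Ideal.span {f₁, f₂} ≤ K₁ ⊓ ip V₂ ⊓ ip V₃) :
    pdl (MvPolynomial (Fin N) k) (col (Ideal.span {f₁, f₂}) (K₁ ⊓ ip V₂ ⊓ ip V₃)) 2 := by
  have F1 : f₁ ∈ Ideal.span {f₁, f₂} := Ideal.subset_span (by simp)
  have F2 : f₂ ∈ Ideal.span {f₁, f₂} := Ideal.subset_span (by simp)
  obtain ⟨Δ₁, D₁⟩ := h₁.DL hrel hf1 hf2 (hK.le (hF F1).1.1) (hK.le (hF F2).1.1)
  obtain ⟨Δ₂, D₂⟩ := h₂.DL hrel hf1 hf2 (hF F1).1.2 (hF F2).1.2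
  obtain ⟨Δ₃, D₃⟩ := h₃.DL hrel hf1 hf2 (hF F1).2 (hF F2).2
  have s1 := caseA_start h₂ D₂
  have s2 : pdl (MvPolynomial (Fin N) k) (col (Ideal.span {f₁, f₂}) (ip V₂ ⊓ ip V₃)) 2 := by
    refine step_E D₃ h₃.pd D₂.ext (le_inf D₂.le D₃.le) inf_le_left (mkOn (ip V₃) (ip V₂)) (mkOn_hk _ _) (mkOn_ne ?_) s1
    exact ip_not_le h₂.finrank h₃.finrank h23
  have r2 := h₂.relp h12
  have r3 := h₃.relp h13
  have hz2 : lin z ∈ ip V₂ := lin_mem_ip' h₂.hx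
  have hw2 : lin w ∈ ip V₂ := lin_mem_ip' h₂.hy
  have hz3 : lin z' ∈ ip V₃ := lin_mem_ip' h₃.hx
  have hw3 : lin w' ∈ ip V₃ := lin_mem_ip' h₃.hy
  have gc : ∀ c : MvPolynomial (Fin N) k ⧸ ip (Submodule.span k {x, y}),
      (∀ p ∈ ip V₂, ∀ q ∈ ip V₃, c ∣ Ideal.Quotient.mk _ (p * q)) → IsUnit c := by
    intro c hc
    have e1 : c ∣ Ideal.Quotient.mk _ (lin z') := dvd_of_relprime r2
      (by rw [← map_mul]; exact hc _ hz2 _ hz3) (by rw [← map_mul]; exact hc _ hw2 _ hz3)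
    have e2 : c ∣ Ideal.Quotient.mk _ (lin w') := dvd_of_relprime r2
      (by rw [← map_mul]; exact hc _ hz2 _ hw3) (by rw [← map_mul]; exact hc _ hw2 _ hw3)
    exact r3 e1 e2
  have s3 : pdl (MvPolynomial (Fin N) k) (col (Ideal.span {f₁, f₂}) (ip V₂ ⊓ ip V₃ ⊓ ip (Submodule.span k {x, y}))) 2 := by
    refine step_u D₁ h₁.pd inf_le_left (mkOn _ _) (mkOn_hk _ _) ?_ Δ₁ (mkOn_hu D₁) s2
    intro c hc
    refine gc c fun p hp q hq => ?_
    exact hc ⟨p * q, Ideal.mul_mem_right _ _ hp, Ideal.mul_mem_left _ _ hq⟩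
  obtain ⟨δ, hδ, hδK⟩ := hK.delta
  obtain ⟨u, hu⟩ := D₁.u_of_E D₁.ext δ (fun h hh => (hδK h).1 (hF hh).1.1)
  have hle : ip V₂ ⊓ ip V₃ ⊓ ip (Submodule.span k {x, y}) ≤ ip (Submodule.span k {x, y}) := inf_le_right
  have s4 : pdl (MvPolynomial (Fin N) k) (col (Ideal.span {f₁, f₂}) (ip V₂ ⊓ ip V₃ ⊓ ip (Submodule.span k {x, y}) ⊓ K₁)) 2 := by
    refine step_u D₁ h₁.pd inf_le_left (δ ∘ₗ Submodule.inclusion hle) ?_ ?_ u ?_ s3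
    · intro h
      rw [LinearMap.comp_apply, ← hδK]
      exact ⟨fun hh => hh.2, fun hh => ⟨h.2, hh⟩⟩
    · intro c hc
      refine gc c fun p hp q hq => ?_
      have mm : ∀ v ∈ ip (Submodule.span k {x, y}), p * q * v ∈ ip V₂ ⊓ ip V₃ ⊓ ip (Submodule.span k {x, y}) := fun v hv =>
        ⟨⟨by rw [mul_assoc]; exact Ideal.mul_mem_right _ _ hp, by rw [mul_assoc]; exact Ideal.mul_mem_left _ _ (Ideal.mul_mem_right _ _ hq)⟩, Ideal.mul_mem_left _ _ hv⟩
      have e1 := hc ⟨_, mm _ (lin_mem_ip' h₁.hx)⟩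
      have e2 := hc ⟨_, mm _ (lin_mem_ip' h₁.hy)⟩
      rw [LinearMap.comp_apply, hδ (p * q) 0 _ (by simp [Submodule.inclusion])] at e1
      rw [LinearMap.comp_apply, hδ 0 (p * q) _ (by simp [Submodule.inclusion])] at e2
      refine dvd_of_relprime hK.rel ?_ ?_
      · rw [← map_mul]
        convert (dvd_neg.2 e2) using 1
        rw [← map_neg]; congr 1; ring
      · rw [← map_mul]
        convert e1 using 2; ring
    · intro h r hr
      exact hu (Submodule.inclusion hle h) r hr
  have heq : K₁ ⊓ ip V₂ ⊓ ip V₃ = ip V₂ ⊓ ip V₃ ⊓ ip (Submodule.span k {x, y}) ⊓ K₁ := by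
   apply le_antisymm
   · intro v hv
     exact ⟨⟨⟨hv.1.2, hv.2⟩, hK.le hv.1.1⟩, hv.1.1⟩
   · intro v hv
     exact ⟨⟨hv.2, hv.1.1.1⟩, hv.1.1.2⟩
  rw [heq]; exact s4

theorem caseA_II {V₂ V₃ : Submodule k (Fin N → k)} {x y z z' w' : Fin N → k} {K₁ : Ideal (MvPolynomial (Fin N) k)} {a b : MvPolynomial (Fin N) k}
    (h₁ : PB (Submodule.span k {x, y}) x y) (h₂ : PB V₂ x z) (h₃ : PB V₃ z' w')
    (h12 : Submodule.span k {x, y} ≠ V₂) (h13 : Submodule.span k {x, y} ≠ V₃) (h23 : V₂ ≠ V₃) (hK : KS x y K₁ a b)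
    (hcase : (Submodule.span k {x, y} ⊓ V₃ = ⊥ ∧ V₂ ⊓ V₃ = ⊥) ∨ (x ∈ V₃ ∨ y ∈ V₃ ∨ z ∈ V₃))
    {f₁ f₂ : MvPolynomial (Fin N) k} (hrel : IsRelPrime f₁ f₂) (hf1 : f₁ ≠ 0) (hf2 : f₂ ≠ 0)
    (hF : Ideal.span {f₁, f₂} ≤ K₁ ⊓ ip V₂ ⊓ ip V₃) :
    pdl (MvPolynomial (Fin N) k) (col (Ideal.span {f₁, f₂}) (K₁ ⊓ ip V₂ ⊓ ip V₃)) 2 := by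
  have F1 : f₁ ∈ Ideal.span {f₁, f₂} := Ideal.subset_span (by simp)
  have F2 : f₂ ∈ Ideal.span {f₁, f₂} := Ideal.subset_span (by simp)
  obtain ⟨Δ₁, D₁⟩ := h₁.DL hrel hf1 hf2 (hK.le (hF F1).1.1) (hK.le (hF F2).1.1)
  obtain ⟨Δ₂, D₂⟩ := h₂.DL hrel hf1 hf2 (hF F1).1.2 (hF F2).1.2
  obtain ⟨Δ₃, D₃⟩ := h₃.DL hrel hf1 hf2 (hF F1).2 (hF F2).2
  set p₁ := ip (Submodule.span k {x, y}) with hp₁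
  have n12 : ¬ p₁ ≤ ip V₂ := ip_not_le h₁.finrank h₂.finrank h12
  have n13 : ¬ p₁ ≤ ip V₃ := ip_not_le h₁.finrank h₃.finrank h13
  have n23 : ¬ ip V₂ ≤ ip V₃ := ip_not_le h₂.finrank h₃.finrank h23
  have n21 : ¬ ip V₂ ≤ p₁ := ip_not_le h₂.finrank h₁.finrank h12.symm
  have n31 : ¬ ip V₃ ≤ p₁ := ip_not_le h₃.finrank h₁.finrank h13.symm
  have hx1 : lin x ∈ p₁ := lin_mem_ip' h₁.hx
  have hy1 : lin y ∈ p₁ := lin_mem_ip' h₁.hy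
  have hx2 : lin x ∈ ip V₂ := lin_mem_ip' h₂.hx
  have hz2 : lin z ∈ ip V₂ := lin_mem_ip' h₂.hy
  have hy2 : lin y ∉ ip V₂ := by
    intro h; apply n12; rw [hp₁, h₁.ip, Ideal.span_le]; rintro _ (rfl | rfl); exacts [hx2, h]
  have hz1 : lin z ∉ p₁ := by
    intro h; apply n21; rw [h₂.ip, Ideal.span_le]; rintro _ (rfl | rfl); exacts [hx1, h]
  have P2 : (ip V₂).IsPrime := ip_prime _
  have P1 : p₁.IsPrime := ip_prime _
  have P3 : (ip V₃).IsPrime := ip_prime _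
  have s1 := caseA_start h₁ D₁
  have s2 : pdl (MvPolynomial (Fin N) k) (col (Ideal.span {f₁, f₂}) (p₁ ⊓ ip V₂)) 2 :=
    step_E D₂ h₂.pd D₁.ext (le_inf D₁.le D₂.le) inf_le_left (mkOn (ip V₂) p₁) (mkOn_hk _ _) (mkOn_ne n12) s1
  have E2 : EE (Ideal.span {f₁, f₂}) (p₁ ⊓ ip V₂) := by
    refine E_step D₂ D₁.ext (le_inf D₁.le D₂.le) inf_le_left (lin y) hy1 ?_ ?_
    · intro v hv
      rw [hp₁, h₁.ip] at hv
      obtain ⟨s, t, rfl⟩ := Ideal.mem_span_pair.1 hv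
      refine ⟨t, ?_⟩
      rw [add_sub_cancel_right]
      exact ⟨Ideal.mul_mem_left _ _ hx1, Ideal.mul_mem_left _ _ hx2⟩
    · intro r
      constructor
      · intro h
        exact (P2.mem_or_mem h.2).resolve_right hy2
      · intro h
        exact ⟨Ideal.mul_mem_left _ _ hy1, Ideal.mul_mem_right _ _ h⟩
  obtain ⟨δ, hδ, hδK⟩ := hK.delta
  have hδne : ∀ q ∉ p₁, ¬ (Ideal.Quotient.mk p₁ (q * b) = 0 ∧ Ideal.Quotient.mk p₁ (q * lin z * a) = 0) := by
    rintro q hq ⟨e1, e2⟩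
    rw [Ideal.Quotient.eq_zero_iff_mem] at e1 e2
    have hb := (P1.mem_or_mem e1).resolve_left hq
    have ha := (P1.mem_or_mem e2).resolve_left (fun h => (P1.mem_or_mem h).elim hq hz1)
    have h0 : IsUnit (0 : MvPolynomial (Fin N) k ⧸ ip (Submodule.span k {x,y})) :=
      hK.rel (by rw [Ideal.Quotient.eq_zero_iff_mem.2 ha]) (by rw [Ideal.Quotient.eq_zero_iff_mem.2 hb])
    exact not_isUnit_zero h0
  have hFK : Ideal.span {f₁, f₂} ≤ K₁ := hF.trans (inf_le_left.trans inf_le_left)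
  have δk : ∀ (H : Ideal (MvPolynomial (Fin N) k)) (hle : H ≤ p₁) (h : H), h.1 ∈ H ⊓ K₁ ↔ (δ ∘ₗ Submodule.inclusion hle) h = 0 := by
    intro H hle h
    rw [LinearMap.comp_apply, ← hδK]
    exact ⟨fun hh => hh.2, fun hh => ⟨h.2, hh⟩⟩
  have δn : ∀ (H : Ideal (MvPolynomial (Fin N) k)) (hle : H ≤ p₁) q, q ∉ p₁ → q * lin x ∈ H → q * (lin y * lin z) ∈ H →
      ∃ h, (δ ∘ₗ Submodule.inclusion hle) h ≠ 0 := by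
    intro H hle q hq e1 e2
    by_contra hcon
    push Not at hcon
    have c1 := hcon ⟨_, e1⟩
    have c2 := hcon ⟨_, e2⟩
    rw [LinearMap.comp_apply, hδ q 0 _ (by simp [Submodule.inclusion])] at c1
    rw [LinearMap.comp_apply, hδ 0 (q * lin z) _ (by simp [Submodule.inclusion]; ring)] at c2
    refine hδne q hq ⟨?_, ?_⟩
    · rw [← c1]; congr 1; ring
    · rw [← neg_eq_zero, ← map_neg, ← c2]; congr 1; ring
  rcases hcase with ⟨d13, d23⟩ | hcase
  · have hle : p₁ ⊓ ip V₂ ≤ p₁ := inf_le_left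
    have s3 : pdl (MvPolynomial (Fin N) k) (col (Ideal.span {f₁, f₂}) (p₁ ⊓ ip V₂ ⊓ K₁)) 2 := by
      refine step_E D₁ h₁.pd E2 (le_inf (le_inf D₁.le D₂.le) hFK) inf_le_left (δ ∘ₗ Submodule.inclusion hle) (δk _ _) ?_ s2
      refine δn _ hle 1 (fun h => P1.ne_top ((Ideal.eq_top_iff_one _).2 h)) ?_ ?_
      · rw [one_mul]; exact ⟨hx1, hx2⟩
      · rw [one_mul]; exact ⟨Ideal.mul_mem_right _ _ hy1, Ideal.mul_mem_left _ _ hz2⟩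
    have s4 : pdl (MvPolynomial (Fin N) k) (col (Ideal.span {f₁, f₂}) (p₁ ⊓ ip V₂ ⊓ K₁ ⊓ ip V₃)) 2 := by
      refine step_u D₃ h₃.pd inf_le_left (mkOn _ _) (mkOn_hk _ _) ?_ Δ₃ (mkOn_hu D₃) s3
      intro c hc
      have m1 : lin x * lin x ∈ p₁ ⊓ ip V₂ ⊓ K₁ := by
        refine ⟨⟨Ideal.mul_mem_left _ _ hx1, Ideal.mul_mem_left _ _ hx2⟩, ?_⟩
        have := (hK.mem (lin x) 0).2 (by simpa using Ideal.mul_mem_right _ _ hx1)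
        simpa using this
      have m2 : lin y * lin z * lin y ∈ p₁ ⊓ ip V₂ ⊓ K₁ := by
        refine ⟨⟨Ideal.mul_mem_left _ _ hy1, Ideal.mul_mem_right _ _ (Ideal.mul_mem_left _ _ hz2)⟩, ?_⟩
        have := (hK.mem 0 (lin y * lin z)).2 (by
          have := p₁.neg_mem (Ideal.mul_mem_right a _ (Ideal.mul_mem_right (lin z) _ hy1))
          simpa using this)
        simpa using this
      have e1 := hc ⟨_, m1⟩
      have e2 := hc ⟨_, m2⟩
      rw [mkOn_apply] at e1 e2
      simp only [map_mul] at e1 e2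
      have r1 := h₁.relp d13
      have r2 := h₂.relp d23
      have := ((r1.mul_right r2).mul_right r1)
      exact (IsRelPrime.mul_left this this) e1 e2
    have heq : K₁ ⊓ ip V₂ ⊓ ip V₃ = p₁ ⊓ ip V₂ ⊓ K₁ ⊓ ip V₃ := by
      apply le_antisymm
      · intro v hv
        exact ⟨⟨⟨hK.le hv.1.1, hv.1.2⟩, hv.1.1⟩, hv.2⟩
      · intro v hv
        exact ⟨⟨hv.1.2, hv.1.1.2⟩, hv.2⟩
    rw [heq]; exact s4
  · have nQ : ¬ p₁ ⊓ ip V₂ ≤ ip V₃ := by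
      intro h
      rcases (P3.inf_le).1 h with h | h
      exacts [n13 h, n23 h]
    have s3 : pdl (MvPolynomial (Fin N) k) (col (Ideal.span {f₁, f₂}) (p₁ ⊓ ip V₂ ⊓ ip V₃)) 2 :=
      step_E D₃ h₃.pd E2 (le_inf (le_inf D₁.le D₂.le) D₃.le) inf_le_left (mkOn _ _) (mkOn_hk _ _) (mkOn_ne nQ) s2
    have hQ : ∀ v ∈ p₁ ⊓ ip V₂, ∃ s t, v = s * lin x + t * (lin y * lin z) := by
      rintro v ⟨hv1, hv2⟩
      rw [hp₁, h₁.ip] at hv1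
      obtain ⟨s, t, rfl⟩ := Ideal.mem_span_pair.1 hv1
      have : t * lin y ∈ ip V₂ := by
        have := (ip V₂).sub_mem hv2 (Ideal.mul_mem_left _ s hx2)
        simpa using this
      have := (P2.mem_or_mem this).resolve_right hy2
      rw [h₂.ip] at this
      obtain ⟨s', t', rfl⟩ := Ideal.mem_span_pair.1 this
      exact ⟨s + s' * lin y, t', by ring⟩
    have hxQ : lin x ∈ p₁ ⊓ ip V₂ := ⟨hx1, hx2⟩
    have hyzQ : lin y * lin z ∈ p₁ ⊓ ip V₂ := ⟨Ideal.mul_mem_right _ _ hy1, Ideal.mul_mem_left _ _ hz2⟩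
    have E3 : EE (Ideal.span {f₁, f₂}) (p₁ ⊓ ip V₂ ⊓ ip V₃) := by
      by_cases hx3 : lin x ∈ ip V₃
      · have hyz3 : lin y * lin z ∉ ip V₃ := by
          intro h
          apply nQ
          intro v hv
          obtain ⟨s, t, rfl⟩ := hQ v hv
          exact add_mem (Ideal.mul_mem_left _ _ hx3) (Ideal.mul_mem_left _ _ h)
        refine E_step D₃ E2 (le_inf (le_inf D₁.le D₂.le) D₃.le) inf_le_left (lin y * lin z) hyzQ ?_ ?_
        · intro v hv
          obtain ⟨s, t, rfl⟩ := hQ v hv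
          refine ⟨t, ?_⟩
          rw [add_sub_cancel_right]
          exact ⟨Ideal.mul_mem_left _ _ hxQ, Ideal.mul_mem_left _ _ hx3⟩
        · intro r
          exact ⟨fun h => (P3.mem_or_mem h.2).resolve_right hyz3, fun h => ⟨Ideal.mul_mem_left _ _ hyzQ, Ideal.mul_mem_right _ _ h⟩⟩
      · have hyz3 : lin y * lin z ∈ ip V₃ := by
          rcases hcase with h | h | h
          · exact absurd (lin_mem_ip' h) hx3
          · exact Ideal.mul_mem_right _ _ (lin_mem_ip' h)
          · exact Ideal.mul_mem_left _ _ (lin_mem_ip' h)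
        refine E_step D₃ E2 (le_inf (le_inf D₁.le D₂.le) D₃.le) inf_le_left (lin x) hxQ ?_ ?_
        · intro v hv
          obtain ⟨s, t, rfl⟩ := hQ v hv
          refine ⟨s, ?_⟩
          rw [add_sub_cancel_left]
          exact ⟨Ideal.mul_mem_left _ _ hyzQ, Ideal.mul_mem_left _ _ hyz3⟩
        · intro r
          exact ⟨fun h => (P3.mem_or_mem h.2).resolve_right hx3, fun h => ⟨Ideal.mul_mem_left _ _ hxQ, Ideal.mul_mem_right _ _ h⟩⟩
    have hle : p₁ ⊓ ip V₂ ⊓ ip V₃ ≤ p₁ := inf_le_left.trans inf_le_left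
    have s4 : pdl (MvPolynomial (Fin N) k) (col (Ideal.span {f₁, f₂}) (p₁ ⊓ ip V₂ ⊓ ip V₃ ⊓ K₁)) 2 := by
      refine step_E D₁ h₁.pd E3 (le_inf (le_inf (le_inf D₁.le D₂.le) D₃.le) hFK) inf_le_left (δ ∘ₗ Submodule.inclusion hle) (δk _ _) ?_ s3
      obtain ⟨q, hq3, hq1⟩ := SetLike.not_le_iff_exists.1 n31
      exact δn _ hle q hq1 ⟨Ideal.mul_mem_left _ _ hxQ, Ideal.mul_mem_right _ _ hq3⟩ ⟨Ideal.mul_mem_left _ _ hyzQ, Ideal.mul_mem_right _ _ hq3⟩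
    have heq : K₁ ⊓ ip V₂ ⊓ ip V₃ = p₁ ⊓ ip V₂ ⊓ ip V₃ ⊓ K₁ := by
      apply le_antisymm
      · intro v hv
        exact ⟨⟨⟨hK.le hv.1.1, hv.1.2⟩, hv.2⟩, hv.1.1⟩
      · intro v hv
        exact ⟨⟨hv.2, hv.1.1.2⟩, hv.1.2⟩
    rw [heq]; exact s4
end

end

section
open MvPolynomial Filter CategoryTheory
noncomputable section

theorem mem_pair_mul {B : Type} [CommRing B] {a b c : B} {𝔞 : Ideal B} :
    c ∈ Ideal.span {a, b} * 𝔞 ↔ ∃ u ∈ 𝔞, ∃ v ∈ 𝔞, c = a * u + b * v := by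
  rw [Ideal.span_insert, Ideal.sup_mul, Submodule.mem_sup]
  constructor
  · rintro ⟨p, hp, q, hq, rfl⟩
    obtain ⟨u, hu, rfl⟩ := Ideal.mem_span_singleton_mul.1 hp
    obtain ⟨v, hv, rfl⟩ := Ideal.mem_span_singleton_mul.1 hq
    exact ⟨u, hu, v, hv, rfl⟩
  · rintro ⟨u, hu, v, hv, rfl⟩
    exact ⟨_, Ideal.mem_span_singleton_mul.2 ⟨u, hu, rfl⟩, _, Ideal.mem_span_singleton_mul.2 ⟨v, hv, rfl⟩, rfl⟩

theorem mem_map_mk {R : Type} [CommRing R] {p H : Ideal R} {c : R ⧸ p} :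
    c ∈ H.map (Ideal.Quotient.mk p) ↔ ∃ h ∈ H, Ideal.Quotient.mk p h = c :=
  Ideal.mem_map_iff_of_surjective _ Ideal.Quotient.mk_surjective

theorem syz_mod {R : Type} [CommRing R] {p : Ideal R} [IsDomain (R ⧸ p)] [UniqueFactorizationMonoid (R ⧸ p)] {g h s t : R}
    (hr : IsRelPrime (Ideal.Quotient.mk p g) (Ideal.Quotient.mk p h)) (h0 : h ∉ p) (hm : s * g + t * h ∈ p) :
    ∃ s' ∈ p, ∃ t' ∈ p, s * g + t * h = s' * g + t' * h := by
  have e : Ideal.Quotient.mk p s * Ideal.Quotient.mk p g + Ideal.Quotient.mk p t * Ideal.Quotient.mk p h = 0 := by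
    rw [← map_mul, ← map_mul, ← map_add, Ideal.Quotient.eq_zero_iff_mem]; exact hm
  have h0' : Ideal.Quotient.mk p h ≠ 0 := by rwa [Ne, Ideal.Quotient.eq_zero_iff_mem]
  have hd : Ideal.Quotient.mk p h ∣ Ideal.Quotient.mk p s := by
    refine hr.symm.dvd_of_dvd_mul_right (z := Ideal.Quotient.mk p g) ⟨- Ideal.Quotient.mk p t, ?_⟩
    linear_combination e
  obtain ⟨c, hc⟩ := hd
  obtain ⟨c, rfl⟩ := Ideal.Quotient.mk_surjective c
  refine ⟨s - c * h, ?_, t + c * g, ?_, by ring⟩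
  · rw [← Ideal.Quotient.eq_zero_iff_mem, map_sub, map_mul, hc]; ring
  · rw [← Ideal.Quotient.eq_zero_iff_mem, map_add, map_mul]
    apply mul_left_cancel₀ h0'
    rw [mul_zero, ← e, hc]; ring

theorem colon_principal {C : Type} [CommRing C] [IsDomain C] [UniqueFactorizationMonoid C] (a b e : C) (he : e ≠ 0) :
    ∃ g, ∀ c, (e ∣ a * c ∧ e ∣ b * c) ↔ g ∣ c := by
  obtain ⟨d, a', b', rfl, rfl, hr⟩ := exists_gcd2 a b
  obtain ⟨h, e', d', rfl, rfl, hr'⟩ := exists_gcd2 e d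
  have h0 : h ≠ 0 := left_ne_zero_of_mul he
  refine ⟨e', fun c => ⟨?_, ?_⟩⟩
  · rintro ⟨h1, h2⟩
    have h3 : h * e' ∣ h * (d' * c) := by
      refine dvd_of_relprime hr ?_ ?_
      · convert h1 using 1; ring
      · convert h2 using 1; ring
    exact hr'.dvd_of_dvd_mul_left ((mul_dvd_mul_iff_left h0).1 h3)
  · rintro ⟨q, rfl⟩
    exact ⟨⟨d' * a' * q, by ring⟩, ⟨d' * b' * q, by ring⟩⟩

variable {k : Type} [Field k] {N m : ℕ}

theorem PB.pdB {V : Submodule k (Fin N → k)} {x y} (h : PB V x y) :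
    pdl (MvPolynomial (Fin N) k) (MvPolynomial (Fin N) k ⧸ _root_.ip V) 2 := pdl_quot h.pd

theorem mk_mem_map_ip {U V : Submodule k (Fin N → k)} {r : MvPolynomial (Fin N) k} :
    Ideal.Quotient.mk (ip U) r ∈ (ip V).map (Ideal.Quotient.mk (ip U)) ↔ r ∈ ip (V ⊔ U) := by
  rw [Ideal.mem_quotient_iff_mem_sup, ip_sup]

theorem map_ip_prime (U V : Submodule k (Fin N → k)) : ((ip V).map (Ideal.Quotient.mk (ip U))).IsPrime := by
  refine ⟨?_, ?_⟩
  · intro h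
    have h1 : Ideal.Quotient.mk (ip U) 1 ∈ (ip V).map (Ideal.Quotient.mk (ip U)) := by rw [h]; trivial
    rw [mk_mem_map_ip] at h1
    exact (ip_prime (V ⊔ U)).ne_top ((Ideal.eq_top_iff_one _).2 h1)
  · intro r s
    obtain ⟨r, rfl⟩ := Ideal.Quotient.mk_surjective r
    obtain ⟨s, rfl⟩ := Ideal.Quotient.mk_surjective s
    rw [← map_mul, mk_mem_map_ip, mk_mem_map_ip, mk_mem_map_ip]
    exact (ip_prime (V ⊔ U)).mem_or_mem

theorem map_ip_pair {U V : Submodule k (Fin N → k)} {x y} (h : PB V x y) : (ip V).map (Ideal.Quotient.mk (ip U)) =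
    Ideal.span {Ideal.Quotient.mk (ip U) (lin x), Ideal.Quotient.mk (ip U) (lin y)} := by
  rw [h.ip, Ideal.map_span, Set.image_pair]

theorem stepB_mk {H : Ideal (MvPolynomial (Fin N) k)} (V : Submodule k (Fin N → k)) 
    (hH : pdl (MvPolynomial (Fin N) k) H 3) (hc : pdl (MvPolynomial (Fin N) k) (H.map (Ideal.Quotient.mk (ip V))) 4) :
    pdl (MvPolynomial (Fin N) k) (H ⊓ ip V : Ideal _) 3 := by
  refine pdi_ker (mkOn (ip V) H) inf_le_left ?_ ?_ (mkOn_hk _ _) hH hc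
  · intro h; exact Ideal.mem_map_of_mem _ h.2
  · intro c hc
    obtain ⟨h, hh, rfl⟩ := mem_map_mk.1 hc
    exact ⟨⟨h, hh⟩, rfl⟩

theorem stepB_K {x y : Fin N → k} {K : Ideal (MvPolynomial (Fin N) k)} {a b : MvPolynomial (Fin N) k} (hK : KS x y K a b)
    {H : Ideal (MvPolynomial (Fin N) k)} (𝔠 : Ideal (MvPolynomial (Fin N) k ⧸ ip (Submodule.span k {x, y})))
    (h1 : ∀ h ∈ H, ∃ s t, h = s * lin x + t * lin y ∧ Ideal.Quotient.mk _ (s * b - t * a) ∈ 𝔠)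
    (h2 : ∀ c ∈ 𝔠, ∃ s t, s * lin x + t * lin y ∈ H ∧ Ideal.Quotient.mk _ (s * b - t * a) = c)
    (hH : pdl (MvPolynomial (Fin N) k) H 3) (hc : pdl (MvPolynomial (Fin N) k) 𝔠 4) :
    pdl (MvPolynomial (Fin N) k) (H ⊓ K : Ideal _) 3 := by
  obtain ⟨δ, hδ, hδK⟩ := hK.delta
  have hle : H ≤ ip (Submodule.span k {x, y}) := by
    intro h hh
    obtain ⟨s, t, rfl, -⟩ := h1 h hh
    rw [ip_pair]; exact Ideal.mem_span_pair.2 ⟨s, t, rfl⟩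
  refine pdi_ker (δ ∘ₗ Submodule.inclusion hle) inf_le_left ?_ ?_ ?_ hH hc
  · intro h
    obtain ⟨s, t, e, hm⟩ := h1 h.1 h.2
    rw [LinearMap.comp_apply, hδ s t _ e]; exact hm
  · intro c hc
    obtain ⟨s, t, hm, rfl⟩ := h2 c hc
    refine ⟨⟨_, hm⟩, ?_⟩
    rw [LinearMap.comp_apply, hδ s t _ rfl]
  · intro h
    rw [LinearMap.comp_apply, ← hδK]
    exact ⟨fun hh => hh.2, fun hh => ⟨h.2, hh⟩⟩

theorem pdH_two (g h : MvPolynomial (Fin N) k) {n : ℕ} : pdl (MvPolynomial (Fin N) k) (Ideal.span {g, h}) (n + 1) :=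
  pdl_mono (pdi_two (pdl_projective 0) _ _) (by omega)

theorem map_span_pair {R : Type} [CommRing R] (p : Ideal R) (g h : R) : (Ideal.span {g, h}).map (Ideal.Quotient.mk p) =
    Ideal.span {Ideal.Quotient.mk p g, Ideal.Quotient.mk p h} := by
  rw [Ideal.map_span, Set.image_pair]

theorem edge_inf {V₁ V₂ : Submodule k (Fin N → k)} {x y z : Fin N → k} (h₁ : PB V₁ x y) (h₂ : PB V₂ x z) (h12 : V₁ ≠ V₂) :
    ip V₁ ⊓ ip V₂ = Ideal.span {lin x, lin y * lin z} := by
  have n12 : ¬ ip V₁ ≤ ip V₂ := ip_not_le h₁.finrank h₂.finrank h12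
  have hx1 : lin x ∈ ip V₁ := lin_mem_ip' h₁.hx
  have hy1 : lin y ∈ ip V₁ := lin_mem_ip' h₁.hy
  have hx2 : lin x ∈ ip V₂ := lin_mem_ip' h₂.hx
  have hz2 : lin z ∈ ip V₂ := lin_mem_ip' h₂.hy
  have hy2 : lin y ∉ ip V₂ := by
    intro h; apply n12; rw [h₁.ip, Ideal.span_le]; rintro _ (rfl | rfl); exacts [hx2, h]
  apply le_antisymm
  · rintro v ⟨hv1, hv2⟩
    rw [h₁.ip] at hv1
    obtain ⟨s, t, rfl⟩ := Ideal.mem_span_pair.1 hv1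
    have : t * lin y ∈ ip V₂ := by
      have := (ip V₂).sub_mem hv2 (Ideal.mul_mem_left _ s hx2)
      simpa using this
    have := ((ip_prime V₂).mem_or_mem this).resolve_right hy2
    rw [h₂.ip] at this
    obtain ⟨s', t', rfl⟩ := Ideal.mem_span_pair.1 this
    exact Ideal.mem_span_pair.2 ⟨s + s' * lin y, t', by ring⟩
  · rw [Ideal.span_le]
    rintro _ (rfl | rfl)
    · exact ⟨hx1, hx2⟩
    · exact ⟨Ideal.mul_mem_right _ _ hy1, Ideal.mul_mem_left _ _ hz2⟩

theorem caseB_II {V₂ V₃ : Submodule k (Fin N → k)} {x y z z' w' : Fin N → k} {K₁ : Ideal (MvPolynomial (Fin N) k)} {a b : MvPolynomial (Fin N) k}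
    (h₁ : PB (Submodule.span k {x, y}) x y) (h₂ : PB V₂ x z) (h₃ : PB V₃ z' w')
    (h12 : Submodule.span k {x, y} ≠ V₂) (h13 : Submodule.span k {x, y} ≠ V₃) (h23 : V₂ ≠ V₃) (hK : KS x y K₁ a b)
    (hcase : (Submodule.span k {x, y} ⊓ V₃ = ⊥ ∧ V₂ ⊓ V₃ = ⊥) ∨ (x ∈ V₃ ∨ y ∈ V₃ ∨ z ∈ V₃)) :
    pdl (MvPolynomial (Fin N) k) (K₁ ⊓ ip V₂ ⊓ ip V₃ : Ideal _) 3 := by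
  have hQ' := edge_inf h₁ h₂ h12
  have P3 : (ip V₃).IsPrime := ip_prime _
  have pdQ : pdl (MvPolynomial (Fin N) k) (Ideal.span {lin x, lin y * lin z} ⊓ ip V₃ : Ideal _) 3 := by
    refine stepB_mk _ (pdH_two _ _) ?_
    rw [map_span_pair]
    exact pdl_mono (pdi_two h₃.pdB _ _) (by norm_num)
  have heq : K₁ ⊓ ip V₂ ⊓ ip V₃ = Ideal.span {lin x, lin y * lin z} ⊓ ip V₃ ⊓ K₁ := by
    rw [← hQ']
    apply le_antisymm
    · intro v hv
      exact ⟨⟨⟨hK.le hv.1.1, hv.1.2⟩, hv.2⟩, hv.1.1⟩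
    · intro v hv
      exact ⟨⟨hv.2, hv.1.1.2⟩, hv.1.2⟩
  rw [heq]
  have hyne : lin y ≠ 0 := by rw [Ne, lin_eq_zero]; exact h₁.swap.ne
  have hz1 : z ∉ Submodule.span k {x, y} := by
    intro h
    exact h12 (pb_of_two h₁.finrank h₁.hx h h₂.ne h₂.nmem |>.eq.trans h₂.eq.symm)
  have hz1' : lin z ∉ ip (Submodule.span k {x, y}) := by rwa [lin_mem_ip]
  rcases hcase with ⟨d13, d23⟩ | hcase
  · -- isolated
    have hr : IsRelPrime (Ideal.Quotient.mk (ip V₃) (lin x)) (Ideal.Quotient.mk (ip V₃) (lin y * lin z)) := by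
      rw [map_mul]
      exact (h₁.relp d13).mul_right (h₂.relp d23)
    have h0 : lin y * lin z ∉ ip V₃ := by
      intro h
      rcases P3.mem_or_mem h with h | h
      · rw [lin_mem_ip] at h; exact (h₁.swap.not_mem_of_disj d13).1 h
      · rw [lin_mem_ip] at h; exact (h₂.swap.not_mem_of_disj d23).1 h
    refine stepB_K hK (Ideal.span {Ideal.Quotient.mk _ b, Ideal.Quotient.mk _ (lin z * a)} * (ip V₃).map (Ideal.Quotient.mk _)) ?_ ?_ pdQ
      (pdi_pair_prime h₁.pdB (map_ip_prime _ _) ?_ _ _)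
    · rintro h ⟨hh1, hh2⟩
      obtain ⟨s, t, rfl⟩ := Ideal.mem_span_pair.1 hh1
      obtain ⟨s', hs', t', ht', e⟩ := syz_mod hr h0 hh2
      refine ⟨s', t' * lin z, by rw [e]; ring, ?_⟩
      rw [mem_pair_mul]
      refine ⟨_, Ideal.mem_map_of_mem _ hs', _, Ideal.mem_map_of_mem _ ((ip V₃).neg_mem ht'), ?_⟩
      rw [← map_mul, ← map_mul, ← map_add]; congr 1; ring
    · intro c hc
      obtain ⟨u, hu, v, hv, rfl⟩ := mem_pair_mul.1 hc
      obtain ⟨u, hu', rfl⟩ := mem_map_mk.1 hu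
      obtain ⟨v, hv', rfl⟩ := mem_map_mk.1 hv
      refine ⟨u, - v * lin z, ⟨Ideal.mem_span_pair.2 ⟨u, -v, by ring⟩, ?_⟩, ?_⟩
      · exact add_mem (Ideal.mul_mem_right _ _ hu') (Ideal.mul_mem_right _ _ (Ideal.mul_mem_right _ _ ((ip V₃).neg_mem hv')))
      · rw [← map_mul, ← map_mul, ← map_add]; congr 1; ring
    · rw [map_ip_pair h₃]; exact pdi_two h₁.pdB _ _
  · by_cases hx3 : x ∈ V₃
    · obtain ⟨v, hv⟩ := pb_of_one h₃.finrank hx3 h₁.ne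
      have nQ : lin y * lin z ∉ ip V₃ := by
        intro h
        rcases P3.mem_or_mem h with h | h
        · rw [lin_mem_ip] at h
          exact h13 (pb_of_two h₃.finrank hx3 h h₁.ne h₁.nmem |>.eq).symm
        · rw [lin_mem_ip] at h
          exact h23 (h₂.eq.trans (pb_of_two h₃.finrank hx3 h h₂.ne h₂.nmem |>.eq).symm)
      have hx3' : lin x ∈ ip V₃ := lin_mem_ip' hx3
      refine stepB_K hK (Ideal.span {Ideal.Quotient.mk _ b, Ideal.Quotient.mk _ (lin z * lin v * a)}) ?_ ?_ pdQ
        (pdl_mono (pdi_two h₁.pdB _ _) (by norm_num))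
      · rintro h ⟨hh1, hh2⟩
        obtain ⟨s, t, rfl⟩ := Ideal.mem_span_pair.1 hh1
        have : t * (lin y * lin z) ∈ ip V₃ := by
          have := (ip V₃).sub_mem hh2 (Ideal.mul_mem_left _ s hx3')
          simpa using this
        have := (P3.mem_or_mem this).resolve_right nQ
        rw [hv.ip] at this
        obtain ⟨t₁, t₂, rfl⟩ := Ideal.mem_span_pair.1 this
        refine ⟨s + t₁ * lin y * lin z, t₂ * lin v * lin z, by ring, ?_⟩
        rw [Ideal.mem_span_pair]
        refine ⟨Ideal.Quotient.mk _ s, Ideal.Quotient.mk _ (-t₂), ?_⟩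
        rw [← map_mul, ← map_mul, ← map_add, Ideal.Quotient.eq]
        have : s * b + -t₂ * (lin z * lin v * a) - ((s + t₁ * lin y * lin z) * b - t₂ * lin v * lin z * a) = - (t₁ * lin z * b) * lin y := by ring
        rw [this]
        exact Ideal.mul_mem_left _ _ (lin_mem_ip' h₁.hy)
      · intro c hc
        obtain ⟨s, t, rfl⟩ := Ideal.mem_span_pair.1 hc
        obtain ⟨s, rfl⟩ := Ideal.Quotient.mk_surjective s
        obtain ⟨t, rfl⟩ := Ideal.Quotient.mk_surjective t
        refine ⟨s, - t * lin v * lin z, ⟨Ideal.mem_span_pair.2 ⟨s, - t * lin v, by ring⟩, ?_⟩, ?_⟩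
        · refine add_mem (Ideal.mul_mem_left _ _ hx3') (Ideal.mul_mem_right _ _ (Ideal.mul_mem_right _ _ (Ideal.mul_mem_left _ _ (lin_mem_ip' hv.hy))))
        · rw [← map_mul, ← map_mul, ← map_add]; congr 1; ring
    · have hyz3 : lin y * lin z ∈ ip V₃ := by
        rcases hcase with h | h | h
        · exact absurd h hx3
        · exact Ideal.mul_mem_right _ _ (lin_mem_ip' h)
        · exact Ideal.mul_mem_left _ _ (lin_mem_ip' h)
      have hx3' : lin x ∉ ip V₃ := by rwa [lin_mem_ip]
      refine stepB_K hK (Ideal.span {Ideal.Quotient.mk _ (lin z * a)} ⊔ Ideal.span {Ideal.Quotient.mk _ b} * (ip V₃).map (Ideal.Quotient.mk _)) ?_ ?_ pdQ ?_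
      · rintro h ⟨hh1, hh2⟩
        obtain ⟨s, t, rfl⟩ := Ideal.mem_span_pair.1 hh1
        have : s * lin x ∈ ip V₃ := by
          have := (ip V₃).sub_mem hh2 (Ideal.mul_mem_left _ t hyz3)
          simpa using this
        have := (P3.mem_or_mem this).resolve_right hx3'
        refine ⟨s, t * lin z, by ring, ?_⟩
        refine Submodule.mem_sup.2 ⟨_, Ideal.mem_span_singleton'.2 ⟨Ideal.Quotient.mk _ (-t), rfl⟩, _, Ideal.mem_span_singleton_mul.2 ⟨_, Ideal.mem_map_of_mem _ this, rfl⟩, ?_⟩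
        rw [← map_mul, ← map_mul, ← map_add]; congr 1; ring
      · intro c hc
        obtain ⟨c₁, hc₁, c₂, hc₂, rfl⟩ := Submodule.mem_sup.1 hc
        obtain ⟨t, rfl⟩ := Ideal.mem_span_singleton'.1 hc₁
        obtain ⟨t, rfl⟩ := Ideal.Quotient.mk_surjective t
        obtain ⟨s, hs, rfl⟩ := Ideal.mem_span_singleton_mul.1 hc₂
        obtain ⟨s, hs', rfl⟩ := mem_map_mk.1 hs
        refine ⟨s, - t * lin z, ⟨Ideal.mem_span_pair.2 ⟨s, - t, by ring⟩, ?_⟩, ?_⟩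
        · refine add_mem (Ideal.mul_mem_right _ _ hs') ?_
          rw [mul_assoc, mul_comm (lin z)]
          exact Ideal.mul_mem_left _ _ hyz3
        · rw [← map_mul, ← map_mul, ← map_add]; congr 1; ring
      · have hpm := map_ip_prime (Submodule.span k {x, y}) V₃
        by_cases hy3 : y ∈ V₃
        · obtain ⟨u, hu⟩ := pb_of_one h₃.finrank hy3 h₁.swap.ne
          have : (ip V₃).map (Ideal.Quotient.mk (ip (Submodule.span k {x, y}))) = Ideal.span {Ideal.Quotient.mk _ (lin u)} := by
            rw [map_ip_pair hu, Ideal.Quotient.eq_zero_iff_mem.2 (lin_mem_ip' h₁.hy), Ideal.span_insert]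
            simp
          rw [this, Ideal.span_singleton_mul_span_singleton, ← Ideal.span_insert]
          exact pdl_mono (pdi_two h₁.pdB _ _) (by norm_num)
        · have hz3 : z ∈ V₃ := by tauto
          have hpd3 : pdl (MvPolynomial (Fin N) k) ((ip V₃).map (Ideal.Quotient.mk (ip (Submodule.span k {x, y})))) 3 := by
            rw [map_ip_pair h₃]; exact pdi_two h₁.pdB _ _
          have hzm : Ideal.Quotient.mk (ip (Submodule.span k {x, y})) (lin z) ∈ (ip V₃).map (Ideal.Quotient.mk (ip (Submodule.span k {x, y}))) :=
            Ideal.mem_map_of_mem _ (lin_mem_ip' hz3)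
          have hzp := prime_mk_lin hz1
          have hrel := hK.rel
          revert hzm hzp hrel
          rw [map_mul]
          generalize Ideal.Quotient.mk (ip (Submodule.span k {x, y})) (lin z) = Z
          generalize Ideal.Quotient.mk (ip (Submodule.span k {x, y})) a = A
          generalize Ideal.Quotient.mk (ip (Submodule.span k {x, y})) b = β
          generalize (ip V₃).map (Ideal.Quotient.mk (ip (Submodule.span k {x, y}))) = P at hpm hpd3
          intro hzm hzp hrel
          refine pdi_sup (pdl_mono (pdi_one h₁.pdB _) (by norm_num)) (pdl_mono (pdi_mul _ hpd3) (by norm_num)) ?_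
          by_cases hzb : Z ∣ β
          · obtain ⟨β, rfl⟩ := hzb
            have hrel' : IsRelPrime A β := hrel.of_mul_right_right
            have key : ∀ 𝔮 : Ideal (MvPolynomial (Fin N) k ⧸ ip (Submodule.span k {x, y})), (∀ q, q ∈ 𝔮 ↔ A * q ∈ P) →
                Ideal.span {Z * A} ⊓ Ideal.span {Z * β} * P = Ideal.span {Z * A * β} * 𝔮 := by
              intro 𝔮 h𝔮
              apply le_antisymm
              · rintro c ⟨hc1, hc2⟩
                obtain ⟨r, rfl⟩ := Ideal.mem_span_singleton.1 hc1
                obtain ⟨q, hq, e⟩ := Ideal.mem_span_singleton_mul.1 hc2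
                have e1 : β * q = A * r := mul_left_cancel₀ hzp.ne_zero (by linear_combination e)
                obtain ⟨q', rfl⟩ : A ∣ q := hrel'.dvd_of_dvd_mul_left ⟨r, e1⟩
                exact Ideal.mem_span_singleton_mul.2 ⟨q', (h𝔮 _).2 hq, by linear_combination e⟩
              · intro c hc
                obtain ⟨q, hq, rfl⟩ := Ideal.mem_span_singleton_mul.1 hc
                exact ⟨Ideal.mem_span_singleton.2 ⟨β * q, by ring⟩, Ideal.mem_span_singleton_mul.2 ⟨A * q, (h𝔮 _).1 hq, by ring⟩⟩
            by_cases hA : A ∈ P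
            · rw [key ⊤ (fun q => ⟨fun _ => P.mul_mem_right _ hA, fun _ => trivial⟩)]
              exact pdl_mono (pdi_mul _ (pdi_top h₁.pdB)) (by norm_num)
            · rw [key P (fun q => ⟨fun h => P.mul_mem_left _ h, fun h => (hpm.mem_or_mem h).resolve_left hA⟩)]
              exact pdi_mul _ hpd3
          · have : Ideal.span {Z * A} ⊓ Ideal.span {β} * P = Ideal.span {Z * A * β} := by
              apply le_antisymm
              · rintro c ⟨hc1, hc2⟩
                obtain ⟨r, rfl⟩ := Ideal.mem_span_singleton.1 hc1
                obtain ⟨q, hq, e⟩ := Ideal.mem_span_singleton_mul.1 hc2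
                have : Z ∣ q := (hzp.dvd_or_dvd ⟨A * r, by linear_combination e⟩ : Z ∣ β ∨ Z ∣ q).resolve_left hzb
                obtain ⟨q, rfl⟩ := this
                have e1 : β * q = A * r := mul_left_cancel₀ hzp.ne_zero (by linear_combination e)
                obtain ⟨q', rfl⟩ : A ∣ q := hrel.dvd_of_dvd_mul_left ⟨r, e1⟩
                exact Ideal.mem_span_singleton.2 ⟨q', by linear_combination -e⟩
              · rw [Ideal.span_singleton_le_iff_mem]
                exact ⟨Ideal.mem_span_singleton.2 ⟨β, by ring⟩, Ideal.mem_span_singleton_mul.2 ⟨Z * A, P.mul_mem_right _ hzm, by ring⟩⟩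
            rw [this]
            exact pdl_mono (pdi_one h₁.pdB _) (by norm_num)

theorem caseB_I_edge {V₂ V₃ : Submodule k (Fin N → k)} {x y l u v : Fin N → k} {K₁ : Ideal (MvPolynomial (Fin N) k)} {a b : MvPolynomial (Fin N) k}
    (h₁ : PB (Submodule.span k {x, y}) x y) (h₂ : PB V₂ l u) (h₃ : PB V₃ l v)
    (h12 : V₂ ⊓ Submodule.span k {x, y} = ⊥) (h13 : V₃ ⊓ Submodule.span k {x, y} = ⊥) (h23 : V₂ ≠ V₃) (hK : KS x y K₁ a b) :
    pdl (MvPolynomial (Fin N) k) (K₁ ⊓ ip V₂ ⊓ ip V₃ : Ideal _) 3 := by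
  have hJ := edge_inf h₂ h₃ h23
  set p₁ := ip (Submodule.span k {x, y}) with hp₁
  have P1 : p₁.IsPrime := ip_prime _
  have pdQ : pdl (MvPolynomial (Fin N) k) (Ideal.span {lin l, lin u * lin v} ⊓ p₁ : Ideal _) 3 := by
    refine stepB_mk _ (pdH_two _ _) ?_
    rw [map_span_pair]
    exact pdl_mono (pdi_two h₁.pdB _ _) (by norm_num)
  have heq : K₁ ⊓ ip V₂ ⊓ ip V₃ = Ideal.span {lin l, lin u * lin v} ⊓ p₁ ⊓ K₁ := by
    rw [← hJ]
    apply le_antisymm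
    · intro v hv
      exact ⟨⟨⟨hv.1.2, hv.2⟩, hK.le hv.1.1⟩, hv.1.1⟩
    · intro v hv
      exact ⟨⟨hv.2, hv.1.1.1⟩, hv.1.1.2⟩
  rw [heq]
  have hr : IsRelPrime (Ideal.Quotient.mk p₁ (lin l)) (Ideal.Quotient.mk p₁ (lin u * lin v)) := by
    rw [map_mul]
    exact (h₂.relp h12).mul_right (h₃.relp h13)
  have h0 : lin u * lin v ∉ p₁ := by
    intro h
    rcases P1.mem_or_mem h with h | h
    · rw [lin_mem_ip] at h; exact (h₂.swap.not_mem_of_disj h12).1 h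
    · rw [lin_mem_ip] at h; exact (h₃.swap.not_mem_of_disj h13).1 h
  have hx1 : lin x ∈ p₁ := lin_mem_ip' h₁.hx
  have hy1 : lin y ∈ p₁ := lin_mem_ip' h₁.hy
  refine stepB_K hK (Ideal.span {Ideal.Quotient.mk _ a, Ideal.Quotient.mk _ b} * (Ideal.span {Ideal.Quotient.mk _ (lin l), Ideal.Quotient.mk _ (lin u * lin v)})) ?_ ?_ pdQ ?_
  · rintro h ⟨hh1, hh2⟩
    obtain ⟨s, t, rfl⟩ := Ideal.mem_span_pair.1 hh1
    obtain ⟨s', hs', t', ht', e⟩ := syz_mod hr h0 hh2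
    rw [hp₁, ip_pair] at hs' ht'
    obtain ⟨s₁, s₂, rfl⟩ := Ideal.mem_span_pair.1 hs'
    obtain ⟨t₁, t₂, rfl⟩ := Ideal.mem_span_pair.1 ht'
    refine ⟨s₁ * lin l + t₁ * (lin u * lin v), s₂ * lin l + t₂ * (lin u * lin v), by rw [e]; ring, ?_⟩
    rw [mem_pair_mul]
    refine ⟨Ideal.Quotient.mk _ (- s₂) * Ideal.Quotient.mk _ (lin l) + Ideal.Quotient.mk _ (- t₂) * Ideal.Quotient.mk _ (lin u * lin v), Ideal.mem_span_pair.2 ⟨_, _, rfl⟩,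
      Ideal.Quotient.mk _ (s₁) * Ideal.Quotient.mk _ (lin l) + Ideal.Quotient.mk _ (t₁) * Ideal.Quotient.mk _ (lin u * lin v), Ideal.mem_span_pair.2 ⟨_, _, rfl⟩, ?_⟩
    simp only [← map_mul, ← map_add]
    congr 1; ring
  · intro c hc
    obtain ⟨c₁, hc₁, c₂, hc₂, rfl⟩ := mem_pair_mul.1 hc
    obtain ⟨s₂, t₂, rfl⟩ := Ideal.mem_span_pair.1 hc₁
    obtain ⟨s₁, t₁, rfl⟩ := Ideal.mem_span_pair.1 hc₂
    obtain ⟨s₁, rfl⟩ := Ideal.Quotient.mk_surjective s₁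
    obtain ⟨s₂, rfl⟩ := Ideal.Quotient.mk_surjective s₂
    obtain ⟨t₁, rfl⟩ := Ideal.Quotient.mk_surjective t₁
    obtain ⟨t₂, rfl⟩ := Ideal.Quotient.mk_surjective t₂
    refine ⟨s₁ * lin l + t₁ * (lin u * lin v), - s₂ * lin l - t₂ * (lin u * lin v), ⟨Ideal.mem_span_pair.2 ⟨s₁ * lin x - s₂ * lin y, t₁ * lin x - t₂ * lin y, by ring⟩, ?_⟩, ?_⟩
    · exact add_mem (Ideal.mul_mem_left _ _ hx1) (Ideal.mul_mem_left _ _ hy1)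
    · simp only [← map_mul, ← map_add]
      congr 1; ring
  · have hl1 := (h₂.not_mem_of_disj h12)
    have hl3 := (h₃.not_mem_of_disj h13)
    have he : Ideal.Quotient.mk (ip (Submodule.span k {x, y} ⊔ Submodule.span k {l})) (lin u * lin v) ≠ 0 := by
      rw [map_mul]
      exact mul_ne_zero (prime_mk_lin hl1.2).ne_zero (prime_mk_lin hl3.2).ne_zero
    obtain ⟨g, hg⟩ := colon_principal (Ideal.Quotient.mk (ip (Submodule.span k {x, y} ⊔ Submodule.span k {l})) a) (Ideal.Quotient.mk _ b) _ he
    obtain ⟨g, rfl⟩ := Ideal.Quotient.mk_surjective g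
    have key : ∀ (r e : MvPolynomial (Fin N) k), Ideal.Quotient.mk p₁ r ∈ Ideal.span {Ideal.Quotient.mk p₁ (lin l), Ideal.Quotient.mk p₁ e} ↔
        Ideal.Quotient.mk (ip (Submodule.span k {x, y} ⊔ Submodule.span k {l})) e ∣ Ideal.Quotient.mk _ r := by
      intro r e
      constructor
      · intro h
        obtain ⟨s, t, h⟩ := Ideal.mem_span_pair.1 h
        obtain ⟨s, rfl⟩ := Ideal.Quotient.mk_surjective s
        obtain ⟨t, rfl⟩ := Ideal.Quotient.mk_surjective t
        rw [← map_mul, ← map_mul, ← map_add, Ideal.Quotient.eq] at h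
        refine ⟨Ideal.Quotient.mk _ t, ?_⟩
        rw [← map_mul, eq_comm, Ideal.Quotient.eq, ip_sup]
        refine Submodule.mem_sup.2 ⟨_, h, _, Ideal.mul_mem_left _ (-s) (lin_mem_ip' (Submodule.mem_span_singleton_self l)), by ring⟩
      · rintro ⟨t, h⟩
        obtain ⟨t, rfl⟩ := Ideal.Quotient.mk_surjective t
        rw [← map_mul, Ideal.Quotient.eq, ip_sup] at h
        obtain ⟨c, hc, d, hd, h⟩ := Submodule.mem_sup.1 h
        rw [ip_single] at hd
        obtain ⟨s, rfl⟩ := Ideal.mem_span_singleton'.1 hd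
        refine Ideal.mem_span_pair.2 ⟨Ideal.Quotient.mk _ s, Ideal.Quotient.mk _ t, ?_⟩
        rw [← map_mul, ← map_mul, ← map_add, eq_comm, Ideal.Quotient.eq]
        convert hc using 1
        linear_combination -h
    refine pdi_pair (𝔠 := Ideal.span {Ideal.Quotient.mk p₁ (lin l), Ideal.Quotient.mk p₁ g}) hK.rel ?_ (pdl_mono (pdi_two h₁.pdB _ _) (by norm_num)) (pdi_two h₁.pdB _ _)
    intro c
    obtain ⟨r, rfl⟩ := Ideal.Quotient.mk_surjective c
    have k1 := key (a * r) (lin u * lin v)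
    have k2 := key (b * r) (lin u * lin v)
    rw [(Ideal.Quotient.mk p₁).map_mul, RingHom.map_mul _ a r] at k1
    rw [(Ideal.Quotient.mk p₁).map_mul, RingHom.map_mul _ b r] at k2
    rw [key, ← hg]
    exact and_congr k1.symm k2.symm
end

end

section
open MvPolynomial Filter CategoryTheory
noncomputable section

section quasi
variable {R : Type} [CommRing R] {B : Type} [CommRing B] [Algebra R B]
  [IsDomain B] [UniqueFactorizationMonoid B] {X Y : B}

theorem mem_P2 {c : B} : c ∈ Ideal.span {X, Y} * Ideal.span {X, Y} ↔ ∃ e f g, c = e * X ^ 2 + f * (X * Y) + g * Y ^ 2 := by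
  rw [mem_pair_mul]
  constructor
  · rintro ⟨u, hu, v, hv, rfl⟩
    obtain ⟨p, q, rfl⟩ := Ideal.mem_span_pair.1 hu
    obtain ⟨r, s, rfl⟩ := Ideal.mem_span_pair.1 hv
    exact ⟨p, q + r, s, by ring⟩
  · rintro ⟨e, f, g, rfl⟩
    exact ⟨e * X + f * Y, Ideal.mem_span_pair.2 ⟨e, f, rfl⟩, g * Y, Ideal.mem_span_pair.2 ⟨0, g, by ring⟩, by ring⟩

theorem mem_P3 {c : B} : c ∈ Ideal.span {X, Y} * (Ideal.span {X, Y} * Ideal.span {X, Y}) ↔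
    ∃ e ∈ Ideal.span {X, Y}, ∃ f ∈ Ideal.span {X, Y}, ∃ g ∈ Ideal.span {X, Y}, c = e * X ^ 2 + f * (X * Y) + g * Y ^ 2 := by
  rw [mem_pair_mul]
  constructor
  · rintro ⟨u, hu, v, hv, rfl⟩
    obtain ⟨e, f, g, rfl⟩ := mem_P2.1 hu
    obtain ⟨e', f', g', rfl⟩ := mem_P2.1 hv
    exact ⟨e * X + e' * Y, Ideal.mem_span_pair.2 ⟨e, e', rfl⟩, f * X + f' * Y, Ideal.mem_span_pair.2 ⟨f, f', rfl⟩,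
      g * X + g' * Y, Ideal.mem_span_pair.2 ⟨g, g', rfl⟩, by ring⟩
  · rintro ⟨e, he, f, hf, g, hg, rfl⟩
    obtain ⟨e, e', rfl⟩ := Ideal.mem_span_pair.1 he
    obtain ⟨f, f', rfl⟩ := Ideal.mem_span_pair.1 hf
    obtain ⟨g, g', rfl⟩ := Ideal.mem_span_pair.1 hg
    exact ⟨_, mem_P2.2 ⟨e, f, g, rfl⟩, _, mem_P2.2 ⟨e', f', g', rfl⟩, by ring⟩

theorem quasi_reg (hr : IsRelPrime X Y) (hX : X ≠ 0) {e f g : B}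
    (h : e * X ^ 2 + f * (X * Y) + g * Y ^ 2 ∈ Ideal.span {X, Y} * (Ideal.span {X, Y} * Ideal.span {X, Y})) :
    e ∈ Ideal.span {X, Y} ∧ f ∈ Ideal.span {X, Y} ∧ g ∈ Ideal.span {X, Y} := by
  obtain ⟨e', he, f', hf, g', hg, h⟩ := mem_P3.1 h
  have hX' : X ∈ Ideal.span {X, Y} := Ideal.subset_span (by simp)
  have hY' : Y ∈ Ideal.span {X, Y} := Ideal.subset_span (by simp)
  obtain ⟨u, hu⟩ : X ∣ g - g' := by
    have : X ∣ Y * (Y * (g - g')) := ⟨- (e - e') * X - (f - f') * Y, by linear_combination h⟩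
    exact hr.dvd_of_dvd_mul_left (hr.dvd_of_dvd_mul_left this)
  have h2 : (e - e') * X + (f - f' + u * Y) * Y = 0 := by
    apply mul_left_cancel₀ hX
    linear_combination h - Y ^ 2 * hu
  obtain ⟨v, hv⟩ : X ∣ f - f' + u * Y := by
    have : X ∣ Y * (f - f' + u * Y) := ⟨- (e - e'), by linear_combination h2⟩
    exact hr.dvd_of_dvd_mul_left this
  have h3 : (e - e') + v * Y = 0 := by
    apply mul_left_cancel₀ hX
    linear_combination h2 - Y * hv
  refine ⟨?_, ?_, ?_⟩
  · have : e = e' + (-v) * Y := by linear_combination h3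
    rw [this]; exact add_mem he (Ideal.mul_mem_left _ _ hY')
  · have : f = f' + (X * v - u * Y) := by linear_combination hv
    rw [this]; exact add_mem hf (sub_mem (Ideal.mul_mem_right _ _ hX') (Ideal.mul_mem_left _ _ hY'))
  · have : g = g' + X * u := by linear_combination hu
    rw [this]; exact add_mem hg (Ideal.mul_mem_right _ _ hX')

theorem quasi_reg1 (hr : IsRelPrime X Y) (hX : X ≠ 0) {e f : B}
    (h : e * X + f * Y ∈ Ideal.span {X, Y} * Ideal.span {X, Y}) :
    e ∈ Ideal.span {X, Y} ∧ f ∈ Ideal.span {X, Y} := by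
  obtain ⟨p, q, r, h⟩ := mem_P2.1 h
  obtain ⟨u, hu⟩ : X ∣ f - r * Y := by
    have : X ∣ Y * (f - r * Y) := ⟨p * X + q * Y - e, by linear_combination h⟩
    exact hr.dvd_of_dvd_mul_left this
  have h3 : e = p * X + (q - u) * Y := by
    apply mul_left_cancel₀ hX
    linear_combination h - Y * hu
  exact ⟨Ideal.mem_span_pair.2 ⟨_, _, h3.symm⟩, Ideal.mem_span_pair.2 ⟨u, r, by linear_combination -hu⟩⟩

theorem pd_P2 (hB : pdl R B 2) (hr : IsRelPrime X Y) : pdl R (Ideal.span {X, Y} * Ideal.span {X, Y} : Ideal B) 3 := by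
  refine pdi_pair (𝔠 := ⊤) hr ?_ (pdi_two hB _ _) (pdi_top hB)
  intro c
  exact ⟨fun _ => ⟨Ideal.mul_mem_right _ _ (Ideal.subset_span (by simp)), Ideal.mul_mem_right _ _ (Ideal.subset_span (by simp))⟩, fun _ => trivial⟩

theorem pd_P3 (hB : pdl R B 2) (hr : IsRelPrime X Y) (hX : X ≠ 0) :
    pdl R (Ideal.span {X, Y} * (Ideal.span {X, Y} * Ideal.span {X, Y}) : Ideal B) 4 := by
  refine pdi_pair (𝔠 := Ideal.span {X, Y}) hr ?_ (pdl_mono (pd_P2 hB hr) (by norm_num)) (pdi_two hB _ _)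
  intro c
  have hX' : X ∈ Ideal.span {X, Y} := Ideal.subset_span (by simp)
  have hY' : Y ∈ Ideal.span {X, Y} := Ideal.subset_span (by simp)
  constructor
  · intro h
    exact ⟨Ideal.mul_mem_mul hX' h, Ideal.mul_mem_mul hY' h⟩
  · rintro ⟨h, -⟩
    have : c * X + 0 * Y ∈ Ideal.span {X, Y} * Ideal.span {X, Y} := by
      convert h using 1; ring
    exact (quasi_reg1 hr hX this).1

theorem pd_P2Z (hB : pdl R B 2) (hr : IsRelPrime X Y) (hX : X ≠ 0) (hP : (Ideal.span {X, Y}).IsPrime) {Z W : B} (hZ : IsRelPrime Z W)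
    (hm : Z ∉ Ideal.span {X, Y} ∨ W ∉ Ideal.span {X, Y}) :
    pdl R (Ideal.span {Z, W} * (Ideal.span {X, Y} * Ideal.span {X, Y}) : Ideal B) 4 := by
  have key : ∀ z ∉ Ideal.span {X, Y}, ∀ c, z * c ∈ Ideal.span {X, Y} * Ideal.span {X, Y} → c ∈ Ideal.span {X, Y} * Ideal.span {X, Y} := by
    intro z hz c hc
    have h1 : c ∈ Ideal.span {X, Y} := (hP.mem_or_mem (Ideal.mul_le_left hc)).resolve_left hz
    obtain ⟨e, f, rfl⟩ := Ideal.mem_span_pair.1 h1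
    have : (z * e) * X + (z * f) * Y ∈ Ideal.span {X, Y} * Ideal.span {X, Y} := by
      convert hc using 1; ring
    obtain ⟨h2, h3⟩ := quasi_reg1 hr hX this
    have h2 := (hP.mem_or_mem h2).resolve_left hz
    have h3 := (hP.mem_or_mem h3).resolve_left hz
    exact add_mem (Ideal.mul_mem_mul h2 (Ideal.subset_span (by simp))) (Ideal.mul_mem_mul h3 (Ideal.subset_span (by simp)))
  refine pdi_pair (𝔠 := Ideal.span {X, Y} * Ideal.span {X, Y}) hZ ?_ (pdl_mono (pd_P2 hB hr) (by norm_num)) (pd_P2 hB hr)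
  intro c
  constructor
  · intro h; exact ⟨Ideal.mul_mem_left _ _ h, Ideal.mul_mem_left _ _ h⟩
  · rintro ⟨h1, h2⟩
    rcases hm with h | h
    exacts [key _ h _ h1, key _ h _ h2]

theorem pd_P3F (hB : pdl R B 2) (hr : IsRelPrime X Y) (hX : X ≠ 0) {F : B} (hF : F ∈ Ideal.span {X, Y} * Ideal.span {X, Y})
    (hc : ∀ c, c * F ∈ Ideal.span {X, Y} * (Ideal.span {X, Y} * Ideal.span {X, Y}) → c ∈ Ideal.span {X, Y}) :
    pdl R (Ideal.span {X, Y} * (Ideal.span {X, Y} * Ideal.span {X, Y}) ⊔ Ideal.span {F} : Ideal B) 4 := by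
  refine pdi_sup (pd_P3 hB hr hX) (pdl_mono (pdi_one hB _) (by norm_num)) ?_
  have : Ideal.span {X, Y} * (Ideal.span {X, Y} * Ideal.span {X, Y}) ⊓ Ideal.span {F} = Ideal.span {F} * Ideal.span {X, Y} := by
    apply le_antisymm
    · rintro c ⟨h1, h2⟩
      obtain ⟨c, rfl⟩ := Ideal.mem_span_singleton'.1 h2
      exact Ideal.mem_span_singleton_mul.2 ⟨c, hc c h1, mul_comm _ _⟩
    · refine le_inf ?_ Ideal.mul_le_left
      rw [mul_comm]
      exact Ideal.mul_mono_right ((Ideal.span_singleton_le_iff_mem _).2 hF)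
  rw [this]
  exact pdi_mul _ (pdi_two hB _ _)
end quasi
end

end

section
open MvPolynomial Filter CategoryTheory
noncomputable section
theorem comp_mul {k : Type} [Field k] {N : ℕ} {r g : MvPolynomial (Fin N) k} {e : ℕ} (hg : g.IsHomogeneous e) (n : ℕ) :
    homogeneousComponent (n + e) (r * g) = homogeneousComponent n r * g := by
  conv_lhs => rw [← sum_homogeneousComponent r, Finset.sum_mul, map_sum]
  have : ∀ i, homogeneousComponent (n + e) (homogeneousComponent i r * g) = if i = n then homogeneousComponent n r * g else 0 := by
    intro i
    rw [homogeneousComponent_of_mem ((homogeneousComponent_isHomogeneous i r).mul hg)]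
    by_cases h : i = n
    · subst h; simp
    · rw [if_neg h, if_neg (by omega)]
  simp_rw [this]
  rw [Finset.sum_ite_eq']
  split_ifs with h
  · rfl
  · rw [homogeneousComponent_eq_zero, zero_mul]
    simpa using h

theorem hom_comb {k : Type} [Field k] {N : ℕ} {ι : Type} [Fintype ι] {f : MvPolynomial (Fin N) k} {d : ℕ} (hf : f.IsHomogeneous d)
    {g r : ι → MvPolynomial (Fin N) k} (hg : ∀ i, (g i).IsHomogeneous d) (h : f = ∑ i, r i * g i) :
    f = ∑ i, C (coeff 0 (r i)) * g i := by
  have h1 : homogeneousComponent d f = f := by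
    rw [homogeneousComponent_of_mem hf, if_pos rfl]
  rw [← h1, h, map_sum]
  refine Finset.sum_congr rfl fun i _ => ?_
  have := comp_mul (r := r i) (hg i) 0
  rw [zero_add] at this
  rw [this, homogeneousComponent_zero]

def hh {k : Type} [Field k] {N : ℕ} : MvPolynomial (Fin N) k →ₐ[k] Polynomial (MvPolynomial (Fin N) k) :=
  aeval (fun i => Polynomial.C (X i) * Polynomial.X)

theorem hh_homog {k : Type} [Field k] {N : ℕ} {p : MvPolynomial (Fin N) k} {d : ℕ} (hp : p.IsHomogeneous d) :
    hh p = Polynomial.C p * Polynomial.X ^ d := by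
  have : hh p = ∑ s ∈ p.support, Polynomial.C (monomial s (coeff s p)) * Polynomial.X ^ d := by
    conv_lhs => rw [hh, aeval_def, eval₂_eq]
    refine Finset.sum_congr rfl fun s hs => ?_
    have hd := hp (mem_support_iff.1 hs)
    simp_rw [mul_pow]
    rw [Finset.prod_mul_distrib, Finset.prod_pow_eq_pow_sum, ← mul_assoc]
    congr 1
    · simp_rw [← map_pow]
      rw [← map_prod, monomial_eq, map_mul]
      rfl
    · rw [← hd, Finsupp.weight_apply, Finsupp.sum]; simp
  rw [this]
  conv_rhs => rw [← support_sum_monomial_coeff p, map_sum, Finset.sum_mul]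

theorem hh_coeff {k : Type} [Field k] {N : ℕ} (p : MvPolynomial (Fin N) k) (i : ℕ) :
    (hh p).coeff i = homogeneousComponent i p := by
  conv_lhs => rw [← sum_homogeneousComponent p, map_sum, Polynomial.finset_sum_coeff]
  have : ∀ j, (hh (homogeneousComponent j p)).coeff i = if j = i then homogeneousComponent i p else 0 := by
    intro j
    rw [hh_homog (homogeneousComponent_isHomogeneous j p), Polynomial.coeff_C_mul, Polynomial.coeff_X_pow]
    by_cases h : j = i
    · subst h; simp
    · rw [if_neg h, if_neg (Ne.symm h), mul_zero]
  simp_rw [this]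
  rw [Finset.sum_ite_eq']
  split_ifs with h
  · rfl
  · rw [homogeneousComponent_eq_zero]
    simpa using h

theorem hh_inj {k : Type} [Field k] {N : ℕ} {p : MvPolynomial (Fin N) k} (h : hh p = 0) : p = 0 := by
  rw [← sum_homogeneousComponent p]
  refine Finset.sum_eq_zero fun i _ => ?_
  rw [← hh_coeff, h, Polynomial.coeff_zero]

theorem homog_of_hh {k : Type} [Field k] {N : ℕ} {p : MvPolynomial (Fin N) k} (h : (hh p).natTrailingDegree = (hh p).natDegree) :
    p.IsHomogeneous (hh p).natDegree := by
  have : p = homogeneousComponent (hh p).natDegree p := by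
    conv_lhs => rw [← sum_homogeneousComponent p]
    have : ∀ j, homogeneousComponent j p = if j = (hh p).natDegree then homogeneousComponent (hh p).natDegree p else 0 := by
      intro j
      split_ifs with hj
      · rw [hj]
      · rw [← hh_coeff]
        rcases lt_or_gt_of_ne hj with h1 | h1
        · exact Polynomial.coeff_eq_zero_of_lt_natTrailingDegree (by omega)
        · exact Polynomial.coeff_eq_zero_of_natDegree_lt h1
    rw [Finset.sum_congr rfl (fun j _ => this j), Finset.sum_ite_eq']
    split_ifs with h
    · rfl
    · rw [homogeneousComponent_eq_zero]
      simpa using h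
  rw [this]
  convert homogeneousComponent_isHomogeneous _ p using 2
  rw [← this]

theorem hom_factor {k : Type} [Field k] {N n : ℕ} {p q : MvPolynomial (Fin N) k} (h : (p * q).IsHomogeneous n) (h0 : p * q ≠ 0) :
    ∃ d e, d + e = n ∧ p.IsHomogeneous d ∧ q.IsHomogeneous e := by
  have hp : hh p ≠ 0 := fun hh => h0 (by rw [hh_inj hh, zero_mul])
  have hq : hh q ≠ 0 := fun hh => h0 (by rw [hh_inj hh, mul_zero])
  have e1 : hh p * hh q = Polynomial.C (p * q) * Polynomial.X ^ n := by rw [← map_mul, hh_homog h]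
  have e2 := Polynomial.natDegree_mul hp hq
  have e3 := Polynomial.natTrailingDegree_mul hp hq
  rw [e1, Polynomial.natDegree_C_mul_X_pow _ _ h0] at e2
  rw [e1, Polynomial.C_mul_X_pow_eq_monomial, Polynomial.natTrailingDegree_monomial h0] at e3
  have e4 := (hh p).natTrailingDegree_le_natDegree
  have e5 := (hh q).natTrailingDegree_le_natDegree
  exact ⟨_, _, e2.symm, homog_of_hh (by omega), homog_of_hh (by omega)⟩
end

end

section
open MvPolynomial Filter CategoryTheory
noncomputable section

theorem exists_ret {k V : Type} [Field k] [AddCommGroup V] [Module k V] {W U : Submodule k V} (h : W ⊓ U = ⊥) :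
    ∃ τ : V →ₗ[k] V, (∀ v ∈ W, τ v = v) ∧ ∀ u ∈ U, τ u = 0 := by
  obtain ⟨g, hg⟩ := LinearMap.exists_leftInverse_of_injective (U.mkQ ∘ₗ W.subtype) (by
    rw [LinearMap.ker_eq_bot']
    intro v hv
    have hv' : (v : V) ∈ W ⊓ U := ⟨v.2, by simpa using hv⟩
    rw [h] at hv'
    exact Subtype.ext (by simpa using hv'))
  refine ⟨W.subtype ∘ₗ g ∘ₗ U.mkQ, fun v hv => ?_, fun u hu => ?_⟩
  · have := LinearMap.congr_fun hg ⟨v, hv⟩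
    simpa using congrArg Subtype.val this
  · have : U.mkQ u = 0 := by simpa using hu
    simp [LinearMap.comp_apply, this]

variable {k : Type} [Field k] {N m : ℕ}

/-- combination with coefficients in a skew prime. -/
theorem skew_split {V₁ V₂ : Submodule k (Fin N → k)} {x y : Fin N → k} (h₁ : PB V₁ x y) (d : V₂ ⊓ V₁ = ⊥)
    {s t : MvPolynomial (Fin N) k} (h : s * lin x + t * lin y ∈ ip V₂) :
    ∃ c, s - c * lin y ∈ ip V₂ ∧ t + c * lin x ∈ ip V₂ := by
  have hr := h₁.relp (by rw [inf_comm]; exact d : V₁ ⊓ V₂ = ⊥)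
  have hy : lin y ∉ ip V₂ := by
    rw [lin_mem_ip]; exact (h₁.swap.not_mem_of_disj (by rw [inf_comm]; exact d)).1
  have hx : lin x ∉ ip V₂ := by
    rw [lin_mem_ip]; exact (h₁.not_mem_of_disj (by rw [inf_comm]; exact d)).1
  obtain ⟨s', hs', t', ht', e⟩ := syz_mod hr hy h
  -- difference divisible by lin y
  have hd : lin y ∣ s - s' := by
    have hp : Prime (lin y) := prime_lin h₁.swap.ne
    have : lin y ∣ (s - s') * lin x := ⟨t' - t, by linear_combination e⟩
    refine (hp.dvd_or_dvd this).resolve_right ?_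
    rw [lin_dvd, lin_mem_ip]; exact h₁.swap.nmem
  obtain ⟨c, hc⟩ := hd
  have hy0 : lin y ≠ 0 := by rw [Ne, lin_eq_zero]; exact h₁.swap.ne
  refine ⟨c, ?_, ?_⟩
  · have : s - c * lin y = s' := by linear_combination hc
    rwa [this]
  · have : t + c * lin x = t' := mul_right_cancel₀ hy0 (by linear_combination e - lin x * hc)
    rwa [this]

theorem skew_inf {V₁ V₂ : Submodule k (Fin N → k)} {x y : Fin N → k} (h₁ : PB V₁ x y) (d : V₂ ⊓ V₁ = ⊥) :
    ip V₁ ⊓ ip V₂ = ip V₁ * ip V₂ := by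
  apply le_antisymm
  · rintro r ⟨hr1, hr2⟩
    rw [h₁.ip] at hr1 ⊢
    obtain ⟨s, t, rfl⟩ := Ideal.mem_span_pair.1 hr1
    obtain ⟨c, h1, h2⟩ := skew_split h₁ d hr2
    exact mem_pair_mul.2 ⟨_, h1, _, h2, by ring⟩
  · exact Ideal.mul_le_inf

theorem skew_inf2 {V₁ V₂ : Submodule k (Fin N → k)} {x y : Fin N → k} (h₁ : PB V₁ x y) (d : V₂ ⊓ V₁ = ⊥) :
    ip V₁ * ip V₁ ⊓ ip V₂ = ip V₁ * ip V₁ * ip V₂ := by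
  apply le_antisymm
  · rintro r ⟨hr1, hr2⟩
    have e : ip V₁ * ip V₁ = Ideal.span {lin x, lin y} * ip V₁ := by rw [← h₁.ip]
    rw [e] at hr1
    obtain ⟨s, hs, t, ht, rfl⟩ := mem_pair_mul.1 hr1
    obtain ⟨c, h1, h2⟩ := skew_split h₁ d (s := s) (t := t) (by rw [mul_comm s, mul_comm t]; exact hr2)
    have hs' : s - c * lin y ∈ ip V₁ * ip V₂ := by
      rw [← skew_inf h₁ d]
      exact ⟨sub_mem hs (Ideal.mul_mem_left _ _ (lin_mem_ip' h₁.hy)), h1⟩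
    have ht' : t + c * lin x ∈ ip V₁ * ip V₂ := by
      rw [← skew_inf h₁ d]
      exact ⟨add_mem ht (Ideal.mul_mem_left _ _ (lin_mem_ip' h₁.hx)), h2⟩
    rw [mul_assoc]
    have : lin x * s + lin y * t = lin x * (s - c * lin y) + lin y * (t + c * lin x) := by ring
    rw [this]
    exact add_mem (Ideal.mul_mem_mul (lin_mem_ip' h₁.hx) hs') (Ideal.mul_mem_mul (lin_mem_ip' h₁.hy) ht')
  · exact Ideal.mul_le_inf

theorem skew_sup_finrank {V₁ V₂ : Submodule k (Fin N → k)} (h1 : Module.finrank k V₁ = 2) (h2 : Module.finrank k V₂ = 2) (d : V₁ ⊓ V₂ = ⊥) :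
    Module.finrank k (V₁ ⊔ V₂ : Submodule k (Fin N → k)) = 4 := by
  have := Submodule.finrank_sup_add_finrank_inf_eq V₁ V₂
  rw [d, finrank_bot] at this
  omega

theorem pd_KH {V₂ : Submodule k (Fin N → k)} {x y z w : Fin N → k} {K₁ : Ideal (MvPolynomial (Fin N) k)} {a b : MvPolynomial (Fin N) k}
    (h₁ : PB (Submodule.span k {x, y}) x y) (h₂ : PB V₂ z w) (h12 : V₂ ⊓ Submodule.span k {x, y} = ⊥) (hK : KS x y K₁ a b) :
    pdl (MvPolynomial (Fin N) k) (K₁ ⊓ ip V₂ : Ideal _) 3 := by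
  have pdQ : pdl (MvPolynomial (Fin N) k) (Ideal.span {lin x, lin y} ⊓ ip V₂ : Ideal _) 3 := by
    refine stepB_mk _ (pdH_two _ _) ?_
    rw [map_span_pair]
    exact pdl_mono (pdi_two h₂.pdB _ _) (by norm_num)
  have heq : K₁ ⊓ ip V₂ = Ideal.span {lin x, lin y} ⊓ ip V₂ ⊓ K₁ := by
    rw [← h₁.ip]
    apply le_antisymm
    · intro v hv; exact ⟨⟨hK.le hv.1, hv.2⟩, hv.1⟩
    · intro v hv; exact ⟨hv.2, hv.1.2⟩
  rw [heq]
  refine stepB_K hK (Ideal.span {Ideal.Quotient.mk _ b, Ideal.Quotient.mk _ a} * (ip V₂).map (Ideal.Quotient.mk _)) ?_ ?_ pdQ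
      (pdi_pair_prime h₁.pdB (map_ip_prime _ _) ?_ _ _)
  · rintro h ⟨hh1, hh2⟩
    obtain ⟨s, t, rfl⟩ := Ideal.mem_span_pair.1 hh1
    obtain ⟨c, hs, ht⟩ := skew_split h₁ h12 hh2
    refine ⟨s - c * lin y, t + c * lin x, by ring, ?_⟩
    · rw [mem_pair_mul]
      refine ⟨_, Ideal.mem_map_of_mem _ hs, _, Ideal.mem_map_of_mem _ ((ip V₂).neg_mem ht), ?_⟩
      rw [← map_mul, ← map_mul, ← map_add]; congr 1; ring
  · intro c hc
    obtain ⟨u, hu, v, hv, rfl⟩ := mem_pair_mul.1 hc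
    obtain ⟨u, hu', rfl⟩ := mem_map_mk.1 hu
    obtain ⟨v, hv', rfl⟩ := mem_map_mk.1 hv
    refine ⟨u, - v, ⟨Ideal.mem_span_pair.2 ⟨u, -v, by ring⟩, ?_⟩, ?_⟩
    · exact add_mem (Ideal.mul_mem_right _ _ hu') (Ideal.mul_mem_right _ _ ((ip V₂).neg_mem hv'))
    · rw [← map_mul, ← map_mul, ← map_add]; congr 1; ring
  · rw [map_ip_pair h₂]; exact pdi_two h₁.pdB _ _

/-- binary quadratic forms in `x, y`. -/
def qf (x y : Fin N → k) (e : Fin 3 → k) : MvPolynomial (Fin N) k :=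
  C (e 0) * lin x ^ 2 + C (e 1) * (lin x * lin y) + C (e 2) * lin y ^ 2

theorem qf_homog (x y : Fin N → k) (e : Fin 3 → k) : (qf x y e).IsHomogeneous 2 := by
  unfold qf
  have hC : ∀ c : k, (C c : MvPolynomial (Fin N) k).IsHomogeneous 0 := fun c => isHomogeneous_C _ c
  refine ((?_ : IsHomogeneous _ 2).add ?_).add ?_
  · simpa using (hC (e 0)).mul ((lin_homog x).pow 2)
  · simpa using (hC (e 1)).mul ((lin_homog x).mul (lin_homog y))
  · simpa using (hC (e 2)).mul ((lin_homog y).pow 2)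

theorem sub_qf {x y : Fin N → k} {e : Fin 3 → k} {ψ : (Fin N → k) →ₗ[k] (Fin N → k)} (hx : ψ x = x) (hy : ψ y = y) :
    sub ψ (qf x y e) = qf x y e := by
  unfold qf
  have hC : ∀ c : k, sub ψ (C c) = C c := fun c => (sub ψ).commutes c
  simp only [map_add, map_mul, map_pow, sub_lin, hx, hy, hC]

theorem qf_zero_of_mem {x y : Fin N → k} {e : Fin 3 → k} {U : Submodule k (Fin N → k)} (d : Submodule.span k {x, y} ⊓ U = ⊥)
    (h : qf x y e ∈ ip U) : qf x y e = 0 := by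
  obtain ⟨τ, h1, h2⟩ := exists_ret d
  have hx : τ x = x := h1 x (Submodule.subset_span (by simp))
  have hy : τ y = y := h1 y (Submodule.subset_span (by simp))
  have := sub_ip τ (W := ⊥) (fun v hv => by rw [h2 v hv]; exact Submodule.zero_mem _) h
  rw [sub_qf hx hy, ip_bot] at this
  simpa using this

theorem q_decomp {V₁ V₂ : Submodule k (Fin N → k)} {x y z w : Fin N → k} (h₁ : PB V₁ x y) (h₂ : PB V₂ z w) (d : V₂ ⊓ V₁ = ⊥)
    {q : MvPolynomial (Fin N) k} (hq : q.IsHomogeneous 3) (hq1 : q ∈ ip V₁ * ip V₁) (hq2 : q ∈ ip V₂) :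
    ∃ e e', q = qf x y e * lin z + qf x y e' * lin w := by
  have h : q ∈ ip V₂ * (ip V₁ * ip V₁) := by
    rw [mul_comm, ← skew_inf2 h₁ d]; exact ⟨hq1, hq2⟩
  rw [h₂.ip, h₁.ip] at h
  obtain ⟨u, hu, v, hv, e⟩ := mem_pair_mul.1 h
  obtain ⟨u1, u2, u3, rfl⟩ := mem_P2.1 hu
  obtain ⟨v1, v2, v3, rfl⟩ := mem_P2.1 hv
  have hl := lin_homog (k := k) (N := N)
  have := hom_comb hq (ι := Fin 6) (g := ![lin x ^ 2 * lin z, lin x * lin y * lin z, lin y ^ 2 * lin z, lin x ^ 2 * lin w, lin x * lin y * lin w, lin y ^ 2 * lin w])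
    (r := ![u1, u2, u3, v1, v2, v3]) (by
      intro i
      fin_cases i
      · exact ((hl x).pow 2).mul (hl z)
      · exact ((hl x).mul (hl y)).mul (hl z)
      · exact ((hl y).pow 2).mul (hl z)
      · exact ((hl x).pow 2).mul (hl w)
      · exact ((hl x).mul (hl y)).mul (hl w)
      · exact ((hl y).pow 2).mul (hl w)) (by
      simp [Fin.sum_univ_six, e]; ring)
  refine ⟨![coeff 0 u1, coeff 0 u2, coeff 0 u3], ![coeff 0 v1, coeff 0 v2, coeff 0 v3], ?_⟩
  rw [this]
  simp [Fin.sum_univ_six, qf]; ring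

theorem cubic_decomp {V₁ : Submodule k (Fin N → k)} {x y : Fin N → k} (h₁ : PB V₁ x y) {f : MvPolynomial (Fin N) k} (hf : f.IsHomogeneous 3)
    (hm : f ∈ ip V₁) : ∃ s t, s.IsHomogeneous 2 ∧ t.IsHomogeneous 2 ∧ f = s * lin x + t * lin y := by
  rw [h₁.ip] at hm
  obtain ⟨s, t, e⟩ := Ideal.mem_span_pair.1 hm
  refine ⟨homogeneousComponent 2 s, homogeneousComponent 2 t, homogeneousComponent_isHomogeneous _ _, homogeneousComponent_isHomogeneous _ _, ?_⟩
  have h1 : homogeneousComponent 3 f = f := by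
    rw [homogeneousComponent_of_mem hf, if_pos rfl]
  rw [← comp_mul (lin_homog x) 2, ← comp_mul (lin_homog y) 2, ← map_add, e, h1]

theorem det_mem {V₂ V₃ : Submodule k (Fin N → k)} {z w : Fin N → k} (h₂ : PB V₂ z w) (d : V₂ ⊓ V₃ = ⊥)
    {f₁ f₂ M11 M12 M21 M22 : MvPolynomial (Fin N) k} (e1 : f₁ = M11 * lin z + M12 * lin w) (e2 : f₂ = M21 * lin z + M22 * lin w)
    (h1 : f₁ ∈ ip V₃) (h2 : f₂ ∈ ip V₃) : M11 * M22 - M12 * M21 ∈ ip V₃ := by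
  have hz : lin z ∉ ip V₃ := by rw [lin_mem_ip]; exact (h₂.not_mem_of_disj d).1
  have : (M11 * M22 - M12 * M21) * lin z ∈ ip V₃ := by
    have : (M11 * M22 - M12 * M21) * lin z = M22 * f₁ - M12 * f₂ := by rw [e1, e2]; ring
    rw [this]
    exact sub_mem (Ideal.mul_mem_left _ _ h1) (Ideal.mul_mem_left _ _ h2)
  exact ((ip_prime V₃).mem_or_mem this).resolve_right hz

theorem eq_zero_of_dvd_deg {f g : MvPolynomial (Fin N) k} (hf : f.IsHomogeneous 3) (h0 : f ≠ 0) (hg : g.IsHomogeneous 2) (h : f ∣ g) : g = 0 := by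
  by_contra hg0
  obtain ⟨c, rfl⟩ := h
  obtain ⟨d, e, hde, h1, h2⟩ := hom_factor hg hg0
  have := hf.inj_right h1 h0
  omega

theorem det_ne {z w : Fin N → k} {f₁ f₂ M11 M12 M21 M22 : MvPolynomial (Fin N) k} (hf₁ : f₁.IsHomogeneous 3)
    (h0 : f₁ ≠ 0) (hrel : IsRelPrime f₁ f₂)
    (e1 : f₁ = M11 * lin z + M12 * lin w) (e2 : f₂ = M21 * lin z + M22 * lin w)
    (h11 : M11.IsHomogeneous 2) (h12 : M12.IsHomogeneous 2) : M11 * M22 - M12 * M21 ≠ 0 := by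
  intro hD
  have a1 : M11 = 0 := eq_zero_of_dvd_deg hf₁ h0 h11 (hrel.dvd_of_dvd_mul_right (y := M11) (z := f₂) ⟨M21, by
    rw [e1, e2]; linear_combination lin w * hD⟩)
  have a2 : M12 = 0 := eq_zero_of_dvd_deg hf₁ h0 h12 (hrel.dvd_of_dvd_mul_right (y := M12) (z := f₂) ⟨M22, by
    rw [e1, e2]; linear_combination - lin z * hD⟩)
  exact h0 (by rw [e1, a1, a2]; ring)
end

end

section
open MvPolynomial Filter CategoryTheory
noncomputable section

theorem rel_factor {S : Type} [CommRing S] [IsDomain S] [UniqueFactorizationMonoid S] {α β s t : S} (h : IsRelPrime α β)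
    (e : s * β = t * α) : ∃ c, s = c * α ∧ t = c * β := by
  by_cases hα : α = 0
  · subst hα
    have hu : IsUnit β := h (dvd_zero _) dvd_rfl
    obtain ⟨β', hβ⟩ := hu.exists_right_inv
    refine ⟨t * β', ?_, ?_⟩
    · linear_combination β' * e - s * hβ
    · linear_combination - t * hβ
  · obtain ⟨c, rfl⟩ : α ∣ s := h.dvd_of_dvd_mul_right ⟨t, by linear_combination e⟩
    refine ⟨c, by ring, ?_⟩
    exact mul_left_cancel₀ hα (by linear_combination -e)

variable {k : Type} [Field k] {N m : ℕ}

theorem deg_split {α β c s t : MvPolynomial (Fin m) k} (h : IsRelPrime α β) (hs : s.IsHomogeneous 2) (ht : t.IsHomogeneous 2)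
    (e1 : s = c * α) (e2 : t = c * β) (hc : c ≠ 0) :
    ∃ d e, d + e = 2 ∧ α.IsHomogeneous d ∧ β.IsHomogeneous d ∧ c.IsHomogeneous e := by
  subst e1; subst e2
  by_cases hα : α = 0
  · subst hα
    have hu : IsUnit β := h (dvd_zero _) dvd_rfl
    obtain ⟨e, d, hde, h1, h2⟩ := hom_factor ht (mul_ne_zero hc hu.ne_zero)
    exact ⟨d, e, by omega, isHomogeneous_zero _ _ _, h2, h1⟩
  · obtain ⟨e, d, hde, h1, h2⟩ := hom_factor hs (mul_ne_zero hc hα)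
    by_cases hβ : β = 0
    · subst hβ; exact ⟨d, e, by omega, h2, isHomogeneous_zero _ _ _, h1⟩
    · obtain ⟨e', d', hde', h1', h2'⟩ := hom_factor ht (mul_ne_zero hc hβ)
      have : e = e' := h1.inj_right h1' hc
      have : d = d' := by omega
      subst this
      exact ⟨d, e, by omega, h2, h2', h1⟩

theorem sq_mem {x y : Fin N → k} {φ : (Fin N → k) →ₗ[k] (Fin m → k)}
    {σ : (Fin m → k) →ₗ[k] (Fin N → k)} (h1 : LinearMap.ker φ = Submodule.span k {x, y}) (h2 : ∀ w, φ (σ w) = w)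
    {s t : MvPolynomial (Fin N) k} (hs : sub φ s = 0) (ht : sub φ t = 0) :
    s * lin x + t * lin y ∈ ip (Submodule.span k {x, y}) * ip (Submodule.span k {x, y}) := by
  rw [ker_sub h1 h2] at hs ht
  exact add_mem (Ideal.mul_mem_mul hs (lin_mem_ip' (Submodule.subset_span (by simp)))) (Ideal.mul_mem_mul ht (lin_mem_ip' (Submodule.subset_span (by simp))))

theorem skew_zero {V₁ V₂ V₃ : Submodule k (Fin N → k)} {x y z w : Fin N → k} (h₁ : PB V₁ x y) (h₂ : PB V₂ z w)
    (d12 : V₂ ⊓ V₁ = ⊥) (d13 : V₃ ⊓ V₁ = ⊥) (d23 : V₂ ⊓ V₃ = ⊥) {f₁ f₂ : MvPolynomial (Fin N) k}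
    (hf₁ : f₁.IsHomogeneous 3) (hf₂ : f₂.IsHomogeneous 3) (h0 : f₁ ≠ 0) (hrel : IsRelPrime f₁ f₂)
    (h11 : f₁ ∈ ip V₁ * ip V₁) (h21 : f₂ ∈ ip V₁ * ip V₁) (h12 : f₁ ∈ ip V₂) (h22 : f₂ ∈ ip V₂) (h13 : f₁ ∈ ip V₃) (h23 : f₂ ∈ ip V₃) : False := by
  obtain ⟨e1, e1', E1⟩ := q_decomp h₁ h₂ d12 hf₁ h11 h12
  obtain ⟨e2, e2', E2⟩ := q_decomp h₁ h₂ d12 hf₂ h21 h22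
  have hD := det_mem h₂ d23 E1 E2 h13 h23
  refine det_ne hf₁ h0 hrel E1 E2 (qf_homog _ _ _) (qf_homog _ _ _) ?_
  obtain ⟨τ, t1, t2⟩ := exists_ret (by rw [inf_comm]; exact d13 : V₁ ⊓ V₃ = ⊥)
  have := sub_ip τ (W := ⊥) (fun v hv => by rw [t2 v hv]; exact Submodule.zero_mem _) hD
  rw [map_sub, map_mul, map_mul, sub_qf (t1 x h₁.hx) (t1 y h₁.hy), sub_qf (t1 x h₁.hx) (t1 y h₁.hy), sub_qf (t1 x h₁.hx) (t1 y h₁.hy), sub_qf (t1 x h₁.hx) (t1 y h₁.hy), ip_bot] at this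
  simpa using this

theorem exists_functional {V : Type} [AddCommGroup V] [Module k V] {U : Submodule k V} {v : V} (h : v ∉ U) :
    ∃ l : V →ₗ[k] k, l v ≠ 0 ∧ ∀ u ∈ U, l u = 0 := by
  obtain ⟨f, hf, hle⟩ := Submodule.exists_le_ker_of_notMem h
  exact ⟨f, hf, fun u hu => hle hu⟩

/-- the linear coefficient of a cubic through `V₂` lies in the image of `V₂` -/
theorem coef_mem {V₂ : Submodule k (Fin N → k)} {x y : Fin N → k} {φ : (Fin N → k) →ₗ[k] (Fin m → k)}
    {σ : (Fin m → k) →ₗ[k] (Fin N → k)} (h1 : LinearMap.ker φ = Submodule.span k {x, y}) (h2 : ∀ w, φ (σ w) = w)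
    (h₁ : PB (Submodule.span k {x, y}) x y) (d12 : V₂ ⊓ Submodule.span k {x, y} = ⊥) {s t c α β}
    (hs : sub φ s = c * α) (ht : sub φ t = c * β) (hm : s * lin x + t * lin y ∈ ip V₂)
    (hg : ¬ (α ∈ ip (V₂.map φ) ∧ β ∈ ip (V₂.map φ))) : c ∈ ip (V₂.map φ) := by
  obtain ⟨e, hs', ht'⟩ := skew_split h₁ d12 hm
  have hx : φ x = 0 := by rw [← LinearMap.mem_ker, h1]; exact h₁.hx
  have hy : φ y = 0 := by rw [← LinearMap.mem_ker, h1]; exact h₁.hy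
  have hs2 := sub_ip φ (W := V₂.map φ) (fun v hv => Submodule.mem_map_of_mem hv) hs'
  have ht2 := sub_ip φ (W := V₂.map φ) (fun v hv => Submodule.mem_map_of_mem hv) ht'
  rw [map_sub, map_mul, sub_lin, hy, map_zero, mul_zero, sub_zero, hs] at hs2
  rw [map_add, map_mul, sub_lin, hx, map_zero, mul_zero, add_zero, ht] at ht2
  have P := ip_prime (V₂.map φ)
  by_contra hc
  exact hg ⟨(P.mem_or_mem hs2).resolve_left hc, (P.mem_or_mem ht2).resolve_left hc⟩

theorem lin_add_smul (z w : Fin N → k) (a b : k) : lin (a • z + b • w) = C a * lin z + C b * lin w := by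
  rw [map_add, map_smul, map_smul, smul_eq_C_mul, smul_eq_C_mul]

theorem q_zero_aux {V₁ V₂ V₃ : Submodule k (Fin N → k)} {x y z w : Fin N → k} (h₁ : PB V₁ x y) (h₂ : PB V₂ z w)
    (d13 : V₃ ⊓ V₁ = ⊥) (d23 : V₂ ⊓ V₃ = ⊥) {e e' : Fin 3 → k} (hz : z ∉ V₁ ⊔ V₃)
    (hq : qf x y e * lin z + qf x y e' * lin w ∈ ip V₃) : qf x y e = 0 ∧ qf x y e' = 0 := by
  obtain ⟨a1, a2⟩ := h₂.not_mem_of_disj d23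
  have e2 : qf x y e' = 0 := by
    have : qf x y e' * lin w ∈ ip (V₃ ⊔ Submodule.span k {z}) := by
      have hz' : qf x y e * lin z ∈ ip (V₃ ⊔ Submodule.span k {z}) :=
        Ideal.mul_mem_left _ _ (lin_mem_ip' (Submodule.mem_sup_right (Submodule.mem_span_singleton_self z)))
      have := sub_mem (ip_mono le_sup_left hq) hz'
      simpa using this
    have := ((ip_prime _).mem_or_mem this).resolve_right (by rwa [lin_mem_ip])
    refine qf_zero_of_mem ?_ this
    rw [← h₁.eq, eq_bot_iff]
    rintro r ⟨hr1, hr2⟩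
    obtain ⟨v, hv, c, hc, rfl⟩ := Submodule.mem_sup.1 hr2
    obtain ⟨c, rfl⟩ := Submodule.mem_span_singleton.1 hc
    by_cases hc0 : c = 0
    · subst hc0
      have : v + (0:k) • z ∈ V₃ ⊓ V₁ := ⟨by simpa using hv, hr1⟩
      rwa [d13] at this
    · exfalso; apply hz
      have : z = c⁻¹ • ((v + c • z) - v) := by
        rw [add_sub_cancel_left, smul_smul, inv_mul_cancel₀ hc0, one_smul]
      rw [this]
      exact Submodule.smul_mem _ _ (sub_mem (Submodule.mem_sup_left hr1) (Submodule.mem_sup_right hv))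
  refine ⟨?_, e2⟩
  rw [e2, zero_mul, add_zero] at hq
  have := ((ip_prime _).mem_or_mem hq).resolve_right (by rwa [lin_mem_ip])
  refine qf_zero_of_mem ?_ this
  rw [← h₁.eq, inf_comm]; exact d13
end

end

section
open MvPolynomial Filter CategoryTheory
noncomputable section
variable {k : Type} [Field k] {N m : ℕ}

theorem good_setup {V₂ : Submodule k (Fin N → k)} {x y z w : Fin N → k} {φ : (Fin N → k) →ₗ[k] (Fin m → k)}
    {σ : (Fin m → k) →ₗ[k] (Fin N → k)} (h1 : LinearMap.ker φ = Submodule.span k {x, y}) (h2 : ∀ w, φ (σ w) = w)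
    (h₁ : PB (Submodule.span k {x, y}) x y) (h₂ : PB V₂ z w) (d12 : V₂ ⊓ Submodule.span k {x, y} = ⊥)
    {f s t : MvPolynomial (Fin N) k} (hf : f.IsHomogeneous 3) (e : f = s * lin x + t * lin y) (hm : f ∈ ip V₂)
    {c u v : Fin m → k} {u' v' z₀ : Fin N → k} (hs : sub φ s = lin c * lin u) (ht : sub φ t = lin c * lin v) 
    (hu : φ u' = u) (hv : φ v' = v) (hz : φ z₀ = c) (hz₀ : z₀ ∈ V₂) :
    ∃ e e', f = lin z₀ * (lin u' * lin x + lin v' * lin y) + (qf x y e * lin z + qf x y e' * lin w) := by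
  have hl := lin_homog (k := k) (N := N)
  obtain ⟨e1, e2, E⟩ := q_decomp h₁ h₂ d12 (q := f - lin z₀ * (lin u' * lin x + lin v' * lin y))
    (hf.sub (by simpa using (hl z₀).mul (((hl u').mul (hl x)).add ((hl v').mul (hl y))))) (by
      have : f - lin z₀ * (lin u' * lin x + lin v' * lin y) = (s - lin z₀ * lin u') * lin x + (t - lin z₀ * lin v') * lin y := by
        rw [e]; ring
      rw [this]
      refine sq_mem h1 h2 ?_ ?_
      · rw [map_sub, map_mul, sub_lin, sub_lin, hu, hz, hs, sub_self]
      · rw [map_sub, map_mul, sub_lin, sub_lin, hv, hz, ht, sub_self]) (sub_mem hm (Ideal.mul_mem_right _ _ (lin_mem_ip' hz₀)))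
  exact ⟨e1, e2, by rw [← E]; ring⟩

theorem good_lemma [Infinite k] {V₂ V₃ : Submodule k (Fin N → k)} {x y z w : Fin N → k} {φ : (Fin N → k) →ₗ[k] (Fin m → k)}
    {σ : (Fin m → k) →ₗ[k] (Fin N → k)} (h1 : LinearMap.ker φ = Submodule.span k {x, y}) (h2 : ∀ w, φ (σ w) = w)
    (h₁ : PB (Submodule.span k {x, y}) x y) (h₂ : PB V₂ z w) (hV₃ : Module.finrank k V₃ = 2)
    (d12 : V₂ ⊓ Submodule.span k {x, y} = ⊥) (d13 : V₃ ⊓ Submodule.span k {x, y} = ⊥) (d23 : V₂ ⊓ V₃ = ⊥) 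
    {f₁ f₂ s₁ t₁ s₂ t₂ : MvPolynomial (Fin N) k}
    (hf₁ : f₁.IsHomogeneous 3) (hf₂ : f₂.IsHomogeneous 3) (h0 : f₁ ≠ 0) (hrel : IsRelPrime f₁ f₂)
    (E₁ : f₁ = s₁ * lin x + t₁ * lin y) (E₂ : f₂ = s₂ * lin x + t₂ * lin y)
    {c₁ c₂ u v : Fin m → k} (hs₁ : sub φ s₁ = lin c₁ * lin u) (ht₁ : sub φ t₁ = lin c₁ * lin v) (hs₂ : sub φ s₂ = lin c₂ * lin u) (ht₂ : sub φ t₂ = lin c₂ * lin v) 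
    (h12 : f₁ ∈ ip V₂) (h22 : f₂ ∈ ip V₂) (h13 : f₁ ∈ ip V₃) (h23 : f₂ ∈ ip V₃) : 
    u ∈ V₂.map φ ∧ v ∈ V₂.map φ := by
  by_contra hg
  have hg' : ¬ (lin u ∈ ip (V₂.map φ) ∧ lin v ∈ ip (V₂.map φ)) := by rwa [lin_mem_ip, lin_mem_ip]
  have hc₁ := coef_mem h1 h2 h₁ d12 hs₁ ht₁ (E₁ ▸ h12) hg'
  have hc₂ := coef_mem h1 h2 h₁ d12 hs₂ ht₂ (E₂ ▸ h22) hg'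
  rw [lin_mem_ip] at hc₁ hc₂
  obtain ⟨z₁, hz₁, hzc₁⟩ := hc₁
  obtain ⟨z₂, hz₂, hzc₂⟩ := hc₂
  have hl := lin_homog (k := k) (N := N)
  have d13' : Submodule.span k {x, y} ⊓ V₃ = ⊥ := by rw [inf_comm]; exact d13
  by_cases hg3 : u ∈ V₃.map φ ∧ v ∈ V₃.map φ
  · obtain ⟨⟨u', hu'3, hu'⟩, ⟨v', hv'3, hv'⟩⟩ := hg3
    obtain ⟨e1, e1', Q1⟩ := good_setup h1 h2 h₁ h₂ d12 hf₁ E₁ h12 hs₁ ht₁ hu' hv' hzc₁ hz₁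
    obtain ⟨e2, e2', Q2⟩ := good_setup h1 h2 h₁ h₂ d12 hf₂ E₂ h22 hs₂ ht₂ hu' hv' hzc₂ hz₂
    have hF3 : lin u' * lin x + lin v' * lin y ∈ ip V₃ :=
      add_mem (Ideal.mul_mem_right _ _ (lin_mem_ip' hu'3)) (Ideal.mul_mem_right _ _ (lin_mem_ip' hv'3))
    have hF1 : lin u' * lin x + lin v' * lin y ∈ ip (Submodule.span k {x, y}) :=
      add_mem (Ideal.mul_mem_left _ _ (lin_mem_ip' h₁.hx)) (Ideal.mul_mem_left _ _ (lin_mem_ip' h₁.hy))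
    have hq1 : qf x y e1 * lin z + qf x y e1' * lin w ∈ ip V₃ := by
      have := sub_mem h13 (Ideal.mul_mem_left _ (lin z₁) hF3)
      rw [Q1] at this
      simpa using this
    have hq2 : qf x y e2 * lin z + qf x y e2' * lin w ∈ ip V₃ := by
      have := sub_mem h23 (Ideal.mul_mem_left _ (lin z₂) hF3)
      rw [Q2] at this
      simpa using this
    have fin : qf x y e1 = 0 ∧ qf x y e1' = 0 → qf x y e2 = 0 ∧ qf x y e2' = 0 → False := by
      rintro ⟨a1, a2⟩ ⟨a3, a4⟩
      rw [a1, a2] at Q1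
      rw [a3, a4] at Q2
      have : IsUnit (lin u' * lin x + lin v' * lin y) := hrel ⟨lin z₁, by rw [Q1]; ring⟩ ⟨lin z₂, by rw [Q2]; ring⟩
      exact (ip_prime _).ne_top (Ideal.eq_top_of_isUnit_mem _ hF1 this)
    by_cases hz : z ∈ Submodule.span k {x, y} ⊔ V₃
    · by_cases hw : w ∈ Submodule.span k {x, y} ⊔ V₃
      · apply hg
        have hle : Submodule.span k {x, y} ⊔ V₂ ≤ Submodule.span k {x, y} ⊔ V₃ := by
          refine sup_le le_sup_left ?_
          rw [h₂.eq, Submodule.span_le]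
          rintro _ (rfl | rfl) <;> assumption
        have heq := Submodule.eq_of_le_of_finrank_eq hle (by
          rw [skew_sup_finrank h₁.finrank h₂.finrank (by rw [inf_comm]; exact d12), skew_sup_finrank h₁.finrank hV₃ d13'])
        have key : ∀ r ∈ V₃, φ r ∈ V₂.map φ := by
          intro r hr
          have : r ∈ Submodule.span k {x, y} ⊔ V₂ := by rw [heq]; exact Submodule.mem_sup_right hr
          obtain ⟨p, hp, q, hq, rfl⟩ := Submodule.mem_sup.1 this
          rw [← h1, LinearMap.mem_ker] at hp
          rw [map_add, hp, zero_add]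
          exact Submodule.mem_map_of_mem hq
        exact ⟨hu' ▸ key _ hu'3, hv' ▸ key _ hv'3⟩
      · exact fin (q_zero_aux h₁ h₂.swap d13 d23 hw (by rw [add_comm]; exact hq1)).symm
          (q_zero_aux h₁ h₂.swap d13 d23 hw (by rw [add_comm]; exact hq2)).symm
    · exact fin (q_zero_aux h₁ h₂ d13 d23 hz hq1) (q_zero_aux h₁ h₂ d13 d23 hz hq2)
  · obtain ⟨e1, e1', Q1⟩ := good_setup h1 h2 h₁ h₂ d12 hf₁ E₁ h12 hs₁ ht₁ (h2 u) (h2 v) hzc₁ hz₁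
    obtain ⟨e2, e2', Q2⟩ := good_setup h1 h2 h₁ h₂ d12 hf₂ E₂ h22 hs₂ ht₂ (h2 u) (h2 v) hzc₂ hz₂
    rw [h₂.eq] at hz₁ hz₂
    obtain ⟨γ11, γ12, rfl⟩ := Submodule.mem_span_pair.1 hz₁
    obtain ⟨γ21, γ22, rfl⟩ := Submodule.mem_span_pair.1 hz₂
    have hFh : (lin (σ u) * lin x + lin (σ v) * lin y).IsHomogeneous 2 := ((hl _).mul (hl _)).add ((hl _).mul (hl _))
    set F := lin (σ u) * lin x + lin (σ v) * lin y with hF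
    rw [lin_add_smul] at Q1 Q2
    have hom : ∀ (γ : k) e, (C γ * F + qf x y e).IsHomogeneous 2 := by
      intro γ e
      refine IsHomogeneous.add ?_ (qf_homog _ _ _)
      simpa using (isHomogeneous_C (Fin N) γ).mul hFh
    have R1 : f₁ = (C γ11 * F + qf x y e1) * lin z + (C γ12 * F + qf x y e1') * lin w := by rw [Q1]; ring
    have R2 : f₂ = (C γ21 * F + qf x y e2) * lin z + (C γ22 * F + qf x y e2') * lin w := by rw [Q2]; ring
    have hD := det_mem h₂ d23 R1 R2 h13 h23
    refine det_ne hf₁ h0 hrel R1 R2 (hom _ _) (hom _ _) ?_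
    obtain ⟨τ, t1, t2⟩ := exists_ret d13'
    have hnot : ∀ r : Fin m → k, r ∉ V₃.map φ → σ r ∉ Submodule.span k {x, y} ⊔ V₃ := by
      intro r hr hmem
      apply hr
      obtain ⟨p, hp, q, hq, e⟩ := Submodule.mem_sup.1 hmem
      rw [← h1, LinearMap.mem_ker] at hp
      rw [← h2 r, ← e, map_add, hp, zero_add]
      exact Submodule.mem_map_of_mem hq
    have hlam : ∃ l : (Fin N → k) →ₗ[k] k, (l (σ u) ≠ 0 ∨ l (σ v) ≠ 0) ∧ ∀ r ∈ Submodule.span k {x, y} ⊔ V₃, l r = 0 := by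
      by_cases hu : u ∈ V₃.map φ
      · have hv : v ∉ V₃.map φ := fun hv => hg3 ⟨hu, hv⟩
        obtain ⟨l, h, h'⟩ := exists_functional (hnot v hv)
        exact ⟨l, Or.inr h, h'⟩
      · obtain ⟨l, h, h'⟩ := exists_functional (hnot u hu)
        exact ⟨l, Or.inl h, h'⟩
    obtain ⟨l, hl0, hl1⟩ := hlam
    set G := C (l (σ u)) * lin x * lin x + C (l (σ v)) * lin x * lin y with hG
    have hG0 : G ≠ 0 := by
      have : G = lin x * lin (l (σ u) • x + l (σ v) • y) := by rw [lin_add_smul, hG]; ring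
      rw [this]
      refine mul_ne_zero (by rw [Ne, lin_eq_zero]; exact h₁.ne) ?_
      rw [Ne, lin_eq_zero]
      intro h
      have := LinearIndependent.pair_iff.1 (PB.linInd h₁.ne h₁.nmem) _ _ h
      rcases hl0 with h | h
      · exact h this.1
      · exact h this.2
    set F₀ := lin (τ (σ u)) * lin x + lin (τ (σ v)) * lin y with hF₀
    let p : Polynomial (MvPolynomial (Fin N) k) := (Polynomial.C (C γ11) * Polynomial.X + Polynomial.C (qf x y e1)) * (Polynomial.C (C γ22) * Polynomial.X + Polynomial.C (qf x y e2'))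
      - (Polynomial.C (C γ12) * Polynomial.X + Polynomial.C (qf x y e1')) * (Polynomial.C (C γ21) * Polynomial.X + Polynomial.C (qf x y e2))
    have hev : ∀ T, p.eval T = (C γ11 * T + qf x y e1) * (C γ22 * T + qf x y e2') - (C γ12 * T + qf x y e1') * (C γ21 * T + qf x y e2) := by
      intro T; simp [p]
    have hroot : ∀ c : k, p.IsRoot (F₀ + C c * G) := by
      intro c
      let ψ : (Fin N → k) →ₗ[k] (Fin N → k) := τ + c • l.smulRight x
      have hψ : ∀ r, ψ r = τ r + (c * l r) • x := by
        intro r; simp [ψ, mul_smul]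
      have hx : ψ x = x := by rw [hψ, t1 x h₁.hx, hl1 x (Submodule.mem_sup_left h₁.hx)]; simp
      have hy : ψ y = y := by rw [hψ, t1 y h₁.hy, hl1 y (Submodule.mem_sup_left h₁.hy)]; simp
      have hC : ∀ c : k, sub ψ (C c) = C c := fun c => (sub ψ).commutes c
      have hFψ : sub ψ F = F₀ + C c * G := by
        rw [hF, map_add, map_mul, map_mul, sub_lin, sub_lin, sub_lin, sub_lin, hx, hy, hψ, hψ, map_add, map_add, map_smul, map_smul,
          smul_eq_C_mul, smul_eq_C_mul, C_mul, C_mul, hF₀, hG]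
        ring
      have := sub_ip ψ (W := ⊥) (fun r hr => by rw [hψ, t2 r hr, hl1 r (Submodule.mem_sup_right hr)]; simp) hD
      rw [ip_bot] at this
      simp only [map_sub, map_mul, map_add, sub_qf hx hy, hC, hFψ] at this
      rw [Polynomial.IsRoot.def, hev]
      simpa using this
    have hp0 : p = 0 := by
      refine Polynomial.eq_zero_of_infinite_isRoot p (Set.Infinite.mono (s := Set.range (fun c : k => F₀ + C c * G)) ?_ (Set.infinite_range_of_injective ?_))
      · rintro _ ⟨c, rfl⟩; exact hroot c
      · intro c c' h
        have := mul_right_cancel₀ hG0 (add_left_cancel h)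
        exact C_injective _ _ this
    rw [← hev, hp0, Polynomial.eval_zero]
end

end

section
open MvPolynomial Filter CategoryTheory
noncomputable section
variable {k : Type} [Field k] {N m : ℕ}

/-- full data on `K₁`. -/
structure SK (x y : Fin N → k) (φ : (Fin N → k) →ₗ[k] (Fin m → k)) (σ : (Fin m → k) →ₗ[k] (Fin N → k))
    (K : Ideal (MvPolynomial (Fin N) k)) (α β : MvPolynomial (Fin m) k) : Prop where
  h1 : LinearMap.ker φ = Submodule.span k {x, y}
  h2 : ∀ w, φ (σ w) = w
  rel : IsRelPrime α β
  le : K ≤ ip (Submodule.span k {x, y})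
  mem : ∀ s t, s * lin x + t * lin y ∈ K ↔ sub φ s * β = sub φ t * α

theorem SK.KS {x y : Fin N → k} {φ : (Fin N → k) →ₗ[k] (Fin m → k)} {σ : (Fin m → k) →ₗ[k] (Fin N → k)}
    {K : Ideal (MvPolynomial (Fin N) k)} {α β : MvPolynomial (Fin m) k} (h : SK x y φ σ K α β) : KS x y K (sub σ α) (sub σ β) := by
  refine ⟨h.le, fun s t => ?_, relprime_sub h.h1 h.h2 h.rel⟩
  rw [h.mem, ← ker_sub h.h1 h.h2, map_sub, map_mul, map_mul, sub_surj h.h2, sub_surj h.h2, sub_eq_zero]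

theorem SK.sq_le {x y : Fin N → k} {φ : (Fin N → k) →ₗ[k] (Fin m → k)} {σ : (Fin m → k) →ₗ[k] (Fin N → k)}
    {K : Ideal (MvPolynomial (Fin N) k)} {α β : MvPolynomial (Fin m) k} (h : SK x y φ σ K α β) :
    ip (Submodule.span k {x, y}) * ip (Submodule.span k {x, y}) ≤ K := by
  intro r hr
  have e : ip (Submodule.span k {x, y}) * ip (Submodule.span k {x, y}) = Ideal.span {lin x, lin y} * ip (Submodule.span k {x, y}) := by rw [← ip_pair]
  rw [e] at hr
  obtain ⟨s, hs, t, ht, rfl⟩ := mem_pair_mul.1 hr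
  rw [← ker_sub h.h1 h.h2] at hs ht
  rw [mul_comm _ s, mul_comm _ t, h.mem, hs, ht, zero_mul, zero_mul]

theorem SK.factor {x y : Fin N → k} {φ : (Fin N → k) →ₗ[k] (Fin m → k)} {σ : (Fin m → k) →ₗ[k] (Fin N → k)}
    {K : Ideal (MvPolynomial (Fin N) k)} {α β : MvPolynomial (Fin m) k} (h : SK x y φ σ K α β) {s t : MvPolynomial (Fin N) k}
    (hm : s * lin x + t * lin y ∈ K) : ∃ c, sub φ s = c * α ∧ sub φ t = c * β :=
  rel_factor h.rel ((h.mem s t).1 hm)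

theorem SK.H_eq {V₂ : Submodule k (Fin N → k)} {x y : Fin N → k} {φ : (Fin N → k) →ₗ[k] (Fin m → k)} {σ : (Fin m → k) →ₗ[k] (Fin N → k)}
    {K : Ideal (MvPolynomial (Fin N) k)} {α β : MvPolynomial (Fin m) k} (h : SK x y φ σ K α β) 
    (h₁ : PB (Submodule.span k {x, y}) x y) (d12 : V₂ ⊓ Submodule.span k {x, y} = ⊥)
    {A B : MvPolynomial (Fin N) k} {g : k} (hg : g ≠ 0) (hA : sub φ A = C g * α) (hB : sub φ B = C g * β) (hF : A * lin x + B * lin y ∈ ip V₂) :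
    K ⊓ ip V₂ = ip V₂ * (ip (Submodule.span k {x, y}) * ip (Submodule.span k {x, y})) ⊔ Ideal.span {A * lin x + B * lin y} := by
  have hFK : A * lin x + B * lin y ∈ K := by rw [h.mem, hA, hB]; ring
  apply le_antisymm
  · rintro r ⟨hr1, hr2⟩
    have hr3 := h.le hr1
    rw [ip_pair] at hr3
    obtain ⟨s, t, rfl⟩ := Ideal.mem_span_pair.1 hr3
    obtain ⟨c, hs, ht⟩ := h.factor hr1
    have hgg : (C g⁻¹ * C g : MvPolynomial (Fin m) k) = 1 := by rw [← C_mul, inv_mul_cancel₀ hg, C_1]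
    have hC : ∀ c : k, sub φ (C c) = C c := fun c => (sub φ).commutes c
    have e : s * lin x + t * lin y = ((s - sub σ c * C g⁻¹ * A) * lin x + (t - sub σ c * C g⁻¹ * B) * lin y) + (sub σ c * C g⁻¹) * (A * lin x + B * lin y) := by ring
    refine Submodule.mem_sup.2 ⟨_, ?_, _, Ideal.mul_mem_left _ (sub σ c * C g⁻¹) (Ideal.mem_span_singleton_self _), e.symm⟩
    rw [mul_comm (ip V₂), ← skew_inf2 h₁ d12]
    constructor
    · refine sq_mem h.h1 h.h2 ?_ ?_
      · rw [map_sub, map_mul, map_mul, sub_surj h.h2, hC, hs, hA]; linear_combination - c * α * hgg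
      · rw [map_sub, map_mul, map_mul, sub_surj h.h2, hC, ht, hB]; linear_combination - c * β * hgg
    · have := sub_mem hr2 (Ideal.mul_mem_left _ (sub σ c * C g⁻¹) hF)
      have e2 : (s - sub σ c * C g⁻¹ * A) * lin x + (t - sub σ c * C g⁻¹ * B) * lin y = s * lin x + t * lin y - sub σ c * C g⁻¹ * (A * lin x + B * lin y) := by ring
      rw [e2]; exact this
  · refine sup_le ?_ ?_
    · exact le_inf (Ideal.mul_le_right.trans h.sq_le) Ideal.mul_le_left
    · rw [Ideal.span_singleton_le_iff_mem]; exact ⟨hFK, hF⟩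

theorem SK.H_map {V₂ V₃ : Submodule k (Fin N → k)} {x y z w : Fin N → k} {φ : (Fin N → k) →ₗ[k] (Fin m → k)} {σ : (Fin m → k) →ₗ[k] (Fin N → k)}
    {K : Ideal (MvPolynomial (Fin N) k)} {α β : MvPolynomial (Fin m) k} (h : SK x y φ σ K α β) 
    (h₁ : PB (Submodule.span k {x, y}) x y) (h₂ : PB V₂ z w) (d12 : V₂ ⊓ Submodule.span k {x, y} = ⊥)
    {A B : MvPolynomial (Fin N) k} {g : k} (hg : g ≠ 0) (hA : sub φ A = C g * α) (hB : sub φ B = C g * β) (hF : A * lin x + B * lin y ∈ ip V₂) :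
    (K ⊓ ip V₂ : Ideal _).map (Ideal.Quotient.mk (ip V₃)) =
      (ip V₂).map (Ideal.Quotient.mk (ip V₃)) * ((ip (Submodule.span k {x, y})).map (Ideal.Quotient.mk (ip V₃)) * (ip (Submodule.span k {x, y})).map (Ideal.Quotient.mk (ip V₃)))
        ⊔ Ideal.span {Ideal.Quotient.mk (ip V₃) (A * lin x + B * lin y)} := by
  rw [h.H_eq h₁ d12 hg hA hB hF, Ideal.map_sup, Ideal.map_mul, Ideal.map_mul, Ideal.map_span, Set.image_singleton]

theorem map_eq_of_sup {U V W : Submodule k (Fin N → k)} (h : V ⊔ U = W ⊔ U) :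
    (ip V).map (Ideal.Quotient.mk (ip U)) = (ip W).map (Ideal.Quotient.mk (ip U)) := by
  ext r
  obtain ⟨r, rfl⟩ := Ideal.Quotient.mk_surjective r
  rw [mk_mem_map_ip, mk_mem_map_ip, h]

theorem mk_lin_ne {U : Submodule k (Fin N → k)} {v} (h : v ∉ U) : Ideal.Quotient.mk (ip U) (lin v) ≠ 0 := by
  rw [Ne, Ideal.Quotient.eq_zero_iff_mem, lin_mem_ip]; exact h

/-- `d = 2` -/
theorem skew_two {V₂ V₃ : Submodule k (Fin N → k)} {x y z w z' w' : Fin N → k} {φ : (Fin N → k) →ₗ[k] (Fin m → k)} {σ : (Fin m → k) →ₗ[k] (Fin N → k)}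
    {K : Ideal (MvPolynomial (Fin N) k)} {α β : MvPolynomial (Fin m) k} (h : SK x y φ σ K α β) 
    (h₁ : PB (Submodule.span k {x, y}) x y) (h₂ : PB V₂ z w) (h₃ : PB V₃ z' w') (d12 : V₂ ⊓ Submodule.span k {x, y} = ⊥)
    (d13 : V₃ ⊓ Submodule.span k {x, y} = ⊥) (d23 : V₂ ⊓ V₃ = ⊥)
    {A B : MvPolynomial (Fin N) k} {g : k} (hg : g ≠ 0) (hA : sub φ A = C g * α) (hB : sub φ B = C g * β) (hF : A * lin x + B * lin y ∈ ip V₂)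
    (hF3 : A * lin x + B * lin y ∈ ip V₃) : pdl (MvPolynomial (Fin N) k) ((K ⊓ ip V₂ : Ideal _).map (Ideal.Quotient.mk (ip V₃))) 4 := by
  have d13' : Submodule.span k {x, y} ⊓ V₃ = ⊥ := by rw [inf_comm]; exact d13
  rw [h.H_map h₁ h₂ d12 hg hA hB hF, Ideal.Quotient.eq_zero_iff_mem.2 hF3]
  have hr := h₁.relp d13'
  have hX := mk_lin_ne (h₁.not_mem_of_disj d13').1
  have hP := map_ip_prime V₃ (Submodule.span k {x, y})
  have e0 : Ideal.span {(0 : MvPolynomial (Fin N) k ⧸ ip V₃)} = ⊥ := by simp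
  rw [e0, sup_bot_eq]
  have hmem : ∀ v, Ideal.Quotient.mk (ip V₃) (lin v) ∈ (ip (Submodule.span k {x, y})).map (Ideal.Quotient.mk (ip V₃)) ↔ v ∈ Submodule.span k {x, y} ⊔ V₃ := by
    intro v; rw [mk_mem_map_ip, lin_mem_ip]
  by_cases hm : z ∈ Submodule.span k {x, y} ⊔ V₃ ∧ w ∈ Submodule.span k {x, y} ⊔ V₃
  · have : V₂ ⊔ V₃ = Submodule.span k {x, y} ⊔ V₃ := by
      apply Submodule.eq_of_le_of_finrank_eq
      · refine sup_le ?_ le_sup_right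
        rw [h₂.eq, Submodule.span_le]
        rintro _ (rfl | rfl)
        exacts [hm.1, hm.2]
      · rw [skew_sup_finrank h₂.finrank h₃.finrank d23, skew_sup_finrank h₁.finrank h₃.finrank d13']
    rw [map_eq_of_sup this, map_ip_pair h₁]
    exact pd_P3 h₃.pdB hr hX
  · have hm' : Ideal.Quotient.mk (ip V₃) (lin z) ∉ (ip (Submodule.span k {x, y})).map (Ideal.Quotient.mk (ip V₃)) ∨
      Ideal.Quotient.mk (ip V₃) (lin w) ∉ (ip (Submodule.span k {x, y})).map (Ideal.Quotient.mk (ip V₃)) := by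
      rw [hmem, hmem]; tauto
    rw [map_ip_pair h₁] at hP hm' ⊢
    rw [map_ip_pair h₂]
    exact pd_P2Z h₃.pdB hr hX hP (h₂.relp d23) hm'

theorem mk_C_unit {I : Ideal (MvPolynomial (Fin N) k)} {g : k} (hg : g ≠ 0) : IsUnit (Ideal.Quotient.mk I (C g)) :=
  ((IsUnit.mk0 g hg).map C).map _

/-- `d = 1` -/
theorem skew_one {V₂ V₃ : Submodule k (Fin N → k)} {x y z w z' w' : Fin N → k} {φ : (Fin N → k) →ₗ[k] (Fin m → k)} {σ : (Fin m → k) →ₗ[k] (Fin N → k)}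
    {K : Ideal (MvPolynomial (Fin N) k)} {u v : Fin m → k} (h : SK x y φ σ K (lin u) (lin v)) 
    (h₁ : PB (Submodule.span k {x, y}) x y) (h₂ : PB V₂ z w) (h₃ : PB V₃ z' w') (d12 : V₂ ⊓ Submodule.span k {x, y} = ⊥)
    (d13 : V₃ ⊓ Submodule.span k {x, y} = ⊥) (d23 : V₂ ⊓ V₃ = ⊥)
    (hg2 : u ∈ V₂.map φ ∧ v ∈ V₂.map φ) (hg3 : u ∈ V₃.map φ ∧ v ∈ V₃.map φ) : 
    pdl (MvPolynomial (Fin N) k) ((K ⊓ ip V₂ : Ideal _).map (Ideal.Quotient.mk (ip V₃))) 4 := by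
  have d13' : Submodule.span k {x, y} ⊓ V₃ = ⊥ := by rw [inf_comm]; exact d13
  obtain ⟨⟨u', hu'2, hu'⟩, ⟨v', hv'2, hv'⟩⟩ := hg2
  -- u, v span a plane
  have hnot1 : ∀ r : Fin m → k, ¬ IsUnit (lin r) := by
    intro r hr
    have : lin r ∈ ip (⊤ : Submodule k (Fin m → k)) := lin_mem_ip' trivial
    exact (ip_prime _).ne_top (Ideal.eq_top_of_isUnit_mem _ this hr)
  have hu0 : u ≠ 0 := by
    rintro rfl
    exact hnot1 v (h.rel (by rw [map_zero]; exact dvd_zero _) dvd_rfl)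
  have hvu : v ∉ Submodule.span k {u} := by
    intro hv
    obtain ⟨c, rfl⟩ := Submodule.mem_span_singleton.1 hv
    refine hnot1 u (h.rel dvd_rfl ?_)
    rw [map_smul, smul_eq_C_mul]; exact Dvd.intro_left _ rfl
  have hu'0 : u' ≠ 0 := by rintro rfl; rw [map_zero] at hu'; exact hu0 hu'.symm
  have hvu' : v' ∉ Submodule.span k {u'} := by
    intro hv
    obtain ⟨c, rfl⟩ := Submodule.mem_span_singleton.1 hv
    apply hvu
    rw [← hv', map_smul, hu']
    exact Submodule.smul_mem _ _ (Submodule.mem_span_singleton_self _)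
  have h₂' := pb_of_two h₂.finrank hu'2 hv'2 hu'0 hvu'
  have key : ∀ r : Fin N → k, φ r ∈ V₃.map φ → r ∈ Submodule.span k {x, y} ⊔ V₃ := by
    rintro r ⟨q, hq, e⟩
    have : r - q ∈ Submodule.span k {x, y} := by rw [← h.h1, LinearMap.mem_ker, map_sub, e, sub_self]
    have h3 := add_mem (Submodule.mem_sup_left (T := V₃) this) (Submodule.mem_sup_right hq)
    simpa using h3
  have hu'3 := key u' (by rw [hu']; exact hg3.1)
  have hv'3 := key v' (by rw [hv']; exact hg3.2)
  have hsup : V₂ ⊔ V₃ = Submodule.span k {x, y} ⊔ V₃ := by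
    apply Submodule.eq_of_le_of_finrank_eq
    · refine sup_le ?_ le_sup_right
      rw [h₂'.eq, Submodule.span_le]
      rintro _ (rfl | rfl)
      exacts [hu'3, hv'3]
    · rw [skew_sup_finrank h₂.finrank h₃.finrank d23, skew_sup_finrank h₁.finrank h₃.finrank d13']
  have hF2 : lin u' * lin x + lin v' * lin y ∈ ip V₂ :=
    add_mem (Ideal.mul_mem_right _ _ (lin_mem_ip' hu'2)) (Ideal.mul_mem_right _ _ (lin_mem_ip' hv'2))
  have hr := h₁.relp d13'
  have hX := mk_lin_ne (h₁.not_mem_of_disj d13').1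
  have hP := map_ip_prime V₃ (Submodule.span k {x, y})
  rw [h.H_map h₁ h₂ d12 (one_ne_zero) (by rw [sub_lin, hu', C_1, one_mul]) (by rw [sub_lin, hv', C_1, one_mul]) hF2, map_eq_of_sup hsup]
  have hrep : ∀ r ∈ Submodule.span k {x, y} ⊔ V₃, ∃ c d : k, Ideal.Quotient.mk (ip V₃) (lin r) =
      Ideal.Quotient.mk (ip V₃) (C c) * Ideal.Quotient.mk (ip V₃) (lin x) + Ideal.Quotient.mk (ip V₃) (C d) * Ideal.Quotient.mk (ip V₃) (lin y) := by
    intro r hr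
    obtain ⟨p, hp, q, hq, rfl⟩ := Submodule.mem_sup.1 hr
    obtain ⟨c, d, rfl⟩ := Submodule.mem_span_pair.1 hp
    refine ⟨c, d, ?_⟩
    rw [map_add lin, map_add (Ideal.Quotient.mk _), Ideal.Quotient.eq_zero_iff_mem.2 (lin_mem_ip' hq), lin_add_smul, map_add, map_mul, map_mul, add_zero]
  obtain ⟨c, d, hc⟩ := hrep _ hu'3
  obtain ⟨c', d', hc'⟩ := hrep _ hv'3
  rw [map_ip_pair h₁] at hP ⊢
  have hFe : Ideal.Quotient.mk (ip V₃) (lin u' * lin x + lin v' * lin y) =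
      Ideal.Quotient.mk (ip V₃) (C c) * Ideal.Quotient.mk (ip V₃) (lin x) ^ 2 + Ideal.Quotient.mk (ip V₃) (C (d + c')) * (Ideal.Quotient.mk (ip V₃) (lin x) * Ideal.Quotient.mk (ip V₃) (lin y))
        + Ideal.Quotient.mk (ip V₃) (C d') * Ideal.Quotient.mk (ip V₃) (lin y) ^ 2 := by
    rw [map_add, map_mul, map_mul, hc, hc', C_add, map_add]; ring
  by_cases hall : c = 0 ∧ d + c' = 0 ∧ d' = 0
  · obtain ⟨a1, a2, a3⟩ := hall
    have e0 : Ideal.span {(0 : MvPolynomial (Fin N) k ⧸ ip V₃)} = ⊥ := by simp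
    rw [hFe, a1, a2, a3, C_0, map_zero, zero_mul, zero_mul, zero_mul, add_zero, add_zero, e0, sup_bot_eq]
    exact pd_P3 h₃.pdB hr hX
  · rw [hFe]
    refine pd_P3F h₃.pdB hr hX (mem_P2.2 ⟨_, _, _, rfl⟩) ?_
    intro r hrr
    have hq := quasi_reg hr hX (e := r * Ideal.Quotient.mk (ip V₃) (C c)) (f := r * Ideal.Quotient.mk (ip V₃) (C (d + c'))) (g := r * Ideal.Quotient.mk (ip V₃) (C d'))
      (by convert hrr using 1; ring)
    have hunit : ∀ g : k, g ≠ 0 → r * Ideal.Quotient.mk (ip V₃) (C g) ∈ Ideal.span {Ideal.Quotient.mk (ip V₃) (lin x), Ideal.Quotient.mk (ip V₃) (lin y)} →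
        r ∈ Ideal.span {Ideal.Quotient.mk (ip V₃) (lin x), Ideal.Quotient.mk (ip V₃) (lin y)} := by
      intro g hg hm
      exact (Ideal.mul_unit_mem_iff_mem _ (mk_C_unit hg)).1 hm
    by_cases h1 : c = 0
    · by_cases h2 : d + c' = 0
      · exact hunit d' (fun h3 => hall ⟨h1, h2, h3⟩) hq.2.2
      · exact hunit _ h2 hq.2.1
    · exact hunit _ h1 hq.1
end

end

section
open MvPolynomial Filter CategoryTheory
noncomputable section
variable {k : Type} [Field k] {N m : ℕ}

/-- `d = 0` -/
theorem skew_deg0 {V₂ V₃ : Submodule k (Fin N → k)} {x y z w z' w' : Fin N → k} {φ : (Fin N → k) →ₗ[k] (Fin m → k)} {σ : (Fin m → k) →ₗ[k] (Fin N → k)}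
    {K : Ideal (MvPolynomial (Fin N) k)} {a b : k} (h : SK x y φ σ K (C a) (C b)) 
    (h₁ : PB (Submodule.span k {x, y}) x y) (h₂ : PB V₂ z w) (h₃ : PB V₃ z' w') (d12 : V₂ ⊓ Submodule.span k {x, y} = ⊥) : 
    pdl (MvPolynomial (Fin N) k) ((K ⊓ ip V₂ : Ideal _).map (Ideal.Quotient.mk (ip V₃))) 4 := by
  have d12' : Submodule.span k {x, y} ⊓ V₂ = ⊥ := by rw [inf_comm]; exact d12
  have hab : a ≠ 0 ∨ b ≠ 0 := by
    by_contra hcon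
    push Not at hcon
    obtain ⟨rfl, rfl⟩ := hcon
    have : IsUnit (C (0:k) : MvPolynomial (Fin m) k) := h.rel dvd_rfl dvd_rfl
    rw [C_0] at this
    exact not_isUnit_zero this
  have hx'1 : a • x + b • y ∈ Submodule.span k {x, y} := Submodule.mem_span_pair.2 ⟨a, b, rfl⟩
  have hx'0 : a • x + b • y ≠ 0 := by
    intro h0
    have := LinearIndependent.pair_iff.1 (PB.linInd h₁.ne h₁.nmem) _ _ h0
    rcases hab with h | h
    · exact h this.1
    · exact h this.2
  obtain ⟨y', hy'⟩ := pb_of_one h₁.finrank hx'1 hx'0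
  have hxl : lin (a • x + b • y) = C a * lin x + C b * lin y := lin_add_smul _ _ _ _
  obtain ⟨e, g, heg⟩ := Submodule.mem_span_pair.1 hy'.hy
  have hyl : lin y' = C e * lin x + C g * lin y := by rw [← heg]; exact lin_add_smul _ _ _ _
  have hΔ : e * b - g * a ≠ 0 := by
    intro h0
    apply hy'.nmem
    rw [Submodule.mem_span_singleton, ← heg]
    rcases hab with h | h
    · refine ⟨e * a⁻¹, ?_⟩
      rw [smul_add, smul_smul, smul_smul]
      congr 2
      · field_simp
      · field_simp; linear_combination h0
    · refine ⟨g * b⁻¹, ?_⟩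
      rw [smul_add, smul_smul, smul_smul]
      congr 2
      · field_simp; linear_combination -h0
      · field_simp
  have hC : ∀ c : k, sub φ (C c) = C c := fun c => (sub φ).commutes c
  have hxK : lin (a • x + b • y) ∈ K := by
    rw [hxl, h.mem, hC, hC]; ring
  set x' := a • x + b • y with hx'
  have hKe : K = Ideal.span {lin x', lin y' * lin y'} := by
    apply le_antisymm
    · intro r hr
      have hr1 := h.le hr
      rw [hy'.ip] at hr1
      obtain ⟨p, q, rfl⟩ := Ideal.mem_span_pair.1 hr1
      have hq : q * lin y' ∈ K := by
        have := sub_mem hr (Ideal.mul_mem_left _ p hxK)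
        simpa using this
      have e1 : q * lin y' = (q * C e) * lin x + (q * C g) * lin y := by rw [hyl]; ring
      rw [e1, h.mem, map_mul, map_mul, hC, hC] at hq
      have hq0 : sub φ q * C (e * b - g * a) = 0 := by
        rw [C_sub, C_mul, C_mul]; linear_combination hq
      have hq1 : sub φ q = 0 := (mul_eq_zero.1 hq0).resolve_right (by rw [C_eq_zero]; exact hΔ)
      rw [ker_sub h.h1 h.h2, hy'.ip] at hq1
      obtain ⟨q1, q2, rfl⟩ := Ideal.mem_span_pair.1 hq1
      exact Ideal.mem_span_pair.2 ⟨p + q1 * lin y', q2, by ring⟩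
    · rw [Ideal.span_le]
      rintro _ (rfl | rfl)
      · exact hxK
      · exact h.sq_le (Ideal.mul_mem_mul (lin_mem_ip' hy'.hy) (lin_mem_ip' hy'.hy))
  have hr : IsRelPrime (Ideal.Quotient.mk (ip V₂) (lin x')) (Ideal.Quotient.mk (ip V₂) (lin y' * lin y')) := by
    rw [map_mul]
    exact (hy'.relp d12').mul_right (hy'.relp d12')
  have h0 : lin y' * lin y' ∉ ip V₂ := by
    intro hh
    have : lin y' ∈ ip V₂ := by rcases (ip_prime V₂).mem_or_mem hh with h | h <;> exact h
    rw [lin_mem_ip] at this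
    exact (hy'.swap.not_mem_of_disj d12').1 this
  have hH : K ⊓ ip V₂ = Ideal.span {lin x', lin y' * lin y'} * ip V₂ := by
    rw [hKe]
    apply le_antisymm
    · rintro r ⟨hr1, hr2⟩
      obtain ⟨s, t, rfl⟩ := Ideal.mem_span_pair.1 hr1
      obtain ⟨s', hs', t', ht', E⟩ := syz_mod hr h0 hr2
      rw [E]
      exact mem_pair_mul.2 ⟨s', hs', t', ht', by ring⟩
    · exact Ideal.mul_le_inf
  rw [hH, Ideal.map_mul, map_span_pair]
  refine pdi_pair_prime h₃.pdB (map_ip_prime _ _) ?_ _ _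
  rw [map_ip_pair h₂]; exact pdi_two h₃.pdB _ _

theorem homog0 {p : MvPolynomial (Fin m) k} (h : p.IsHomogeneous 0) : ∃ c, p = C c :=
  ⟨_, totalDegree_eq_zero_iff_eq_C.1 ((totalDegree_zero_iff_isHomogeneous _).2 h)⟩

theorem skew_main [Infinite k] {V₂ V₃ : Submodule k (Fin N → k)} {x y z w z' w' : Fin N → k} {φ : (Fin N → k) →ₗ[k] (Fin m → k)} {σ : (Fin m → k) →ₗ[k] (Fin N → k)}
    {K : Ideal (MvPolynomial (Fin N) k)} {α β : MvPolynomial (Fin m) k} (h : SK x y φ σ K α β) 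
    (h₁ : PB (Submodule.span k {x, y}) x y) (h₂ : PB V₂ z w) (h₃ : PB V₃ z' w') (d12 : V₂ ⊓ Submodule.span k {x, y} = ⊥)
    (d13 : V₃ ⊓ Submodule.span k {x, y} = ⊥) (d23 : V₂ ⊓ V₃ = ⊥) {f₁ f₂ : MvPolynomial (Fin N) k}
    (hf₁ : f₁.IsHomogeneous 3) (hf₂ : f₂.IsHomogeneous 3) (h0 : f₁ ≠ 0) (h0' : f₂ ≠ 0) (hrel : IsRelPrime f₁ f₂)
    (hF1 : f₁ ∈ K ⊓ ip V₂ ⊓ ip V₃) (hF2 : f₂ ∈ K ⊓ ip V₂ ⊓ ip V₃) :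
    pdl (MvPolynomial (Fin N) k) (K ⊓ ip V₂ ⊓ ip V₃ : Ideal _) 3 := by
  refine stepB_mk _ (pd_KH h₁ h₂ d12 h.KS) ?_
  obtain ⟨s₁, t₁, hs₁, ht₁, E₁⟩ := cubic_decomp h₁ hf₁ (h.le hF1.1.1)
  obtain ⟨s₂, t₂, hs₂, ht₂, E₂⟩ := cubic_decomp h₁ hf₂ (h.le hF2.1.1)
  obtain ⟨c₁, a₁, b₁⟩ := h.factor (E₁ ▸ hF1.1.1)
  obtain ⟨c₂, a₂, b₂⟩ := h.factor (E₂ ▸ hF2.1.1)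
  -- the degree of the coefficients
  have D₁ := fun hc => deg_split h.rel (sub_homog φ hs₁) (sub_homog φ ht₁) a₁ b₁ hc
  have D₂ := fun hc => deg_split h.rel (sub_homog φ hs₂) (sub_homog φ ht₂) a₂ b₂ hc
  have two : ∀ (f s t : MvPolynomial (Fin N) k) (c : MvPolynomial (Fin m) k), f = s * lin x + t * lin y → sub φ s = c * α → sub φ t = c * β → c ≠ 0 → c.IsHomogeneous 0 →
      f ∈ K ⊓ ip V₂ ⊓ ip V₃ → pdl (MvPolynomial (Fin N) k) ((K ⊓ ip V₂ : Ideal _).map (Ideal.Quotient.mk (ip V₃))) 4 := by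
    intro f s t c E hs ht hc hc0 hf
    obtain ⟨g, rfl⟩ := homog0 hc0
    have hg : g ≠ 0 := by rintro rfl; exact hc C_0
    rw [E] at hf
    exact skew_two h h₁ h₂ h₃ d12 d13 d23 hg hs ht hf.1.2 hf.2
  have hdeg : ∀ d e, d + e = 2 → α.IsHomogeneous d → β.IsHomogeneous d → (c₁ ≠ 0 → c₁.IsHomogeneous e) → (c₂ ≠ 0 → c₂.IsHomogeneous e) → (c₁ ≠ 0 ∨ c₂ ≠ 0) →
      pdl (MvPolynomial (Fin N) k) ((K ⊓ ip V₂ : Ideal _).map (Ideal.Quotient.mk (ip V₃))) 4 := by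
    intro d e hde hα hβ hc1 hc2 hne
    have hd : d = 0 ∨ d = 1 ∨ d = 2 := by omega
    rcases hd with rfl | rfl | rfl
    · obtain ⟨a, rfl⟩ := homog0 hα
      obtain ⟨b, rfl⟩ := homog0 hβ
      exact skew_deg0 h h₁ h₂ h₃ d12
    · have he : e = 1 := by omega
      subst he
      have hl : ∀ c : MvPolynomial (Fin m) k, (c ≠ 0 → c.IsHomogeneous 1) → ∃ r, c = lin r := by
        intro c hc
        by_cases h0 : c = 0
        · exact ⟨0, by rw [h0, map_zero]⟩
        · exact exists_lin (hc h0)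
      obtain ⟨r₁, rfl⟩ := hl _ hc1
      obtain ⟨r₂, rfl⟩ := hl _ hc2
      obtain ⟨u, rfl⟩ := exists_lin hα
      obtain ⟨v, rfl⟩ := exists_lin hβ
      refine skew_one h h₁ h₂ h₃ d12 d13 d23 ?_ ?_
      · exact good_lemma h.h1 h.h2 h₁ h₂ h₃.finrank d12 d13 d23 hf₁ hf₂ h0 hrel E₁ E₂ a₁ b₁ a₂ b₂ hF1.1.2 hF2.1.2 hF1.2 hF2.2
      · exact good_lemma h.h1 h.h2 h₁ h₃ h₂.finrank d13 d12 (by rw [inf_comm]; exact d23) hf₁ hf₂ h0 hrel E₁ E₂ a₁ b₁ a₂ b₂ hF1.2 hF2.2 hF1.1.2 hF2.1.2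
    · have he : e = 0 := by omega
      subst he
      rcases hne with hne | hne
      · exact two f₁ s₁ t₁ c₁ E₁ a₁ b₁ hne (hc1 hne) hF1
      · exact two f₂ s₂ t₂ c₂ E₂ a₂ b₂ hne (hc2 hne) hF2
  have huniq : ∀ d d', α.IsHomogeneous d → β.IsHomogeneous d → α.IsHomogeneous d' → β.IsHomogeneous d' → d = d' := by
    intro d d' q1 q2 q3 q4
    by_cases hα : α = 0
    · have hβ : β ≠ 0 := by
        intro hβ
        have := h.rel (d := (0 : MvPolynomial (Fin m) k)) (by rw [hα]) (by rw [hβ])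
        exact not_isUnit_zero this
      exact q2.inj_right q4 hβ
    · exact q1.inj_right q3 hα
  by_cases hc1 : c₁ = 0
  · by_cases hc2 : c₂ = 0
    · exfalso
      rw [hc1, zero_mul] at a₁ b₁
      rw [hc2, zero_mul] at a₂ b₂
      refine skew_zero h₁ h₂ d12 d13 d23 hf₁ hf₂ h0 hrel ?_ ?_ hF1.1.2 hF2.1.2 hF1.2 hF2.2
      · rw [E₁]; exact sq_mem h.h1 h.h2 a₁ b₁
      · rw [E₂]; exact sq_mem h.h1 h.h2 a₂ b₂
    · obtain ⟨d, e, hde, q1, q2, q3⟩ := D₂ hc2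
      exact hdeg d e hde q1 q2 (fun hh => absurd hc1 hh) (fun _ => q3) (Or.inr hc2)
  · obtain ⟨d, e, hde, q1, q2, q3⟩ := D₁ hc1
    refine hdeg d e hde q1 q2 (fun _ => q3) (fun hh => ?_) (Or.inl hc1)
    obtain ⟨d', e', hde', q1', q2', q3'⟩ := D₂ hh
    have : d = d' := huniq d d' q1 q2 q1' q2'
    have : e' = e := by omega
    rwa [← this]
end

end

section
open MvPolynomial Filter CategoryTheory
noncomputable section
variable {k : Type} [Field k] {N m : ℕ}

theorem exists_SK {V₁ : Submodule k (Fin N → k)} {x y : Fin N → k} (h : PB V₁ x y) (K : Ideal (MvPolynomial (Fin N) k))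
    (hprim : K.IsPrimary) (hrad : K.radical = ip V₁) (hm : HasMultiplicity K (N - 2) 2) :
    ∃ (m : ℕ) (φ : (Fin N → k) →ₗ[k] (Fin m → k)) (σ : (Fin m → k) →ₗ[k] (Fin N → k)) (α β : MvPolynomial (Fin m) k),
      SK x y φ σ K α β := by
  obtain ⟨m, φ, σ, hN, h1, h2⟩ := exists_proj V₁
  have hm' : m = N - 2 := by rw [h.finrank] at hN; omega
  rw [← hm'] at hm
  have e := h.eq
  subst e
  obtain ⟨α, β, hr, hmem⟩ := K1_struct h1 h2 K hprim hrad hm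
  exact ⟨m, φ, σ, α, β, h1, h2, hr, hrad ▸ Ideal.le_radical, hmem⟩

theorem not_span_of {V₃ : Submodule k (Fin N → k)} {x y : Fin N → k} (hx : x ∉ V₃) (hy : y ∈ V₃) (h0 : y ≠ 0) :
    y ∉ Submodule.span k {x} := by
  intro h
  obtain ⟨c, rfl⟩ := Submodule.mem_span_singleton.1 h
  have hc : c ≠ 0 := by rintro rfl; exact h0 (zero_smul _ _)
  exact hx ((Submodule.smul_mem_iff _ hc).1 hy)

theorem choose_II {V₁ V₂ V₃ : Submodule k (Fin N → k)} (r1 : Module.finrank k V₁ = 2) (r2 : Module.finrank k V₂ = 2)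
    (h : V₁ ⊓ V₂ ≠ ⊥) : ∃ x y z, PB V₁ x y ∧ PB V₂ x z ∧ ((V₁ ⊓ V₃ = ⊥ ∧ V₂ ⊓ V₃ = ⊥) ∨ (x ∈ V₃ ∨ y ∈ V₃ ∨ z ∈ V₃)) := by
  obtain ⟨x, ⟨hx1, hx2⟩, hx0⟩ := Submodule.exists_mem_ne_zero_of_ne_bot h
  obtain ⟨y, hy⟩ := pb_of_one r1 hx1 hx0
  obtain ⟨z, hz⟩ := pb_of_one r2 hx2 hx0
  by_cases hx3 : x ∈ V₃
  · exact ⟨x, y, z, hy, hz, Or.inr (Or.inl hx3)⟩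
  by_cases h13 : V₁ ⊓ V₃ = ⊥
  · by_cases h23 : V₂ ⊓ V₃ = ⊥
    · exact ⟨x, y, z, hy, hz, Or.inl ⟨h13, h23⟩⟩
    · obtain ⟨z, ⟨hz1, hz2⟩, hz0⟩ := Submodule.exists_mem_ne_zero_of_ne_bot h23
      exact ⟨x, y, z, hy, pb_of_two r2 hx2 hz1 hx0 (not_span_of hx3 hz2 hz0), Or.inr (Or.inr (Or.inr hz2))⟩
  · obtain ⟨y, ⟨hy1, hy2⟩, hy0⟩ := Submodule.exists_mem_ne_zero_of_ne_bot h13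
    exact ⟨x, y, z, pb_of_two r1 hx1 hy1 hx0 (not_span_of hx3 hy2 hy0), hz, Or.inr (Or.inr (Or.inl hy2))⟩

theorem main_II {V₁ V₂ V₃ : Submodule k (Fin N → k)} (r1 : Module.finrank k V₁ = 2) (r2 : Module.finrank k V₂ = 2)
    (r3 : Module.finrank k V₃ = 2) (h12 : V₁ ≠ V₂) (h13 : V₁ ≠ V₃) (h23 : V₂ ≠ V₃) (h : V₁ ⊓ V₂ ≠ ⊥)
    (K : Ideal (MvPolynomial (Fin N) k)) (hprim : K.IsPrimary) (hrad : K.radical = ip V₁) (hm : HasMultiplicity K (N - 2) 2)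
    {f₁ f₂ : MvPolynomial (Fin N) k} (hrel : IsRelPrime f₁ f₂) (h0 : f₁ ≠ 0) (h0' : f₂ ≠ 0)
    (hF1 : f₁ ∈ K ⊓ ip V₂ ⊓ ip V₃) (hF2 : f₂ ∈ K ⊓ ip V₂ ⊓ ip V₃) :
    pdl (MvPolynomial (Fin N) k) (col (Ideal.span {f₁, f₂}) (K ⊓ ip V₂ ⊓ ip V₃)) 2 ∧
      pdl (MvPolynomial (Fin N) k) (K ⊓ ip V₂ ⊓ ip V₃ : Ideal _) 3 := by
  obtain ⟨x, y, z, hy, hz, hc⟩ := choose_II (V₃ := V₃) r1 r2 h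
  obtain ⟨z', w', h₃⟩ := exists_pb r3
  obtain ⟨m, φ, σ, α, β, hS⟩ := exists_SK hy K hprim hrad hm
  have hF : Ideal.span {f₁, f₂} ≤ K ⊓ ip V₂ ⊓ ip V₃ := by
    rw [Ideal.span_le]; rintro _ (rfl | rfl) <;> assumption
  have e := hy.eq
  subst e
  exact ⟨caseA_II hy hz h₃ h12 h13 h23 hS.KS hc hrel h0 h0' hF, caseB_II hy hz h₃ h12 h13 h23 hS.KS hc⟩

theorem main_I [Infinite k] {V₁ V₂ V₃ : Submodule k (Fin N → k)} (r1 : Module.finrank k V₁ = 2) (r2 : Module.finrank k V₂ = 2)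
    (r3 : Module.finrank k V₃ = 2) (h23 : V₂ ≠ V₃) (d12 : V₂ ⊓ V₁ = ⊥) (d13 : V₃ ⊓ V₁ = ⊥)
    (K : Ideal (MvPolynomial (Fin N) k)) (hprim : K.IsPrimary) (hrad : K.radical = ip V₁) (hm : HasMultiplicity K (N - 2) 2)
    {f₁ f₂ : MvPolynomial (Fin N) k} (hf₁ : f₁.IsHomogeneous 3) (hf₂ : f₂.IsHomogeneous 3) (hrel : IsRelPrime f₁ f₂) (h0 : f₁ ≠ 0) (h0' : f₂ ≠ 0)
    (hF1 : f₁ ∈ K ⊓ ip V₂ ⊓ ip V₃) (hF2 : f₂ ∈ K ⊓ ip V₂ ⊓ ip V₃) :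
    pdl (MvPolynomial (Fin N) k) (col (Ideal.span {f₁, f₂}) (K ⊓ ip V₂ ⊓ ip V₃)) 2 ∧
      pdl (MvPolynomial (Fin N) k) (K ⊓ ip V₂ ⊓ ip V₃ : Ideal _) 3 := by
  obtain ⟨x, y, h₁⟩ := exists_pb r1
  obtain ⟨z, w, h₂⟩ := exists_pb r2
  obtain ⟨z', w', h₃⟩ := exists_pb r3
  obtain ⟨m, φ, σ, α, β, hS⟩ := exists_SK h₁ K hprim hrad hm
  have hF : Ideal.span {f₁, f₂} ≤ K ⊓ ip V₂ ⊓ ip V₃ := by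
    rw [Ideal.span_le]; rintro _ (rfl | rfl) <;> assumption
  have e := h₁.eq
  subst e
  refine ⟨caseA_I h₁ h₂ h₃ d12 d13 h23 hS.KS hrel h0 h0' hF, ?_⟩
  by_cases d23 : V₂ ⊓ V₃ = ⊥
  · exact skew_main hS h₁ h₂ h₃ d12 d13 d23 hf₁ hf₂ h0 h0' hrel hF1 hF2
  · obtain ⟨l, ⟨hl2, hl3⟩, hl0⟩ := Submodule.exists_mem_ne_zero_of_ne_bot d23
    obtain ⟨u, hu⟩ := pb_of_one r2 hl2 hl0
    obtain ⟨v, hv⟩ := pb_of_one r3 hl3 hl0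
    exact caseB_I_edge h₁ hu hv d12 d13 h23 hS.KS

theorem main_all [Infinite k] {V₁ V₂ V₃ : Submodule k (Fin N → k)} (r1 : Module.finrank k V₁ = 2) (r2 : Module.finrank k V₂ = 2)
    (r3 : Module.finrank k V₃ = 2) (h12 : V₁ ≠ V₂) (h13 : V₁ ≠ V₃) (h23 : V₂ ≠ V₃)
    (K : Ideal (MvPolynomial (Fin N) k)) (hprim : K.IsPrimary) (hrad : K.radical = ip V₁) (hm : HasMultiplicity K (N - 2) 2)
    {f₁ f₂ : MvPolynomial (Fin N) k} (hf₁ : f₁.IsHomogeneous 3) (hf₂ : f₂.IsHomogeneous 3) (hrel : IsRelPrime f₁ f₂) (h0 : f₁ ≠ 0) (h0' : f₂ ≠ 0)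
    (hF1 : f₁ ∈ K ⊓ ip V₂ ⊓ ip V₃) (hF2 : f₂ ∈ K ⊓ ip V₂ ⊓ ip V₃) :
    pdl (MvPolynomial (Fin N) k) (col (Ideal.span {f₁, f₂}) (K ⊓ ip V₂ ⊓ ip V₃)) 2 ∧
      pdl (MvPolynomial (Fin N) k) (K ⊓ ip V₂ ⊓ ip V₃ : Ideal _) 3 := by
  by_cases d12 : V₁ ⊓ V₂ = ⊥
  · by_cases d13 : V₁ ⊓ V₃ = ⊥
    · exact main_I r1 r2 r3 h23 (by rw [inf_comm]; exact d12) (by rw [inf_comm]; exact d13) K hprim hrad hm hf₁ hf₂ hrel h0 h0' hF1 hF2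
    · rw [inf_right_comm] at hF1 hF2 ⊢
      exact main_II r1 r3 r2 h13 h12 h23.symm d13 K hprim hrad hm hrel h0 h0' hF1 hF2
  · exact main_II r1 r2 r3 h12 h13 h23 d12 K hprim hrad hm hrel h0 h0' hF1 hF2

theorem main_final [IsAlgClosed k]
    (f₁ f₂ f₃ : MvPolynomial (Fin N) k)
    (hf₁ : f₁.IsHomogeneous 3) (hf₂ : f₂.IsHomogeneous 3)
    (hIht : idealHeight (Ideal.span {f₁, f₂, f₃}) = 2)
    (hht₁₂ : idealHeight (Ideal.span {f₁, f₂}) = 2)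
    (p₁ p₂ p₃ : Ideal (MvPolynomial (Fin N) k))
    (hp₁ : IsLinearPrime p₁) (hp₂ : IsLinearPrime p₂) (hp₃ : IsLinearPrime p₃)
    (hpht₁ : idealHeight p₁ = 2) (hpht₂ : idealHeight p₂ = 2) (hpht₃ : idealHeight p₃ = 2)
    (hne₁₂ : p₁ ≠ p₂) (hne₁₃ : p₁ ≠ p₃) (hne₂₃ : p₂ ≠ p₃)
    (K₁ : Ideal (MvPolynomial (Fin N) k))
    (hK₁primary : K₁.IsPrimary) (hK₁rad : K₁.radical = p₁)
    (hK₁e : HasMultiplicity K₁ (N - 2) 2)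
    (hK : K₁ ⊓ p₂ ⊓ p₃ = unmixedPart (Ideal.span {f₁, f₂, f₃}) ∨ K₁ ⊓ p₂ ⊓ p₃ = Submodule.colon (Ideal.span {f₁, f₂}) (Ideal.span {f₃})) :
    pdQuotLE (Ideal.span {f₁, f₂, f₃}) 5 := by
  have : Infinite k := inferInstance
  obtain ⟨V₁, rfl⟩ := exists_ip_of_linearPrime hp₁
  obtain ⟨V₂, rfl⟩ := exists_ip_of_linearPrime hp₂
  obtain ⟨V₃, rfl⟩ := exists_ip_of_linearPrime hp₃
  rw [idealHeight_eq] at hIht hht₁₂ hpht₁ hpht₂ hpht₃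
  have r1 := finrank_of_height hpht₁
  have r2 := finrank_of_height hpht₂
  have r3 := finrank_of_height hpht₃
  have n12 : V₁ ≠ V₂ := by rintro rfl; exact hne₁₂ rfl
  have n13 : V₁ ≠ V₃ := by rintro rfl; exact hne₁₃ rfl
  have n23 : V₂ ≠ V₃ := by rintro rfl; exact hne₂₃ rfl
  obtain ⟨hrel, h0, h0'⟩ := relprime_of_height hht₁₂
  apply pdQuotLE_of_pdl
  rcases hK with hK | hK
  · have hF1 : f₁ ∈ K₁ ⊓ ip V₂ ⊓ ip V₃ := by
      rw [hK]; exact le_unmixedPart _ (Ideal.subset_span (by simp))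
    have hF2 : f₂ ∈ K₁ ⊓ ip V₂ ⊓ ip V₃ := by
      rw [hK]; exact le_unmixedPart _ (Ideal.subset_span (by simp))
    have := (main_all r1 r2 r3 n12 n13 n23 K₁ hK₁primary hK₁rad hK₁e hf₁ hf₂ hrel h0 h0' hF1 hF2).1
    rw [hK] at this
    exact pdl_final f₁ f₂ f₃ _ (colon_unmixed f₁ f₂ f₃ hf₁ (by norm_num) hIht hht₁₂) (pdl_mono this (by norm_num))
  · have hL : ∀ r, r ∈ K₁ ⊓ ip V₂ ⊓ ip V₃ ↔ r * f₃ ∈ Ideal.span {f₁, f₂} := by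
      intro r
      rw [hK, Submodule.mem_colon]
      constructor
      · intro h; exact h f₃ (Ideal.subset_span (by simp))
      · intro h s hs
        obtain ⟨c, rfl⟩ := Ideal.mem_span_singleton'.1 hs
        rw [smul_eq_mul, mul_left_comm]
        exact Ideal.mul_mem_left _ _ h
    have hF1 : f₁ ∈ K₁ ⊓ ip V₂ ⊓ ip V₃ := (hL _).2 (Ideal.mul_mem_right _ _ (Ideal.subset_span (by simp)))
    have hF2 : f₂ ∈ K₁ ⊓ ip V₂ ⊓ ip V₃ := (hL _).2 (Ideal.mul_mem_right _ _ (Ideal.subset_span (by simp)))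
    exact pdl_final f₁ f₂ f₃ _ hL (main_all r1 r2 r3 n12 n13 n23 K₁ hK₁primary hK₁rad hK₁e hf₁ hf₂ hrel h0 h0' hF1 hF2).2
end

end

theorem statement_16
    {k : Type} [Field k] [IsAlgClosed k] {N : ℕ}
    (f₁ f₂ f₃ : MvPolynomial (Fin N) k)
    (hf₁ : f₁.IsHomogeneous 3) (hf₂ : f₂.IsHomogeneous 3) (hf₃ : f₃.IsHomogeneous 3)
    (hIht : idealHeight (Ideal.span {f₁, f₂, f₃}) = 2)
    (hht₁₂ : idealHeight (Ideal.span {f₁, f₂}) = 2)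
    (hht₁₃ : idealHeight (Ideal.span {f₁, f₃}) = 2)
    (hht₂₃ : idealHeight (Ideal.span {f₂, f₃}) = 2)
    (p₁ p₂ p₃ : Ideal (MvPolynomial (Fin N) k))
    (hp₁ : IsLinearPrime p₁) (hp₂ : IsLinearPrime p₂) (hp₃ : IsLinearPrime p₃)
    (hpht₁ : idealHeight p₁ = 2) (hpht₂ : idealHeight p₂ = 2) (hpht₃ : idealHeight p₃ = 2)
    (hne₁₂ : p₁ ≠ p₂) (hne₁₃ : p₁ ≠ p₃) (hne₂₃ : p₂ ≠ p₃)
    (K₁ : Ideal (MvPolynomial (Fin N) k))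
    (hK₁primary : K₁.IsPrimary) (hK₁rad : K₁.radical = p₁)
    (hK₁e : HasMultiplicity K₁ (N - 2) 2)
    (hK : K₁ ⊓ p₂ ⊓ p₃ = unmixedPart (Ideal.span {f₁, f₂, f₃}) ∨ K₁ ⊓ p₂ ⊓ p₃ = Submodule.colon (Ideal.span {f₁, f₂}) (Ideal.span {f₃})) :
    pdQuotLE (Ideal.span {f₁, f₂, f₃}) 5 := by
  exact main_final f₁ f₂ f₃ hf₁ hf₂ hIht hht₁₂ p₁ p₂ p₃ hp₁ hp₂ hp₃ hpht₁ hpht₂ hpht₃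
    hne₁₂ hne₁₃ hne₂₃ K₁ hK₁primary hK₁rad hK₁e hK

end
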